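/- Assume the Riemann Hypothesis. Then there exists a Borel probability measure μ_M on ℝ such that for every bounded continuous function f : ℝ → ℝ, lim_{x→∞} (1/log x) ∫_2^x f(E_M(t)) dt/t = ∫_ℝ f dμ_M. -/

import Mathlib

open Filter MeasureTheory Real Set

/-- The Mertens product `∏_{p ≤ x} (1 - 1/p)⁻¹`. -/
noncomputable def mertensProd (x : ℝ) : ℝ :=
  ∏ p ∈ Finset.filter Nat.Prime (Finset.Iic ⌊x⌋₊), ((1 : ℝ) - 1 / p)⁻¹

/-- `E_M(x) = √x log x (log ∏_{p≤x}(1-1/p)⁻¹ - log log x - γ)`. -/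
noncomputable def EM (x : ℝ) : ℝ :=
  Real.sqrt x * Real.log x *
    (Real.log (mertensProd x) - Real.log (Real.log x) - Real.eulerMascheroniConstant)

/-- The Laplace transform `∫_0^∞ u(y) e^{-sy} dy`. -/
noncomputable def laplace (u : ℝ → ℂ) (s : ℂ) : ℂ :=
  ∫ y in Ioi (0 : ℝ), u y * Complex.exp (-s * y)

/-- The Laplace transform of `u` converges absolutely on the half plane `a < re s`. -/
def LaplaceConv (a : ℝ) (u : ℝ → ℂ) : Prop :=
  ∀ σ : ℝ, a < σ → IntegrableOn (fun y : ℝ => u y * Complex.exp (-(σ : ℂ) * y)) (Ioi 0)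

lemma norm_exp_neg_mul (s : ℂ) (y : ℝ) : ‖Complex.exp (-s * y)‖ = Real.exp (-s.re * y) := by
  simp [Complex.norm_exp]

lemma LaplaceConv.aestronglyMeasurable {a : ℝ} {u : ℝ → ℂ} (h : LaplaceConv a u) :
    AEStronglyMeasurable u (volume.restrict (Ioi 0)) := by
  have h1 := (h (a + 1) (by linarith)).aestronglyMeasurable
  have h2 : AEStronglyMeasurable (fun y : ℝ => Complex.exp (((a + 1 : ℝ) : ℂ) * y))
      (volume.restrict (Ioi (0 : ℝ))) := by
    apply Continuous.aestronglyMeasurable; fun_prop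
  refine (h1.mul h2).congr (ae_of_all _ fun y => ?_)
  simp only [Pi.mul_apply]
  rw [mul_assoc, ← Complex.exp_add, neg_mul, neg_add_cancel, Complex.exp_zero, mul_one]

lemma LaplaceConv.integrableOn {a : ℝ} {u : ℝ → ℂ} (h : LaplaceConv a u) {s : ℂ} (hs : a < s.re) :
    IntegrableOn (fun y : ℝ => u y * Complex.exp (-s * y)) (Ioi 0) := by
  have h1 : Integrable (fun y : ℝ => u y * Complex.exp (-(s.re : ℂ) * y))
      (volume.restrict (Ioi 0)) := h s.re hs
  refine h1.mono (h.aestronglyMeasurable.mul ?_) (ae_of_all _ fun y => ?_)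
  · apply Continuous.aestronglyMeasurable; fun_prop
  · simp only [norm_mul, norm_exp_neg_mul, Complex.ofReal_re, le_refl]

lemma LaplaceConv.integrableOn_norm {a : ℝ} {u : ℝ → ℂ} (h : LaplaceConv a u) {σ : ℝ}
    (hs : a < σ) : IntegrableOn (fun y : ℝ => ‖u y‖ * Real.exp (-σ * y)) (Ioi 0) := by
  refine (h σ hs).norm.congr (ae_of_all _ fun y => ?_)
  simp only [norm_mul, norm_exp_neg_mul, Complex.ofReal_re]

lemma LaplaceConv.mono {a b : ℝ} {u : ℝ → ℂ} (h : LaplaceConv a u) (hab : a ≤ b) :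
    LaplaceConv b u := fun σ hσ => h σ (hab.trans_lt hσ)

lemma mul_exp_neg_le {ε : ℝ} (hε : 0 < ε) (y : ℝ) : y * Real.exp (-ε * y) ≤ 1 / ε := by
  have h1 : ε * y ≤ Real.exp (ε * y) := by linarith [Real.add_one_le_exp (ε * y)]
  rw [neg_mul, Real.exp_neg, ← div_eq_mul_inv, div_le_div_iff₀ (Real.exp_pos _) hε]
  linarith

lemma LaplaceConv.of_exp_bound {a C : ℝ} {u : ℝ → ℂ}
    (hm : AEStronglyMeasurable u (volume.restrict (Ioi 0)))
    (hb : ∀ y > 0, ‖u y‖ ≤ C * Real.exp (a * y)) : LaplaceConv a u := by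
  intro σ hσ
  have h1 : Integrable (fun y : ℝ => C * Real.exp (-(σ - a) * y)) (volume.restrict (Ioi 0)) :=
    (exp_neg_integrableOn_Ioi 0 (by linarith)).const_mul C
  refine h1.mono' (hm.mul ?_) ?_
  · apply Continuous.aestronglyMeasurable; fun_prop
  · filter_upwards [ae_restrict_mem measurableSet_Ioi] with y hy
    rw [norm_mul, norm_exp_neg_mul, Complex.ofReal_re,
      show -(σ - a) * y = a * y + -σ * y by ring, Real.exp_add, ← mul_assoc]
    gcongr
    exact hb y hy

lemma LaplaceConv.id_mul {a : ℝ} {u : ℝ → ℂ} (h : LaplaceConv a u) :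
    LaplaceConv a (fun y => y * u y) := by
  intro σ hσ
  have h1 : Integrable (fun y : ℝ => u y * Complex.exp (-(((a + σ) / 2 : ℝ) : ℂ) * y))
      (volume.restrict (Ioi 0)) := h _ (by linarith)
  refine (h1.norm.const_mul (1 / ((σ - a) / 2))).mono' ?_ ?_
  · refine AEStronglyMeasurable.mul (AEStronglyMeasurable.mul ?_ h.aestronglyMeasurable) ?_ <;>
    · apply Continuous.aestronglyMeasurable; fun_prop
  · filter_upwards [ae_restrict_mem measurableSet_Ioi] with y hy
    have hy : 0 < y := hy
    have := mul_exp_neg_le (ε := (σ - a) / 2) (by linarith) y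
    simp only [norm_mul, norm_exp_neg_mul, Complex.ofReal_re, Complex.norm_real, Real.norm_eq_abs,
      abs_of_pos hy]
    rw [show -σ * y = -((σ - a) / 2) * y + -((a + σ) / 2) * y by ring, Real.exp_add]
    calc _ = (y * Real.exp (-((σ - a) / 2) * y)) * (‖u y‖ * Real.exp (-((a + σ) / 2) * y)) := by ring
      _ ≤ _ := by gcongr

lemma LaplaceConv.pow_mul {a : ℝ} {u : ℝ → ℂ} (h : LaplaceConv a u) (k : ℕ) :
    LaplaceConv a (fun y => y ^ k * u y) := by
  induction k with
  | zero => simpa using h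
  | succ k ih =>
    have := ih.id_mul
    refine (congrArg (LaplaceConv a) (funext fun y => ?_)).mp this
    ring

lemma hasDerivAt_laplace {a : ℝ} {u : ℝ → ℂ} (h : LaplaceConv a u) {s : ℂ} (hs : a < s.re) :
    HasDerivAt (laplace u) (-laplace (fun y => y * u y) s) s := by
  have hU : {z : ℂ | (a + s.re) / 2 < z.re} ∈ nhds s :=
    (isOpen_lt continuous_const Complex.continuous_re).mem_nhds (by simp; linarith)
  have key := hasDerivAt_integral_of_dominated_loc_of_deriv_le (μ := volume.restrict (Ioi (0 : ℝ)))
    (F := fun (z : ℂ) (y : ℝ) => u y * Complex.exp (-z * y))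
    (F' := fun (z : ℂ) (y : ℝ) => u y * (Complex.exp (-z * y) * (-1 * y))) (x₀ := s)
    (bound := fun y => ‖(fun y : ℝ => y * u y) y‖ * Real.exp (-((a + s.re) / 2) * y))
    hU ?_ (h.integrableOn hs) ?_ ?_ ?_ ?_
  · refine key.2.congr_deriv ?_
    simp only [laplace]
    rw [← integral_neg]
    refine integral_congr_ae (ae_of_all _ fun y => ?_)
    simp only
    ring
  · refine Eventually.of_forall fun z => h.aestronglyMeasurable.mul ?_
    apply Continuous.aestronglyMeasurable; fun_prop
  · refine h.aestronglyMeasurable.mul ?_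
    apply Continuous.aestronglyMeasurable; fun_prop
  · filter_upwards [ae_restrict_mem measurableSet_Ioi] with y hy z hz
    have hy : 0 < y := hy
    simp only [norm_mul, norm_exp_neg_mul, norm_neg, norm_one, one_mul]
    rw [mul_comm (Real.exp _), ← mul_assoc, mul_comm ‖u y‖]
    gcongr
  · exact h.id_mul.integrableOn_norm (by linarith)
  · refine ae_of_all _ fun y z _ => ?_
    exact (((hasDerivAt_id z).neg.mul_const (y : ℂ)).cexp).const_mul (u y)

lemma differentiableOn_laplace {a : ℝ} {u : ℝ → ℂ} (h : LaplaceConv a u) :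
    DifferentiableOn ℂ (laplace u) {s | a < s.re} := fun _ hs =>
  (hasDerivAt_laplace h hs).differentiableAt.differentiableWithinAt

lemma isOpen_halfPlane (a : ℝ) : IsOpen {s : ℂ | a < s.re} :=
  isOpen_lt continuous_const Complex.continuous_re

lemma iteratedDeriv_laplace {a : ℝ} {u : ℝ → ℂ} (h : LaplaceConv a u) (k : ℕ) {s : ℂ}
    (hs : a < s.re) :
    iteratedDeriv k (laplace u) s = (-1) ^ k * laplace (fun y => y ^ k * u y) s := by
  induction k generalizing s with
  | zero => simp
  | succ k ih =>
    rw [iteratedDeriv_succ]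
    have : iteratedDeriv k (laplace u) =ᶠ[nhds s]
        fun s => (-1) ^ k * laplace (fun y => y ^ k * u y) s := by
      filter_upwards [(isOpen_halfPlane a).mem_nhds hs] with z hz using ih hz
    rw [this.deriv_eq, ((hasDerivAt_laplace (h.pow_mul k) hs).const_mul _).deriv, pow_succ]
    simp only [mul_neg, mul_one, neg_mul, neg_inj]
    congr 3
    ext y
    ring

lemma norm_laplace_le {u : ℝ → ℂ} {s : ℂ} :
    ‖laplace u s‖ ≤ ∫ y in Ioi (0 : ℝ), ‖u y‖ * Real.exp (-s.re * y) := by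
  refine (norm_integral_le_integral_norm _).trans_eq ?_
  simp only [norm_mul, norm_exp_neg_mul]

/-- Change of variables `t = e^y` turning a Mellin integral into a Laplace transform. -/
lemma integral_Ioi_one_cpow (φ : ℝ → ℂ) (s : ℂ) :
    ∫ t in Ioi (1 : ℝ), φ t * (t : ℂ) ^ (-(s + 1)) = laplace (fun y => φ (Real.exp y)) s := by
  have himg : Real.exp '' Ioi 0 = Ioi 1 := by
    ext t
    constructor
    · rintro ⟨y, hy, rfl⟩
      exact Real.one_lt_exp_iff.mpr hy
    · intro ht
      have ht : 1 < t := ht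
      exact ⟨Real.log t, Real.log_pos ht, Real.exp_log (by linarith)⟩
  rw [← himg, integral_image_eq_integral_abs_deriv_smul measurableSet_Ioi
    (fun y _ => (Real.hasDerivAt_exp y).hasDerivWithinAt) Real.exp_injective.injOn, laplace]
  refine setIntegral_congr_fun measurableSet_Ioi fun y _ => ?_
  simp only [abs_of_pos (Real.exp_pos y)]
  rw [Complex.cpow_def_of_ne_zero (by exact_mod_cast (Real.exp_pos y).ne'),
    ← Complex.ofReal_log (Real.exp_pos y).le, Real.log_exp, Complex.real_smul, Complex.ofReal_exp,
    mul_left_comm, ← Complex.exp_add]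
  congr 2
  ring

lemma LSeries_eq_mul_laplace (f : ℕ → ℝ) (hf : ∀ n, 0 ≤ f n) {r : ℝ} (hr : 0 ≤ r)
    (hO : (fun n ↦ ∑ k ∈ Finset.Icc 1 n, f k) =O[atTop] fun n ↦ (n : ℝ) ^ r)
    {s : ℂ} (hs : r < s.re) :
    LSeries (fun n ↦ f n) s =
      s * laplace (fun y => ((∑ k ∈ Finset.Icc 1 ⌊Real.exp y⌋₊, f k : ℝ) : ℂ)) s := by
  rw [LSeries_eq_mul_integral_of_nonneg f hr hs hO hf,
    ← integral_Ioi_one_cpow (fun t => ((∑ k ∈ Finset.Icc 1 ⌊t⌋₊, f k : ℝ) : ℂ))]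
  push_cast
  rfl

lemma laplaceConv_exp_mul (a : ℂ) : LaplaceConv a.re (fun y : ℝ => Complex.exp (a * y)) := by
  refine LaplaceConv.of_exp_bound (C := 1) ?_ fun y _ => ?_
  · apply Continuous.aestronglyMeasurable; fun_prop
  · rw [Complex.norm_exp]; simp

lemma laplace_exp_mul (a : ℂ) {s : ℂ} (hs : a.re < s.re) :
    laplace (fun y : ℝ => Complex.exp (a * y)) s = (s - a)⁻¹ := by
  have h : (a - s).re < 0 := by simpa using hs
  have hne : a - s ≠ 0 := fun h0 => by simp [h0] at h
  have := integral_exp_mul_complex_Ioi h 0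
  simp only [laplace, ← Complex.exp_add]
  rw [show (fun y : ℝ => Complex.exp (a * y + -s * y)) = fun y : ℝ => Complex.exp ((a - s) * y) by
    ext y; ring_nf, this]
  simp only [Complex.ofReal_zero, mul_zero, Complex.exp_zero, neg_div, one_div]
  rw [← inv_neg, neg_sub]

lemma laplace_add {a : ℝ} {u v : ℝ → ℂ} (hu : LaplaceConv a u) (hv : LaplaceConv a v) {s : ℂ}
    (hs : a < s.re) : laplace (fun y => u y + v y) s = laplace u s + laplace v s := by
  simp only [laplace, add_mul]
  exact integral_add (hu.integrableOn hs) (hv.integrableOn hs)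

lemma laplace_sub {a : ℝ} {u v : ℝ → ℂ} (hu : LaplaceConv a u) (hv : LaplaceConv a v) {s : ℂ}
    (hs : a < s.re) : laplace (fun y => u y - v y) s = laplace u s - laplace v s := by
  simp only [laplace, sub_mul]
  exact integral_sub (hu.integrableOn hs) (hv.integrableOn hs)

lemma laplace_const_mul (c : ℂ) (u : ℝ → ℂ) (s : ℂ) :
    laplace (fun y => c * u y) s = c * laplace u s := by
  simp only [laplace, mul_assoc]
  exact integral_const_mul _ _

lemma LaplaceConv.add {a : ℝ} {u v : ℝ → ℂ} (hu : LaplaceConv a u) (hv : LaplaceConv a v) :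
    LaplaceConv a (fun y => u y + v y) := fun σ hσ => by
  simp only [add_mul]
  exact (hu σ hσ).add (hv σ hσ)

lemma LaplaceConv.sub {a : ℝ} {u v : ℝ → ℂ} (hu : LaplaceConv a u) (hv : LaplaceConv a v) :
    LaplaceConv a (fun y => u y - v y) := fun σ hσ => by
  simp only [sub_mul]
  exact (hu σ hσ).sub (hv σ hσ)

lemma LaplaceConv.const_mul {a : ℝ} {u : ℝ → ℂ} (hu : LaplaceConv a u) (c : ℂ) :
    LaplaceConv a (fun y => c * u y) := fun σ hσ => by
  simp only [mul_assoc]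
  exact (hu σ hσ).const_mul c

/-- The fractional part of `e^y`. -/
noncomputable def fractExp (y : ℝ) : ℂ := ((Real.exp y - ⌊Real.exp y⌋₊ : ℝ) : ℂ)

lemma norm_fractExp_le (y : ℝ) : ‖fractExp y‖ ≤ 1 := by
  rw [fractExp, Complex.norm_real, Real.norm_eq_abs, abs_le]
  have h1 := Nat.floor_le (Real.exp_pos y).le
  have h2 := Nat.lt_floor_add_one (Real.exp y)
  constructor <;> linarith

lemma measurable_fractExp : Measurable fractExp := by
  unfold fractExp
  fun_prop

lemma laplaceConv_fractExp : LaplaceConv 0 fractExp :=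
  LaplaceConv.of_exp_bound (C := 1) measurable_fractExp.aestronglyMeasurable
    fun y _ => by simpa using norm_fractExp_le y

lemma riemannZeta₁_eq_of_one_lt {s : ℂ} (hs : 1 < s.re) :
    riemannZeta₁ s = s - (s - 1) * s * laplace fractExp s := by
  have hs1 : s ≠ 1 := fun h => by simp [h] at hs
  have h0 : s - 1 ≠ 0 := sub_ne_zero.mpr hs1
  have hsum : ∀ n : ℕ, ∑ k ∈ Finset.Icc 1 n, (1 : ℝ) = n := by simp
  have h1 : riemannZeta s = s * laplace (fun y => ((∑ k ∈ Finset.Icc 1 ⌊Real.exp y⌋₊, 1 : ℝ) : ℂ)) s := by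
    rw [← LSeries_one_eq_riemannZeta hs, ← LSeries_eq_mul_laplace (fun _ => (1 : ℝ)) (by simp)
      zero_le_one ?_ hs]
    · simp; rfl
    · simp only [hsum, Real.rpow_one]
      exact Asymptotics.isBigO_refl _ _
  have h2 : laplace (fun y => ((∑ k ∈ Finset.Icc 1 ⌊Real.exp y⌋₊, 1 : ℝ) : ℂ)) s
      = (s - 1)⁻¹ - laplace fractExp s := by
    rw [← laplace_exp_mul 1 (by simpa using hs),
      ← laplace_sub (a := 1) (by simpa using laplaceConv_exp_mul 1)
        (laplaceConv_fractExp.mono zero_le_one) hs]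
    congr 1
    ext y
    rw [hsum, fractExp]
    push_cast
    simp
  rw [h2, riemannZeta_eq_inv_sub_mul hs1] at h1
  field_simp at h1
  linear_combination h1

lemma riemannZeta₁_eq {s : ℂ} (hs : 0 < s.re) :
    riemannZeta₁ s = s - (s - 1) * s * laplace fractExp s := by
  have hU := isOpen_halfPlane 0
  have hpre : IsPreconnected {s : ℂ | (0 : ℝ) < s.re} :=
    (convex_halfSpace_re_gt 0).isPreconnected
  have hf : AnalyticOnNhd ℂ riemannZeta₁ {s : ℂ | (0 : ℝ) < s.re} :=
    differentiable_riemannZeta₁.differentiableOn.analyticOnNhd hU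
  have hg : AnalyticOnNhd ℂ (fun s => s - (s - 1) * s * laplace fractExp s)
      {s : ℂ | (0 : ℝ) < s.re} := by
    refine DifferentiableOn.analyticOnNhd ?_ hU
    have := differentiableOn_laplace laplaceConv_fractExp
    fun_prop
  refine hf.eqOn_of_preconnected_of_eventuallyEq hg hpre (z₀ := 2) (by simp) ?_ hs
  filter_upwards [(isOpen_halfPlane 1).mem_nhds (show (2 : ℂ) ∈ {s : ℂ | (1 : ℝ) < s.re} by simp)]
    with z hz using riemannZeta₁_eq_of_one_lt hz

lemma norm_riemannZeta₁_le {s : ℂ} (hs : 1 / 10 ≤ s.re) :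
    ‖riemannZeta₁ s‖ ≤ 11 * (1 + ‖s‖) ^ 2 := by
  rw [riemannZeta₁_eq (by linarith)]
  have h1 : ‖laplace fractExp s‖ ≤ 10 := by
    refine norm_laplace_le.trans ?_
    have hi : IntegrableOn (fun y : ℝ => Real.exp (-(1 / 10) * y)) (Ioi 0) :=
      exp_neg_integrableOn_Ioi 0 (by norm_num)
    calc ∫ y in Ioi (0 : ℝ), ‖fractExp y‖ * Real.exp (-s.re * y)
        ≤ ∫ y in Ioi (0 : ℝ), Real.exp (-(1 / 10) * y) := by
          refine integral_mono_of_nonneg (ae_of_all _ fun y => by positivity) hi ?_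
          filter_upwards [ae_restrict_mem measurableSet_Ioi] with y hy
          have hy : 0 < y := hy
          calc _ ≤ 1 * Real.exp (-(1 / 10) * y) := by
                gcongr
                exact norm_fractExp_le y
            _ = _ := one_mul _
      _ = 10 := by
          rw [integral_exp_mul_Ioi (by norm_num)]; norm_num
  have h2 : ‖s - 1‖ ≤ 1 + ‖s‖ := by
    rw [add_comm]; simpa using norm_sub_le s 1
  calc _ ≤ ‖s‖ + ‖s - 1‖ * ‖s‖ * ‖laplace fractExp s‖ := by
        refine (norm_sub_le _ _).trans ?_; simp
    _ ≤ ‖s‖ + (1 + ‖s‖) * ‖s‖ * 10 := by gcongr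
    _ ≤ _ := by nlinarith [norm_nonneg s]

lemma norm_riemannZeta₁_two_add_ge (t : ℝ) : 1 / 4 ≤ ‖riemannZeta₁ (2 + t * Complex.I)‖ := by
  set s : ℂ := 2 + t * Complex.I with hs
  have hre : s.re = 2 := by simp [hs]
  have hs1 : s ≠ 1 := fun h => by simp [h] at hre
  have hz := zeta_nat_eq_tsum_of_gt_one (k := 2) (by norm_num)
  have h1 : ‖riemannZeta s - 1‖ ≤ π ^ 2 / 6 - 1 := by
    have hsum : Summable fun n : ℕ => 1 / ((n : ℂ) + 1) ^ s := by
      have := (Complex.summable_one_div_nat_cpow (p := s)).mpr (by rw [hre]; norm_num)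
      simpa using (summable_nat_add_iff 1).mpr this
    have hsum2 : Summable fun n : ℕ => 1 / ((n : ℝ) + 1) ^ 2 := by
      have := (Real.summable_one_div_nat_pow (p := 2)).mpr (by norm_num)
      simpa using (summable_nat_add_iff 1).mpr this
    have hval : ∑' n : ℕ, 1 / ((n : ℝ) + 1) ^ 2 = π ^ 2 / 6 := by
      have h := hasSum_zeta_two
      have := (hasSum_nat_add_iff' 1).mpr h
      simpa using this.tsum_eq
    rw [zeta_eq_tsum_one_div_nat_add_one_cpow (by rw [hre]; norm_num), hsum.tsum_eq_zero_add,
      ← hval, hsum2.tsum_eq_zero_add]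
    simp only [Nat.cast_zero, zero_add, Complex.one_cpow, one_pow, div_one, add_sub_cancel_left]
    refine tsum_of_norm_bounded ((summable_nat_add_iff 1).mpr hsum2).hasSum fun n => ?_
    rw [norm_div, norm_one]
    have : ((n + 1 : ℕ) : ℂ) + 1 = (((n : ℝ) + 1 + 1 : ℝ) : ℂ) := by push_cast; rfl
    rw [this, Complex.norm_cpow_eq_rpow_re_of_pos (by positivity), hre]
    norm_num
  have hpi : π ^ 2 / 6 < 1.65 := by
    have := Real.pi_lt_d4
    have := Real.pi_pos
    nlinarith
  have h2 : (1 : ℝ) / 4 ≤ ‖riemannZeta s‖ := by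
    have := norm_sub_norm_le (1 : ℂ) (1 - riemannZeta s)
    rw [norm_one, sub_sub_cancel, norm_sub_rev] at this
    linarith
  have h3 : riemannZeta₁ s = (s - 1) * riemannZeta s := by
    rw [riemannZeta_eq_inv_sub_mul hs1, mul_inv_cancel_left₀ (sub_ne_zero.mpr hs1)]
  have h4 : 1 ≤ ‖s - 1‖ := by
    have := Complex.abs_re_le_norm (s - 1)
    rw [Complex.sub_re, hre] at this
    norm_num at this
    exact this
  rw [h3, norm_mul]
  nlinarith

lemma exists_eq_pow_mul {f : ℂ → ℂ} (hf : Differentiable ℂ f) {a : ℂ}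
    (ha : analyticOrderAt f a ≠ ⊤) :
    ∃ h : ℂ → ℂ, Differentiable ℂ h ∧ h a ≠ 0 ∧
      ∀ z, f z = (z - a) ^ analyticOrderNatAt f a * h z := by
  have han : ∀ z, AnalyticAt ℂ f z := fun z => hf.analyticAt z
  obtain ⟨g, hg, hga, hfg⟩ := (han a).analyticOrderAt_ne_top.mp ha
  set n := analyticOrderNatAt f a
  set h : ℂ → ℂ := Function.update (fun z => f z / (z - a) ^ n) a (g a) with hh
  have hne : ∀ z, z ≠ a → h z = f z / (z - a) ^ n := fun z hz => by simp [hh, hz]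
  have hev : h =ᶠ[nhds a] g := by
    filter_upwards [hfg] with z hz
    by_cases hza : z = a
    · simp [hh, hza]
    · rw [hne z hza, hz, smul_eq_mul, mul_div_cancel_left₀]
      exact pow_ne_zero _ (sub_ne_zero.mpr hza)
  refine ⟨h, fun z => ?_, by simpa [hh] using hga, fun z => ?_⟩
  · by_cases hza : z = a
    · rw [hza]
      exact (hg.congr hev.symm).differentiableAt
    · have : h =ᶠ[nhds z] fun z => f z / (z - a) ^ n := by
        filter_upwards [isOpen_ne.mem_nhds hza] with w hw using hne w hw
      refine DifferentiableAt.congr_of_eventuallyEq ?_ this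
      exact (hf z).div (by fun_prop) (pow_ne_zero _ (sub_ne_zero.mpr hza))
  · by_cases hza : z = a
    · rw [hza, hfg.self_of_nhds]
      simp [hh]
    · rw [hne z hza, mul_div_cancel₀]
      exact pow_ne_zero _ (sub_ne_zero.mpr hza)

lemma exists_factor {f : ℂ → ℂ} (hf : Differentiable ℂ f)
    (htop : ∀ a, analyticOrderAt f a ≠ ⊤) (S : Finset ℂ) :
    ∃ h : ℂ → ℂ, Differentiable ℂ h ∧ (∀ ρ ∈ S, h ρ ≠ 0) ∧
      ∀ z, f z = (∏ ρ ∈ S, (z - ρ) ^ analyticOrderNatAt f ρ) * h z := by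
  induction S using Finset.induction_on with
  | empty => exact ⟨f, hf, by simp, by simp⟩
  | insert a S haS ih =>
    obtain ⟨h, hd, hne, hfh⟩ := ih
    set p : ℂ → ℂ := fun z => ∏ ρ ∈ S, (z - ρ) ^ analyticOrderNatAt f ρ with hp
    have hpd : Differentiable ℂ p := by simp only [hp]; fun_prop
    have hpa : p a ≠ 0 := by
      simp only [hp]
      refine Finset.prod_ne_zero_iff.mpr fun ρ hρ => pow_ne_zero _ (sub_ne_zero.mpr ?_)
      rintro rfl
      exact haS hρ
    have hord : analyticOrderAt f a = analyticOrderAt h a := by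
      have : f = p * h := funext hfh
      rw [this, analyticOrderAt_mul (hpd.analyticAt a) (hd.analyticAt a),
        (hpd.analyticAt a).analyticOrderAt_eq_zero.mpr hpa, zero_add]
    obtain ⟨h1, hd1, hne1, hfh1⟩ := exists_eq_pow_mul hd (hord ▸ htop a)
    refine ⟨h1, hd1, fun ρ hρ => ?_, fun z => ?_⟩
    · rcases Finset.mem_insert.mp hρ with rfl | hρ
      · exact hne1
      · have := hne ρ hρ
        rw [hfh1] at this
        exact right_ne_zero_of_mul this
    · rw [Finset.prod_insert haS, hfh z, hfh1 z]
      have : analyticOrderNatAt f a = analyticOrderNatAt h a := by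
        simp only [analyticOrderNatAt, hord]
      rw [this]
      ring

lemma analyticOrderAt_ne_top_of_entire {f : ℂ → ℂ} (hf : Differentiable ℂ f) {c : ℂ}
    (hc : f c ≠ 0) (a : ℂ) : analyticOrderAt f a ≠ ⊤ := by
  intro h
  rw [analyticOrderAt_eq_top] at h
  have han : AnalyticOnNhd ℂ f univ := fun z _ => hf.analyticAt z
  exact hc (han.eqOn_zero_of_preconnected_of_eventuallyEq_zero isPreconnected_univ
    (mem_univ a) h (mem_univ c))

lemma finite_zeros {f : ℂ → ℂ} (hf : Differentiable ℂ f) {c : ℂ} (hc : f c ≠ 0) {K : Set ℂ}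
    (hK : IsCompact K) : {z ∈ K | f z = 0}.Finite := by
  have han : AnalyticOnNhd ℂ f K := fun z _ => hf.analyticAt z
  refine ((MeromorphicOn.divisor f K).finiteSupport hK).subset ?_
  rintro z ⟨hz, hfz⟩
  have h0 := (hf.analyticAt z).analyticOrderAt_ne_zero.mpr hfz
  have htop := analyticOrderAt_ne_top_of_entire hf hc z
  rw [Function.mem_support, MeromorphicOn.AnalyticOnNhd.divisor_apply han hz,
    ← Nat.cast_analyticOrderNatAt htop]
  rw [← Nat.cast_analyticOrderNatAt htop] at h0
  simpa using h0

lemma sum_order_le {f : ℂ → ℂ} (hf : Differentiable ℂ f) {c : ℂ} {r R M : ℝ} (hr : 0 < r)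
    (hrR : r < R) (hM : 1 ≤ M) (hc : f c ≠ 0) (hb : ∀ z ∈ Metric.sphere c R, ‖f z‖ ≤ M)
    (Z : Finset ℂ) (hZ : ∀ ρ ∈ Z, ρ ∈ Metric.closedBall c r) :
    (∑ ρ ∈ Z, (analyticOrderNatAt f ρ : ℝ)) ≤ Real.log (M / ‖f c‖) / Real.log (R / r) := by
  have har : |r| = r := abs_of_pos hr
  have haR : |R| = R := abs_of_pos (hr.trans hrR)
  have han : ∀ K, AnalyticOnNhd ℂ f K := fun K z _ => hf.analyticAt z
  have key := AnalyticOnNhd.sum_divisor_le (c := c) (r := r) (R := R) (f := f) (by rwa [har])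
    (by rwa [har, haR]) hM (han _) hc (by rwa [haR])
  refine le_trans ?_ key
  rw [har]
  have hfin := (MeromorphicOn.divisor f (Metric.closedBall c r)).finiteSupport
    (isCompact_closedBall c r)
  have hdiv : ∀ ρ ∈ Metric.closedBall c r,
      MeromorphicOn.divisor f (Metric.closedBall c r) ρ = analyticOrderNatAt f ρ := by
    intro ρ hρ
    rw [MeromorphicOn.AnalyticOnNhd.divisor_apply (han _) hρ,
      ← Nat.cast_analyticOrderNatAt (analyticOrderAt_ne_top_of_entire hf hc ρ)]
    simp
  rw [finsum_eq_sum_of_support_subset (s := hfin.toFinset ∪ Z) _ (by simp)]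
  have h1 : (∑ ρ ∈ Z, (analyticOrderNatAt f ρ : ℝ)) =
      ((∑ ρ ∈ Z, MeromorphicOn.divisor f (Metric.closedBall c r) ρ : ℤ) : ℝ) := by
    push_cast
    refine Finset.sum_congr rfl fun ρ hρ => ?_
    rw [hdiv ρ (hZ ρ hρ)]
    simp
  rw [h1]
  norm_cast
  refine Finset.sum_le_sum_of_subset_of_nonneg Finset.subset_union_right fun ρ _ _ => ?_
  by_cases hρ : ρ ∈ Metric.closedBall c r
  · rw [hdiv ρ hρ]; positivity
  · rw [Function.locallyFinsuppWithin.apply_eq_zero_of_notMem _ hρ]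

/-- The logarithmic derivative of a zero-free function, bounded through its size. -/
lemma norm_deriv_div_le {h : ℂ → ℂ} (hd : Differentiable ℂ h) {c : ℂ} {r1 r r2 A : ℝ}
    (hr1 : 0 < r1) (h1 : r1 < r) (h2 : r < r2) (hA : 0 < A)
    (hne : ∀ z ∈ Metric.ball c r2, h z ≠ 0)
    (hb : ∀ z ∈ Metric.ball c r2, ‖h z‖ ≤ Real.exp A * ‖h c‖) {z : ℂ}
    (hz : z ∈ Metric.closedBall c r1) :
    ‖deriv h z / h z‖ ≤ 2 * A * r / (r2 - r) / (r - r1) := by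
  have hdd : Differentiable ℂ (deriv h) := hd.deriv
  have hcb : c ∈ Metric.ball c r2 := Metric.mem_ball_self (by linarith)
  obtain ⟨G, hG0, hG⟩ := (DifferentiableOn.isExactOn_ball (c := c) (r := r2)
    (f := fun z => deriv h z / h z)
    (fun z hz => ((hdd z).div (hd z) (hne z hz)).differentiableWithinAt)).with_val_at c 0
  have hGd : DifferentiableOn ℂ G (Metric.ball c r2) := fun z hz =>
    (hG z hz).differentiableAt.differentiableWithinAt
  have hconst : ∀ z ∈ Metric.ball c r2, h z * Complex.exp (-G z) = h c := by
    intro z hz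
    have hder : ∀ w ∈ Metric.ball c r2, HasDerivAt (fun w => h w * Complex.exp (-G w)) 0 w := by
      intro w hw
      have := (hd w).hasDerivAt.mul ((hG w hw).neg.cexp)
      refine this.congr_deriv ?_
      have := hne w hw
      field_simp
      ring
    have := (convex_ball c r2).is_const_of_fderivWithin_eq_zero (𝕜 := ℂ)
      (f := fun w => h w * Complex.exp (-G w))
      (fun w hw => (hder w hw).differentiableAt.differentiableWithinAt) (fun w hw => ?_) hz hcb
    · simpa [hG0] using this
    · rw [fderivWithin_of_isOpen Metric.isOpen_ball hw, (hder w hw).hasFDerivAt.fderiv]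
      simp
  have hre : ∀ z ∈ Metric.ball c r2, (G z).re ≤ A := by
    intro z hz
    have h3 := hb z hz
    have h4 := congrArg norm (hconst z hz)
    rw [norm_mul, Complex.norm_exp, Complex.neg_re] at h4
    rw [← h4, mul_comm, mul_assoc, ← Real.exp_add] at h3
    have hpos : 0 < ‖h z‖ := norm_pos_iff.mpr (hne z hz)
    have h5 : (1 : ℝ) ≤ Real.exp (-(G z).re + A) := by
      by_contra! hlt
      nlinarith
    have := Real.one_le_exp_iff.mp h5
    linarith
  have hBC : ∀ z ∈ Metric.closedBall c r, ‖G z‖ ≤ 2 * A * r / (r2 - r) := by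
    intro z hz
    have hzc : ‖z - c‖ ≤ r := by simpa [dist_eq_norm] using hz
    have hshift : ∀ w ∈ Metric.ball (0 : ℂ) r2, w + c ∈ Metric.ball c r2 := fun w hw => by
      simpa [dist_eq_norm] using hw
    have := Complex.borelCaratheodory_zero (f := fun w => G (w + c)) (R := r2) (M := A)
      (z := z - c) hA ?_ (fun w hw => hre _ (hshift w hw)) (by linarith) (by
        simp only [mem_ball_zero_iff]; linarith) (by simpa using hG0)
    · simp only [sub_add_cancel] at this
      refine this.trans ?_
      have : 0 < r2 - r := by linarith
      have : 0 < r := by linarith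
      gcongr
    · exact hGd.comp (by fun_prop) hshift
  have hz' : ‖z - c‖ ≤ r1 := by simpa [dist_eq_norm] using hz
  have hsub : Metric.closedBall z (r - r1) ⊆ Metric.closedBall c r := by
    intro w hw
    have : ‖w - z‖ ≤ r - r1 := by simpa [dist_eq_norm] using hw
    have : ‖w - c‖ ≤ r := by
      calc ‖w - c‖ = ‖(w - z) + (z - c)‖ := by ring_nf
        _ ≤ _ := norm_add_le _ _
        _ ≤ r := by linarith
    simpa [dist_eq_norm] using this
  have hzb : z ∈ Metric.ball c r2 := by
    simp only [Metric.mem_ball, dist_eq_norm]; linarith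
  rw [← (hG z hzb).deriv]
  have hcb2 : Metric.closedBall c r ⊆ Metric.ball c r2 := Metric.closedBall_subset_ball h2
  refine Complex.norm_deriv_le_of_forall_mem_sphere_norm_le (by linarith) ?_
    fun w hw => hBC w (hsub (Metric.sphere_subset_closedBall hw))
  refine DifferentiableOn.diffContOnCl (hGd.mono ?_)
  rw [closure_ball _ (by linarith)]
  exact hsub.trans hcb2

/-- Local partial fraction expansion of the logarithmic derivative of an entire function. -/
lemma exists_logDeriv_sub_sum_le : ∃ K : ℝ, 0 < K ∧ ∀ f : ℂ → ℂ, Differentiable ℂ f →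
    ∀ (c : ℂ) (M : ℝ), 1 ≤ M → 1 / 4 ≤ ‖f c‖ →
    (∀ z ∈ Metric.closedBall c (19 / 10), ‖f z‖ ≤ M) →
    ∀ Z : Finset ℂ, (∀ ρ, ρ ∈ Z ↔ ρ ∈ Metric.closedBall c (17 / 10) ∧ f ρ = 0) →
    (∑ ρ ∈ Z, (analyticOrderNatAt f ρ : ℝ)) ≤ K * Real.log (4 * M) ∧
    ∀ z ∈ Metric.closedBall c (8 / 5), f z ≠ 0 →
      ‖deriv f z / f z - ∑ ρ ∈ Z, (analyticOrderNatAt f ρ : ℂ) / (z - ρ)‖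
        ≤ K * Real.log (4 * M) := by
  set K1 : ℝ := 1 / Real.log (19 / 17) with hK1
  have hlog : 0 < Real.log (19 / 17) := Real.log_pos (by norm_num)
  have hlog9 : 0 < Real.log 9 := Real.log_pos (by norm_num)
  have hK1pos : 0 < K1 := by positivity
  set K2 : ℝ := 2 * (1 + K1 * Real.log 9) * (33 / 20) / (17 / 10 - 33 / 20) / (33 / 20 - 8 / 5)
    with hK2
  have hK2pos : 0 < K2 := by rw [hK2]; norm_num; positivity
  refine ⟨K1 + K2, by positivity, fun f hf c M hM hfc hb Z hZ => ?_⟩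
  set A := Real.log (4 * M) with hA
  have hApos : 0 < A := Real.log_pos (by linarith)
  have hfc0 : f c ≠ 0 := by
    intro h0; rw [h0, norm_zero] at hfc; norm_num at hfc
  have hfcpos : 0 < ‖f c‖ := norm_pos_iff.mpr hfc0
  set N : ℕ := ∑ ρ ∈ Z, analyticOrderNatAt f ρ with hN
  have hNle : (N : ℝ) ≤ K1 * A := by
    have := sum_order_le hf (c := c) (r := 17 / 10) (R := 19 / 10) (by norm_num) (by norm_num)
      hM hfc0 (fun z hz => hb z (Metric.sphere_subset_closedBall hz)) Z
      (fun ρ hρ => ((hZ ρ).mp hρ).1)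
    rw [hN]
    push_cast
    refine this.trans ?_
    rw [show (19 / 10 : ℝ) / (17 / 10) = 19 / 17 by norm_num, hK1, one_div_mul_eq_div]
    have : M / ‖f c‖ ≤ 4 * M := by
      rw [div_le_iff₀ hfcpos]
      nlinarith
    have hpos : 0 < M / ‖f c‖ := by positivity
    gcongr
    exact Real.log_le_log hpos this
  refine ⟨?_, fun z hz hfz => ?_⟩
  · have : (∑ ρ ∈ Z, (analyticOrderNatAt f ρ : ℝ)) = N := by rw [hN]; push_cast; rfl
    rw [this]
    nlinarith
  obtain ⟨h, hd, hne, hfh⟩ := exists_factor hf (analyticOrderAt_ne_top_of_entire hf hfc0) Z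
  have hnorm : ∀ z, ‖f z‖ = (∏ ρ ∈ Z, ‖z - ρ‖ ^ analyticOrderNatAt f ρ) * ‖h z‖ := by
    intro z
    conv_lhs => rw [hfh z]
    rw [norm_mul, norm_prod]
    simp only [norm_pow]
  have hρc : ∀ ρ ∈ Z, ‖c - ρ‖ ≤ 17 / 10 := fun ρ hρ => by
    have := ((hZ ρ).mp hρ).1
    rwa [Metric.mem_closedBall, dist_comm, dist_eq_norm] at this
  have hhc : 1 / 4 ≤ (17 / 10) ^ N * ‖h c‖ := by
    refine hfc.trans ?_
    rw [hnorm, hN, ← Finset.prod_pow_eq_pow_sum]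
    gcongr with ρ hρ
    exact hρc ρ hρ
  have hsphere : ∀ z ∈ Metric.sphere c (19 / 10), ‖h z‖ ≤ M * 5 ^ N := by
    intro z hz
    have h1 := hb z (Metric.sphere_subset_closedBall hz)
    rw [hnorm] at h1
    have h2 : (1 / 5 : ℝ) ^ N ≤ ∏ ρ ∈ Z, ‖z - ρ‖ ^ analyticOrderNatAt f ρ := by
      rw [hN, ← Finset.prod_pow_eq_pow_sum]
      gcongr with ρ hρ
      have h3 : ‖z - c‖ = 19 / 10 := by simpa [dist_eq_norm] using hz
      have h4 := norm_sub_norm_le (z - c) (ρ - c)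
      rw [sub_sub_sub_cancel_right, norm_sub_rev ρ c] at h4
      linarith [hρc ρ hρ]
    have h5 : (1 / 5 : ℝ) ^ N * ‖h z‖ ≤ M := le_trans (by gcongr) h1
    rw [one_div, inv_pow, inv_mul_le_iff₀ (by positivity)] at h5
    linarith
  have hball : ∀ z ∈ Metric.ball c (17 / 10), ‖h z‖ ≤ Real.exp (A + N * Real.log 9) * ‖h c‖ := by
    intro z hz
    have h1 : ‖h z‖ ≤ M * 5 ^ N := by
      refine Complex.norm_le_of_forall_mem_frontier_norm_le (U := Metric.ball c (19 / 10))
        Metric.isBounded_ball hd.diffContOnCl ?_ (subset_closure ?_)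
      · rw [frontier_ball _ (by norm_num)]
        exact hsphere
      · exact Metric.ball_subset_ball (by norm_num) hz
    rw [Real.exp_add, hA, Real.exp_log (by linarith), mul_comm (N : ℝ), Real.exp_mul,
      Real.exp_log (by norm_num), Real.rpow_natCast]
    calc ‖h z‖ ≤ M * 5 ^ N := h1
      _ = 4 * M * 5 ^ N * (1 / 4) := by ring
      _ ≤ 4 * M * 5 ^ N * ((17 / 10) ^ N * ‖h c‖) := by gcongr
      _ = 4 * M * (5 * (17 / 10)) ^ N * ‖h c‖ := by rw [mul_pow]; ring
      _ ≤ 4 * M * 9 ^ N * ‖h c‖ := by gcongr; norm_num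
  have hhne : ∀ z ∈ Metric.ball c (17 / 10), h z ≠ 0 := by
    intro z hz h0
    have hfz : f z = 0 := by rw [hfh, h0, mul_zero]
    exact hne z ((hZ z).mpr ⟨Metric.ball_subset_closedBall hz, hfz⟩) h0
  have hfin := norm_deriv_div_le hd (r1 := 8 / 5) (r := 33 / 20) (by norm_num) (by norm_num)
    (by norm_num) (A := A + N * Real.log 9) (by positivity) hhne hball hz
  have hzb : z ∈ Metric.ball c (17 / 10) := Metric.closedBall_subset_ball (by norm_num) hz
  have hzρ : ∀ ρ ∈ Z, z - ρ ≠ 0 := by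
    intro ρ hρ h0
    rw [sub_eq_zero] at h0
    exact hfz (h0 ▸ ((hZ ρ).mp hρ).2)
  have hlogd : deriv f z / f z =
      (∑ ρ ∈ Z, (analyticOrderNatAt f ρ : ℂ) / (z - ρ)) + deriv h z / h z := by
    have hfeq : f = fun z => (∏ ρ ∈ Z, (z - ρ) ^ analyticOrderNatAt f ρ) * h z := funext hfh
    rw [← logDeriv_apply, ← logDeriv_apply]
    conv_lhs => rw [hfeq]
    rw [logDeriv_mul (f := fun z => ∏ ρ ∈ Z, (z - ρ) ^ analyticOrderNatAt f ρ) z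
      (Finset.prod_ne_zero_iff.mpr fun ρ hρ => pow_ne_zero _ (hzρ ρ hρ)) (hhne z hzb)
      (by fun_prop) (hd z)]
    congr 1
    have := logDeriv_prod (s := Z) (f := fun ρ z => (z - ρ) ^ analyticOrderNatAt f ρ) (x := z)
      (fun ρ hρ => pow_ne_zero _ (hzρ ρ hρ)) (fun ρ _ => by fun_prop)
    rw [this]
    refine Finset.sum_congr rfl fun ρ _ => ?_
    rw [logDeriv_fun_pow (by fun_prop), logDeriv_apply]
    simp [div_eq_mul_inv]
  rw [hlogd, add_sub_cancel_left]
  refine hfin.trans ?_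
  have : A + N * Real.log 9 ≤ (1 + K1 * Real.log 9) * A := by nlinarith
  calc 2 * (A + N * Real.log 9) * (33 / 20) / (17 / 10 - 33 / 20) / (33 / 20 - 8 / 5)
      ≤ 2 * ((1 + K1 * Real.log 9) * A) * (33 / 20) / (17 / 10 - 33 / 20) / (33 / 20 - 8 / 5) := by
        have e1 : (0 : ℝ) < 17 / 10 - 33 / 20 := by norm_num
        have e2 : (0 : ℝ) < 33 / 20 - 8 / 5 := by norm_num
        gcongr
    _ = K2 * A := by rw [hK2]; ring
    _ ≤ (K1 + K2) * A := by gcongr; linarith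

/-- The multiplicity of `ρ` as a zero of `(s - 1) ζ(s)`. -/
noncomputable def zetaOrder (ρ : ℂ) : ℕ := analyticOrderNatAt riemannZeta₁ ρ

/-- The centre `2 + i n` of the `n`-th window. -/
noncomputable def windowCentre (n : ℤ) : ℂ := 2 + (n : ℝ) * Complex.I

lemma riemannZeta₁_windowCentre (n : ℤ) : 1 / 4 ≤ ‖riemannZeta₁ (windowCentre n)‖ :=
  norm_riemannZeta₁_two_add_ge n

lemma riemannZeta₁_windowCentre_ne (n : ℤ) : riemannZeta₁ (windowCentre n) ≠ 0 := fun h => by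
  have := riemannZeta₁_windowCentre n
  rw [h, norm_zero] at this
  norm_num at this

/-- The zeros of the zeta function near the `n`-th window. -/
noncomputable def windowZeros (n : ℤ) : Finset ℂ :=
  (finite_zeros differentiable_riemannZeta₁ (riemannZeta₁_windowCentre_ne n)
    (isCompact_closedBall (windowCentre n) (17 / 10))).toFinset

lemma mem_windowZeros {n : ℤ} {ρ : ℂ} : ρ ∈ windowZeros n ↔
    ρ ∈ Metric.closedBall (windowCentre n) (17 / 10) ∧ riemannZeta₁ ρ = 0 := by
  simp [windowZeros]

/-- The weight bounding the number of zeros in the `n`-th window. -/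
noncomputable def windowWeight (n : ℤ) : ℝ := (1 + |(n : ℝ)|) ^ (1 / 4 : ℝ)

lemma one_le_windowWeight (n : ℤ) : 1 ≤ windowWeight n :=
  Real.one_le_rpow (by linarith [abs_nonneg (n : ℝ)]) (by norm_num)

lemma log_window_le (n : ℤ) :
    Real.log (4 * (11 * (5 + |(n : ℝ)|) ^ 2)) ≤ (Real.log 1100 + 8) * windowWeight n := by
  have hn := abs_nonneg (n : ℝ)
  have h1 : Real.log (1 + |(n : ℝ)|) ≤ 4 * windowWeight n := by
    have := Real.log_le_rpow_div (x := 1 + |(n : ℝ)|) (by linarith) (ε := 1 / 4) (by norm_num)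
    rw [windowWeight]; linarith
  have h2 : Real.log (4 * (11 * (5 + |(n : ℝ)|) ^ 2)) ≤
      Real.log (1100 * (1 + |(n : ℝ)|) ^ 2) := by
    refine Real.log_le_log (by positivity) ?_
    nlinarith
  rw [Real.log_mul (x := 1100) (by norm_num) (by positivity), Real.log_pow] at h2
  have h3 : 0 ≤ Real.log 1100 := Real.log_nonneg (by norm_num)
  have := one_le_windowWeight n
  push_cast at h2
  nlinarith

lemma exists_window_bound : ∃ K : ℝ, 0 < K ∧ ∀ n : ℤ,
    (∑ ρ ∈ windowZeros n, (zetaOrder ρ : ℝ)) ≤ K * windowWeight n ∧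
    ∀ z ∈ Metric.closedBall (windowCentre n) (8 / 5), riemannZeta₁ z ≠ 0 →
      ‖deriv riemannZeta₁ z / riemannZeta₁ z - ∑ ρ ∈ windowZeros n, (zetaOrder ρ : ℂ) / (z - ρ)‖
        ≤ K * windowWeight n := by
  obtain ⟨K, hK, h⟩ := exists_logDeriv_sub_sum_le
  have h3 : 0 ≤ Real.log 1100 := Real.log_nonneg (by norm_num)
  refine ⟨K * (Real.log 1100 + 8), by positivity, fun n => ?_⟩
  have hn := abs_nonneg (n : ℝ)
  have := h riemannZeta₁ differentiable_riemannZeta₁ (windowCentre n) (11 * (5 + |(n : ℝ)|) ^ 2)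
    (by nlinarith) (riemannZeta₁_windowCentre n) ?_ (windowZeros n) (fun ρ => mem_windowZeros)
  · have hle : K * Real.log (4 * (11 * (5 + |(n : ℝ)|) ^ 2)) ≤
        K * (Real.log 1100 + 8) * windowWeight n := by
      rw [mul_assoc]
      exact mul_le_mul_of_nonneg_left (log_window_le n) hK.le
    exact ⟨this.1.trans hle, fun z hz hz0 => (this.2 z hz hz0).trans hle⟩
  · intro z hz
    rw [Metric.mem_closedBall, dist_eq_norm] at hz
    have h4 := (Complex.abs_re_le_norm (z - windowCentre n)).trans hz
    rw [Complex.sub_re, show (windowCentre n).re = 2 by simp [windowCentre], abs_le] at h4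
    have h5 : ‖z‖ ≤ |(n : ℝ)| + 4 := by
      calc ‖z‖ = ‖(z - windowCentre n) + windowCentre n‖ := by rw [sub_add_cancel]
        _ ≤ ‖z - windowCentre n‖ + ‖windowCentre n‖ := norm_add_le _ _
        _ ≤ 19 / 10 + (2 + |(n : ℝ)|) := by
            gcongr
            rw [windowCentre]
            refine (norm_add_le _ _).trans ?_
            simp
        _ ≤ _ := by linarith
    refine (norm_riemannZeta₁_le (by linarith)).trans ?_
    have := norm_nonneg z
    have : 1 + ‖z‖ ≤ 5 + |(n : ℝ)| := by linarith
    gcongr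

lemma re_eq_half_of_zero (hRH : RiemannHypothesis) {s : ℂ} (hs : 0 < s.re)
    (h : riemannZeta₁ s = 0) : s.re = 1 / 2 := by
  have hs1 : s ≠ 1 := by
    rintro rfl
    rw [riemannZeta₁_one] at h
    exact one_ne_zero h
  refine hRH s (by rw [riemannZeta_eq_inv_sub_mul hs1, h, mul_zero]) ?_ hs1
  rintro ⟨n, rfl⟩
  have : (-2 * ((n : ℂ) + 1)).re = -2 * ((n : ℝ) + 1) := by simp
  rw [this] at hs
  have : (0 : ℝ) ≤ n := n.cast_nonneg
  linarith

lemma riemannZeta₁_ne_zero (hRH : RiemannHypothesis) {s : ℂ} (hs : 1 / 2 < s.re) :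
    riemannZeta₁ s ≠ 0 := fun h => by
  have := re_eq_half_of_zero hRH (by linarith) h
  linarith

lemma re_of_mem_windowZeros (hRH : RiemannHypothesis) {n : ℤ} {ρ : ℂ} (h : ρ ∈ windowZeros n) :
    ρ.re = 1 / 2 := by
  obtain ⟨h1, h2⟩ := mem_windowZeros.mp h
  refine re_eq_half_of_zero hRH ?_ h2
  rw [Metric.mem_closedBall, dist_eq_norm] at h1
  have h4 := (Complex.abs_re_le_norm (ρ - windowCentre n)).trans h1
  rw [Complex.sub_re, show (windowCentre n).re = 2 by simp [windowCentre], abs_le] at h4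
  linarith

lemma norm_sub_windowCentre_le {n : ℤ} {s : ℂ} (h1 : 1 / 2 ≤ s.re) (h2 : s.re ≤ 7 / 2)
    (h3 : |s.im - n| ≤ 1 / 2) : s ∈ Metric.closedBall (windowCentre n) (8 / 5) := by
  rw [Metric.mem_closedBall, dist_eq_norm, Complex.norm_eq_sqrt_sq_add_sq]
  refine Real.sqrt_le_iff.mpr ⟨by norm_num, ?_⟩
  have e1 : (s - windowCentre n).re = s.re - 2 := by simp [windowCentre]
  have e2 : (s - windowCentre n).im = s.im - n := by simp [windowCentre]
  rw [e1, e2]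
  have := abs_le.mp h3
  nlinarith

lemma mem_windowZeros_of_im {n : ℤ} {ρ : ℂ} (h1 : ρ.re = 1 / 2) (h0 : riemannZeta₁ ρ = 0)
    (h3 : |ρ.im - n| ≤ 3 / 5) : ρ ∈ windowZeros n := by
  refine mem_windowZeros.mpr ⟨?_, h0⟩
  rw [Metric.mem_closedBall, dist_eq_norm, Complex.norm_eq_sqrt_sq_add_sq]
  refine Real.sqrt_le_iff.mpr ⟨by norm_num, ?_⟩
  have e1 : (ρ - windowCentre n).re = ρ.re - 2 := by simp [windowCentre]
  have e2 : (ρ - windowCentre n).im = ρ.im - n := by simp [windowCentre]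
  rw [e1, e2, h1]
  have := abs_le.mp h3
  nlinarith

/-- The Laplace transform of `ψ(e^y) - e^y`. -/
noncomputable def psiTransform (s : ℂ) : ℂ :=
  -(deriv riemannZeta₁ s / riemannZeta₁ s + 1) / s

lemma differentiableOn_psiTransform (hRH : RiemannHypothesis) :
    DifferentiableOn ℂ psiTransform {s | 1 / 2 < s.re} := by
  intro s hs
  have hs : 1 / 2 < s.re := hs
  have h0 : s ≠ 0 := fun h => by simp [h] at hs; linarith
  have hd := differentiable_riemannZeta₁.deriv
  exact (((((hd s).div (differentiable_riemannZeta₁ s) (riemannZeta₁_ne_zero hRH hs)).add_const 1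
    ).neg).div differentiableAt_id h0).differentiableWithinAt

lemma quarter_le_norm {s : ℂ} (h1 : 1 / 2 ≤ s.re) : (1 + |s.im|) / 4 ≤ ‖s‖ := by
  have e1 := Complex.abs_re_le_norm s
  have e2 := Complex.abs_im_le_norm s
  have := le_abs_self s.re
  linarith

lemma windowWeight_round_le (t : ℝ) : windowWeight (round t) ≤ 2 * (1 + |t|) ^ (1 / 4 : ℝ) := by
  have h := abs_sub_round t
  have h1 : |((round t : ℤ) : ℝ)| ≤ |t| + 1 / 2 := by
    have := abs_sub_abs_le_abs_sub ((round t : ℤ) : ℝ) t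
    rw [abs_sub_comm] at this
    linarith
  have ht := abs_nonneg t
  rw [windowWeight]
  calc (1 + |((round t : ℤ) : ℝ)|) ^ (1 / 4 : ℝ) ≤ (16 * (1 + |t|)) ^ (1 / 4 : ℝ) := by
        gcongr; linarith
    _ = 2 * (1 + |t|) ^ (1 / 4 : ℝ) := by
        rw [Real.mul_rpow (by norm_num) (by positivity), show (16 : ℝ) = 2 ^ (4 : ℝ) by norm_num,
          ← Real.rpow_mul (by norm_num)]
        norm_num

lemma exists_psiTransform_bound (hRH : RiemannHypothesis) {ε : ℝ} (hε : 0 < ε) :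
    ∃ C : ℝ, 0 < C ∧ ∀ s : ℂ, 1 / 2 + ε ≤ s.re → s.re ≤ 7 / 2 →
      ‖psiTransform s‖ ≤ C * (1 + |s.im|) ^ (-(3 / 4) : ℝ) := by
  obtain ⟨K, hK, h⟩ := exists_window_bound
  refine ⟨8 * (K + K / ε + 1), by positivity, fun s h1 h2 => ?_⟩
  obtain ⟨hcount, hlog⟩ := h (round s.im)
  set W := windowWeight (round s.im) with hW
  have hW1 : 1 ≤ W := one_le_windowWeight _
  have hmem := norm_sub_windowCentre_le (by linarith) h2 (abs_sub_round s.im)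
  have hz := hlog s hmem (riemannZeta₁_ne_zero hRH (by linarith))
  have hsum : ‖∑ ρ ∈ windowZeros (round s.im), (zetaOrder ρ : ℂ) / (s - ρ)‖ ≤ K * W / ε := by
    refine (norm_sum_le _ _).trans ?_
    rw [le_div_iff₀ hε, Finset.sum_mul]
    refine le_trans (Finset.sum_le_sum fun ρ hρ => ?_) hcount
    have hre := re_of_mem_windowZeros hRH hρ
    have h5 : ε ≤ ‖s - ρ‖ := by
      have := (le_abs_self _).trans (Complex.abs_re_le_norm (s - ρ))
      rw [Complex.sub_re, hre] at this
      linarith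
    rw [norm_div, Complex.norm_natCast, div_mul_eq_mul_div, div_le_iff₀ (by linarith)]
    gcongr
  have hnum : ‖deriv riemannZeta₁ s / riemannZeta₁ s + 1‖ ≤ (K + K / ε + 1) * W := by
    set S := ∑ ρ ∈ windowZeros (round s.im), (zetaOrder ρ : ℂ) / (s - ρ)
    set L := deriv riemannZeta₁ s / riemannZeta₁ s
    calc ‖L + 1‖ = ‖(L - S) + S + 1‖ := by ring_nf
      _ ≤ ‖L - S‖ + ‖S‖ + ‖(1 : ℂ)‖ := norm_add₃_le
      _ ≤ K * W + K * W / ε + 1 := by rw [norm_one]; gcongr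
      _ ≤ K * W + K * W / ε + W := by gcongr
      _ = _ := by ring
  have hq := quarter_le_norm (s := s) (by linarith)
  have ht := abs_nonneg s.im
  have hWle := windowWeight_round_le s.im
  rw [psiTransform, norm_div, norm_neg, div_le_iff₀ (by linarith)]
  calc _ ≤ (K + K / ε + 1) * W := hnum
    _ ≤ (K + K / ε + 1) * (2 * (1 + |s.im|) ^ (1 / 4 : ℝ)) := by gcongr
    _ = 8 * (K + K / ε + 1) * (1 + |s.im|) ^ (-(3 / 4) : ℝ) * ((1 + |s.im|) / 4) := by
        have : (1 + |s.im|) ^ (1 / 4 : ℝ) = (1 + |s.im|) ^ (-(3 / 4) : ℝ) * (1 + |s.im|) := by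
          conv_rhs => rw [← Real.rpow_add_one (by positivity)]
          norm_num
        rw [this]; ring
    _ ≤ _ := by gcongr

/-- The error term `ψ(e^y) - e^y`. -/
noncomputable def psiError (y : ℝ) : ℝ := Chebyshev.psi (Real.exp y) - Real.exp y

lemma measurable_psi : Measurable Chebyshev.psi := Chebyshev.psi_mono.measurable

lemma measurable_psiError : Measurable psiError := by
  unfold psiError
  exact (measurable_psi.comp Real.measurable_exp).sub Real.measurable_exp

lemma abs_psiError_le (y : ℝ) : |psiError y| ≤ (Real.log 4 + 5) * Real.exp y := by
  have h1 := Chebyshev.psi_le_const_mul_self (Real.exp_pos y).le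
  have h2 := Chebyshev.psi_nonneg (Real.exp y)
  have h3 := Real.exp_pos y
  have h4 : 0 ≤ Real.log 4 := Real.log_nonneg (by norm_num)
  rw [psiError, abs_le]
  constructor <;> nlinarith

lemma laplaceConv_psiError_one : LaplaceConv 1 (fun y => (psiError y : ℂ)) := by
  refine LaplaceConv.of_exp_bound (C := Real.log 4 + 5) ?_ fun y _ => ?_
  · exact (Complex.measurable_ofReal.comp measurable_psiError).aestronglyMeasurable
  · rw [Complex.norm_real, one_mul]
    exact abs_psiError_le y

lemma laplace_psiError_of_one_lt {s : ℂ} (hs : 1 < s.re) :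
    laplace (fun y => (psiError y : ℂ)) s = psiTransform s := by
  have hs1 : s ≠ 1 := fun h => by simp [h] at hs
  have hs0 : s ≠ 0 := fun h => by simp [h] at hs; linarith
  have h0 : s - 1 ≠ 0 := sub_ne_zero.mpr hs1
  have hpsi : ∀ y : ℝ, ∑ k ∈ Finset.Icc 1 ⌊Real.exp y⌋₊, ArithmeticFunction.vonMangoldt k
      = Chebyshev.psi (Real.exp y) := fun y => rfl
  have h1 := LSeries_eq_mul_laplace (fun n => ArithmeticFunction.vonMangoldt n)
    (fun n => ArithmeticFunction.vonMangoldt_nonneg) zero_le_one ?_ hs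
  swap
  · refine Asymptotics.IsBigO.of_bound (Real.log 4 + 4) (Eventually.of_forall fun n => ?_)
    have h2 := Chebyshev.psi_le_const_mul_self n.cast_nonneg (x := (n : ℝ))
    have h3 := Chebyshev.psi_nonneg (n : ℝ)
    have h4 : ∑ k ∈ Finset.Icc 1 n, ArithmeticFunction.vonMangoldt k = Chebyshev.psi n := by
      rw [Chebyshev.psi, Nat.floor_natCast]; rfl
    rw [h4, Real.rpow_one, Real.norm_of_nonneg h3, Real.norm_of_nonneg n.cast_nonneg]
    exact h2
  have h2 := ArithmeticFunction.LSeries_vonMangoldt_eq_deriv_riemannZeta_div hs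
  rw [h2] at h1
  simp only [hpsi] at h1
  have hpc : LaplaceConv 1 (fun y => (Chebyshev.psi (Real.exp y) : ℂ)) := by
    refine LaplaceConv.of_exp_bound (C := Real.log 4 + 4) ?_ fun y _ => ?_
    · exact (Complex.measurable_ofReal.comp (measurable_psi.comp
        Real.measurable_exp)).aestronglyMeasurable
    · rw [Complex.norm_real, one_mul, Real.norm_of_nonneg (Chebyshev.psi_nonneg _)]
      exact Chebyshev.psi_le_const_mul_self (Real.exp_pos y).le
  have h3 : laplace (fun y => (psiError y : ℂ)) s =
      laplace (fun y => (Chebyshev.psi (Real.exp y) : ℂ)) s - (s - 1)⁻¹ := by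
    rw [← laplace_exp_mul 1 (by simpa using hs),
      ← laplace_sub hpc (by simpa using laplaceConv_exp_mul 1) hs]
    simp [psiError]
  have hz : riemannZeta s ≠ 0 := riemannZeta_ne_zero_of_one_lt_re hs
  have hz1 : riemannZeta₁ s ≠ 0 := by
    intro h; apply hz; rw [riemannZeta_eq_inv_sub_mul hs1, h, mul_zero]
  have hlog : deriv riemannZeta s / riemannZeta s =
      deriv riemannZeta₁ s / riemannZeta₁ s - (s - 1)⁻¹ := by
    have hev : riemannZeta =ᶠ[nhds s] fun z => (z - 1)⁻¹ * riemannZeta₁ z := by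
      filter_upwards [isOpen_ne.mem_nhds hs1] with z hz using riemannZeta_eq_inv_sub_mul hz
    have hder : HasDerivAt (fun z : ℂ => (z - 1)⁻¹ * riemannZeta₁ z)
        (-1 / (s - 1) ^ 2 * riemannZeta₁ s + (s - 1)⁻¹ * deriv riemannZeta₁ s) s :=
      (((hasDerivAt_id s).sub_const 1).inv h0).mul (differentiable_riemannZeta₁ s).hasDerivAt
    rw [hev.deriv_eq, hder.deriv, riemannZeta_eq_inv_sub_mul hs1]
    field_simp
    ring
  rw [h3, psiTransform]
  rw [neg_div, hlog] at h1
  have h5 : laplace (fun y => (Chebyshev.psi (Real.exp y) : ℂ)) s =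
      -(deriv riemannZeta₁ s / riemannZeta₁ s - (s - 1)⁻¹) / s := by
    rw [h1]; field_simp
  rw [h5]
  field_simp
  ring

section

open scoped FourierTransform SchwartzMap ContDiff

lemma ae_eq_fourierInv_toLp {u : ℝ → ℂ} (hu : Integrable u) (h2 : MemLp (𝓕 u) 2 volume) :
    u =ᵐ[volume] (𝓕⁻ (h2.toLp (𝓕 u)) : Lp ℂ 2 (volume : Measure ℝ)) := by
  set w : Lp ℂ 2 (volume : Measure ℝ) := 𝓕⁻ (h2.toLp (𝓕 u)) with hw
  have hfw : 𝓕 w = h2.toLp (𝓕 u) := by rw [hw, FourierTransform.fourier_fourierInv_eq]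
  have hwloc : LocallyIntegrable w volume :=
    (Lp.memLp w).locallyIntegrable (by norm_num)
  have key : ∀ φ : 𝓢(ℝ, ℂ), ∫ x, (𝓕 φ) x • u x = ∫ x, (𝓕 φ) x • w x := fun φ => by
    have h1 := congrArg (fun T => T φ) (Lp.fourier_toTemperedDistribution_eq w)
    simp only [TemperedDistribution.fourier_apply, Lp.toTemperedDistribution_apply, hfw] at h1
    rw [h1]
    have h3 : ∫ x, φ x • (h2.toLp (𝓕 u)) x = ∫ x, φ x • (𝓕 u) x := by
      apply integral_congr_ae
      filter_upwards [h2.coeFn_toLp] with x hx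
      rw [hx]
    rw [h3, SchwartzMap.fourier_coe]
    simpa using! VectorFourier.integral_bilin_fourierIntegral_eq_flip (ContinuousLinearMap.lsmul ℂ ℂ)
      Real.continuous_fourierChar (L := innerₗ ℝ) continuous_inner φ.integrable hu
  refine ae_eq_of_integral_contDiff_smul_eq hu.locallyIntegrable hwloc fun g hg hgs => ?_
  have hgc : ContDiff ℝ ∞ (fun x => (g x : ℂ)) := Complex.ofRealCLM.contDiff.comp hg
  have hgcs : HasCompactSupport (fun x => (g x : ℂ)) := hgs.comp_left (g := Complex.ofReal) rfl
  have := key (𝓕⁻ (hgcs.toSchwartzMap hgc))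
  rw [FourierTransform.fourier_fourierInv_eq] at this
  simpa using this

lemma lintegral_fourier_sq {u : ℝ → ℂ} (hu : Integrable u) (h2 : MemLp (𝓕 u) 2 volume) :
    ∫⁻ x, ‖u x‖ₑ ^ 2 = ∫⁻ t, ‖𝓕 u t‖ₑ ^ 2 := by
  have h1 := eLpNorm_congr_ae (p := 2) (ae_eq_fourierInv_toLp hu h2)
  set w : Lp ℂ 2 (volume : Measure ℝ) := 𝓕⁻ (h2.toLp (𝓕 u)) with hw
  have hfw : 𝓕 w = h2.toLp (𝓕 u) := by rw [hw, FourierTransform.fourier_fourierInv_eq]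
  have h3 : eLpNorm u 2 volume = eLpNorm (𝓕 u) 2 volume := by
    rw [h1, ← Lp.enorm_def, ← eLpNorm_congr_ae h2.coeFn_toLp, ← Lp.enorm_def, ← hfw,
      ← ofReal_norm, ← ofReal_norm, Lp.norm_fourier_eq]
  have h4 := congrArg (fun x => x ^ (2 : ℝ)) h3
  simp only [eLpNorm_eq_lintegral_rpow_enorm_toReal (p := 2) (by norm_num) (by norm_num),
    ENNReal.toReal_ofNat, ← ENNReal.rpow_mul] at h4
  norm_num at h4
  exact h4

lemma fourier_indicator_eq_laplace (u : ℝ → ℂ) (σ ξ : ℝ) :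
    𝓕 ((Ioi (0 : ℝ)).indicator fun y : ℝ => u y * Complex.exp (-(σ : ℂ) * y)) ξ =
      laplace u (σ + ((2 * π * ξ : ℝ) : ℂ) * Complex.I) := by
  rw [Real.fourier_real_eq_integral_exp_smul, laplace, ← integral_indicator measurableSet_Ioi]
  congr 1 with y
  by_cases hy : y ∈ Ioi (0 : ℝ)
  · rw [indicator_of_mem hy, indicator_of_mem hy, smul_eq_mul, mul_comm, mul_assoc,
      ← Complex.exp_add]
    congr 2
    push_cast
    ring
  · simp [indicator_of_notMem hy]

lemma lintegral_sq_le_laplace {a : ℝ} {u : ℝ → ℂ} (h : LaplaceConv a u) {σ : ℝ} (hσ : a < σ) :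
    ∫⁻ y in Ioi (0 : ℝ), ‖u y‖ₑ ^ 2 * ENNReal.ofReal (Real.exp (-(2 * σ) * y)) ≤
      ∫⁻ t : ℝ, ‖laplace u (σ + (t : ℂ) * Complex.I)‖ₑ ^ 2 := by
  rcases eq_or_ne (∫⁻ t : ℝ, ‖laplace u (σ + (t : ℂ) * Complex.I)‖ₑ ^ 2) ⊤ with htop | htop
  · rw [htop]; exact le_top
  set v : ℝ → ℂ := (Ioi (0 : ℝ)).indicator fun y : ℝ => u y * Complex.exp (-(σ : ℂ) * y) with hv
  have hvi : Integrable v := (h σ hσ).integrable_indicator measurableSet_Ioi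
  have hcont : Continuous (𝓕 v) :=
    VectorFourier.fourierIntegral_continuous Real.continuous_fourierChar continuous_inner hvi
  have hπ : (2 * π) ≠ 0 := by positivity
  have hlc : Continuous fun t : ℝ => laplace u (σ + (t : ℂ) * Complex.I) := by
    have : (fun t : ℝ => laplace u (σ + (t : ℂ) * Complex.I)) = fun t => 𝓕 v (t / (2 * π)) := by
      ext t
      rw [hv, fourier_indicator_eq_laplace, mul_div_cancel₀ _ hπ]
    rw [this]
    fun_prop
  have hscale : ∫⁻ ξ : ℝ, ‖𝓕 v ξ‖ₑ ^ 2 = ENNReal.ofReal |(2 * π)⁻¹| *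
      ∫⁻ t : ℝ, ‖laplace u (σ + (t : ℂ) * Complex.I)‖ₑ ^ 2 := by
    rw [← smul_eq_mul, ← lintegral_smul_measure, ← Real.map_volume_mul_left hπ,
      lintegral_map (hlc.enorm.measurable.pow_const 2) (by fun_prop)]
    simp only [hv, fourier_indicator_eq_laplace]
  have hle : ∫⁻ ξ : ℝ, ‖𝓕 v ξ‖ₑ ^ 2 ≤ ∫⁻ t : ℝ, ‖laplace u (σ + (t : ℂ) * Complex.I)‖ₑ ^ 2 := by
    rw [hscale]
    refine (mul_le_mul_left ?_ _).trans (one_mul _).le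
    rw [ENNReal.ofReal_le_one, abs_of_pos (by positivity)]
    exact inv_le_one_of_one_le₀ (by linarith [Real.pi_gt_three])
  have hmem : MemLp (𝓕 v) 2 volume := by
    refine ⟨hcont.aestronglyMeasurable, ?_⟩
    rw [eLpNorm_lt_top_iff_lintegral_rpow_enorm_lt_top (by norm_num) (by norm_num)]
    simpa using hle.trans_lt htop.lt_top
  refine le_trans (le_of_eq ?_) ((lintegral_fourier_sq hvi hmem).le.trans hle)
  rw [← lintegral_indicator measurableSet_Ioi]
  congr 1 with y
  by_cases hy : y ∈ Ioi (0 : ℝ)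
  · rw [indicator_of_mem hy, hv, indicator_of_mem hy, enorm_mul, mul_pow]
    congr 1
    rw [← ofReal_norm, norm_exp_neg_mul, ← ENNReal.ofReal_pow (Real.exp_nonneg _),
      ← Real.exp_nat_mul, Complex.ofReal_re]
    congr 2
    push_cast
    ring
  · simp [hv, indicator_of_notMem hy]

lemma norm_iteratedDeriv_le_of_decay {b r C σ : ℝ} {H : ℂ → ℂ}
    (hH : DifferentiableOn ℂ H {s | b < s.re}) (hr : 0 < r) (hr' : r ≤ 3 / 4) (hb : b < σ - r)
    (hC : 0 ≤ C)
    (hbd : ∀ s : ℂ, σ - r ≤ s.re → s.re ≤ σ + r → ‖H s‖ ≤ C * (1 + |s.im|) ^ (-(3 / 4) : ℝ))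
    (k : ℕ) (t : ℝ) :
    ‖iteratedDeriv k H (σ + (t : ℂ) * Complex.I)‖ ≤
      k.factorial * (4 * C * (1 + |t|) ^ (-(3 / 4) : ℝ)) / r ^ k := by
  have hsub : Metric.closedBall (σ + (t : ℂ) * Complex.I) r ⊆ {s : ℂ | b < s.re} := by
    intro z hz
    rw [Metric.mem_closedBall, Complex.dist_eq] at hz
    have := (Complex.abs_re_le_norm _).trans hz
    simp at this
    have := abs_le.1 this
    change b < z.re; linarith
  refine Complex.norm_iteratedDeriv_le_of_forall_mem_sphere_norm_le k hr
    (hH.diffContOnCl_ball hsub) ?_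
  intro z hz
  rw [mem_sphere_iff_norm] at hz
  have h1 := (Complex.abs_re_le_norm _).trans hz.le
  have h2 := (Complex.abs_im_le_norm _).trans hz.le
  simp at h1 h2
  have h1 := abs_le.1 h1
  refine (hbd z (by linarith) (by linarith)).trans ?_
  have h3 : (1 + |t|) / 4 ≤ 1 + |z.im| := by
    have : |t| ≤ |z.im - t| + |z.im| := by
      have := abs_sub_abs_le_abs_sub t z.im
      rw [abs_sub_comm] at this; linarith
    linarith [abs_nonneg t]
  have h0 : 0 < 1 + |t| := by positivity
  have h4 : (1 + |z.im|) ^ (-(3 / 4) : ℝ) ≤ ((1 + |t|) / 4) ^ (-(3 / 4) : ℝ) :=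
    Real.rpow_le_rpow_of_nonpos (by positivity) h3 (by norm_num)
  have h5 : ((1 + |t|) / 4) ^ (-(3 / 4) : ℝ) ≤ 4 * (1 + |t|) ^ (-(3 / 4) : ℝ) := by
    rw [div_eq_mul_inv, Real.mul_rpow h0.le (by norm_num), mul_comm]
    gcongr
    rw [Real.inv_rpow (by norm_num), Real.rpow_neg (by norm_num), inv_inv]
    calc (4 : ℝ) ^ (3 / 4 : ℝ) ≤ 4 ^ (1 : ℝ) :=
          Real.rpow_le_rpow_of_exponent_le (by norm_num) (by norm_num)
      _ = 4 := by norm_num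
  calc C * (1 + |z.im|) ^ (-(3 / 4) : ℝ) ≤ C * (4 * (1 + |t|) ^ (-(3 / 4) : ℝ)) := by
        gcongr; exact h4.trans h5
    _ = _ := by ring

lemma lintegral_decay_sq_ne_top (C : ℝ) :
    ∫⁻ t : ℝ, ENNReal.ofReal (C * (1 + |t|) ^ (-(3 / 4) : ℝ)) ^ 2 ≠ ⊤ := by
  rcases le_total C 0 with hC | hC
  · have : ∀ t : ℝ, ENNReal.ofReal (C * (1 + |t|) ^ (-(3 / 4) : ℝ)) = 0 := fun t =>
      ENNReal.ofReal_of_nonpos (mul_nonpos_of_nonpos_of_nonneg hC (by positivity))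
    simp [this]
  have h := (integrable_one_add_norm (E := ℝ) (μ := volume) (r := 3 / 2)
    (by simp; norm_num)).const_mul (C ^ 2)
  have h2 : ∀ t : ℝ, ENNReal.ofReal (C * (1 + |t|) ^ (-(3 / 4) : ℝ)) ^ 2 =
      ENNReal.ofReal (C ^ 2 * (1 + ‖t‖) ^ (-(3 / 2) : ℝ)) := fun t => by
    rw [← ENNReal.ofReal_pow (by positivity), mul_pow, ← Real.rpow_natCast, ← Real.rpow_natCast,
      ← Real.rpow_mul (by positivity), Real.norm_eq_abs]
    norm_num
  simp only [h2]
  exact h.lintegral_lt_top.ne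

lemma lintegral_moment_le {a b r C σ : ℝ} {u : ℝ → ℂ} {H : ℂ → ℂ}
    (h : LaplaceConv a u) (haσ : a < σ) (hHu : ∀ s : ℂ, a < s.re → laplace u s = H s)
    (hH : DifferentiableOn ℂ H {s | b < s.re}) (hr : 0 < r) (hr' : r ≤ 3 / 4) (hb : b < σ - r)
    (hC : 0 ≤ C)
    (hbd : ∀ s : ℂ, σ - r ≤ s.re → s.re ≤ σ + r → ‖H s‖ ≤ C * (1 + |s.im|) ^ (-(3 / 4) : ℝ))
    (k : ℕ) :
    ∫⁻ y in Ioi (0 : ℝ), ENNReal.ofReal (y ^ (2 * k)) *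
        (‖u y‖ₑ ^ 2 * ENNReal.ofReal (Real.exp (-(2 * σ) * y))) ≤
      ENNReal.ofReal ((k.factorial / r ^ k) ^ 2) *
        ∫⁻ t : ℝ, ENNReal.ofReal (4 * C * (1 + |t|) ^ (-(3 / 4) : ℝ)) ^ 2 := by
  have h1 := lintegral_sq_le_laplace (h.pow_mul k) haσ
  refine le_trans (le_of_eq ?_) (h1.trans ?_)
  · refine setLIntegral_congr_fun measurableSet_Ioi fun y hy => ?_
    have hy : 0 < y := hy
    simp only [enorm_mul, mul_pow, mul_assoc]
    congr 1
    rw [← ofReal_norm, ← ENNReal.ofReal_pow (norm_nonneg _), norm_pow, Complex.norm_real,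
      Real.norm_eq_abs, abs_of_pos hy, ← pow_mul, mul_comm k 2]
  · rw [← lintegral_const_mul' _ _ ENNReal.ofReal_ne_top]
    refine lintegral_mono fun t => ?_
    have hs : a < ((σ : ℂ) + (t : ℂ) * Complex.I).re := by simpa using haσ
    have h2 : laplace u =ᶠ[nhds ((σ : ℂ) + (t : ℂ) * Complex.I)] H := by
      filter_upwards [(isOpen_halfPlane a).mem_nhds hs] with z hz using hHu z hz
    have h3 := iteratedDeriv_laplace h k hs
    have h4 : ‖laplace (fun y => y ^ k * u y) (σ + (t : ℂ) * Complex.I)‖ =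
        ‖iteratedDeriv k H (σ + (t : ℂ) * Complex.I)‖ := by
      rw [← h2.iteratedDeriv_eq k, h3]; simp
    have h5 := norm_iteratedDeriv_le_of_decay hH hr hr' hb hC hbd k t
    rw [← ofReal_norm, h4, ← ENNReal.ofReal_pow (norm_nonneg _),
      ← ENNReal.ofReal_pow (by positivity), ← ENNReal.ofReal_mul (by positivity), ← mul_pow]
    refine ENNReal.ofReal_le_ofReal ?_
    gcongr
    exact h5.trans_eq (by ring)

lemma factorial_sq_div_le (k : ℕ) {q : ℝ} (hq : 0 ≤ q) :
    (2 ^ (2 * k) * q ^ k / (2 * k).factorial) * (k.factorial : ℝ) ^ 2 ≤ (2 * k + 1) * q ^ k := by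
  have h1 : (Nat.centralBinom k) * (k.factorial * k.factorial) = (2 * k).factorial := by
    have := Nat.choose_mul_factorial_mul_factorial (n := 2 * k) (k := k) (by lia)
    rw [show 2 * k - k = k by lia] at this
    rw [Nat.centralBinom, ← this, mul_assoc]
  have h2 : (4 : ℝ) ^ k ≤ (2 * k + 1) * Nat.centralBinom k := by
    exact_mod_cast Nat.four_pow_le_two_mul_add_one_mul_central_binom k
  have hf : (0 : ℝ) < k.factorial := by positivity
  have hc : (0 : ℝ) < Nat.centralBinom k := by exact_mod_cast Nat.centralBinom_pos k
  rw [← h1, pow_mul]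
  push_cast
  have : (2 ^ 2 : ℝ) ^ k * q ^ k / (Nat.centralBinom k * (k.factorial * k.factorial)) *
      (k.factorial : ℝ) ^ 2 = (4 : ℝ) ^ k / Nat.centralBinom k * q ^ k := by
    field_simp; norm_num [mul_comm]
  rw [this]
  gcongr
  rwa [div_le_iff₀ hc]

lemma lintegral_sq_exp_ne_top {a b r C σ η : ℝ} {u : ℝ → ℂ} {H : ℂ → ℂ}
    (h : LaplaceConv a u) (haσ : a < σ) (hHu : ∀ s : ℂ, a < s.re → laplace u s = H s)
    (hH : DifferentiableOn ℂ H {s | b < s.re}) (hr : 0 < r) (hr' : r ≤ 3 / 4) (hb : b < σ - r)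
    (hC : 0 ≤ C)
    (hbd : ∀ s : ℂ, σ - r ≤ s.re → s.re ≤ σ + r → ‖H s‖ ≤ C * (1 + |s.im|) ^ (-(3 / 4) : ℝ))
    (hη : 0 ≤ η) (hηr : η < r) :
    ∫⁻ y in Ioi (0 : ℝ), ‖u y‖ₑ ^ 2 * ENNReal.ofReal (Real.exp (-(2 * (σ - η)) * y)) ≠ ⊤ := by
  set D := ∫⁻ t : ℝ, ENNReal.ofReal (4 * C * (1 + |t|) ^ (-(3 / 4) : ℝ)) ^ 2 with hD
  have hDt : D ≠ ⊤ := lintegral_decay_sq_ne_top _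
  set q := (η / r) ^ 2 with hq
  have hq0 : 0 ≤ q := by positivity
  have hq1 : q < 1 := by
    rw [hq, sq_lt_one_iff₀ (by positivity), div_lt_one hr]; exact hηr
  have hm : AEMeasurable (fun y => ‖u y‖ₑ ^ 2 * ENNReal.ofReal (Real.exp (-(2 * σ) * y)))
      (volume.restrict (Ioi 0)) :=
    (h.aestronglyMeasurable.enorm.pow_const 2).mul (by fun_prop)
  have hpt : ∀ y : ℝ, ‖u y‖ₑ ^ 2 * ENNReal.ofReal (Real.exp (-(2 * (σ - η)) * y)) ≤
      ∑' k : ℕ, ENNReal.ofReal (2 * ((2 * η) ^ (2 * k) / (2 * k).factorial)) *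
        (ENNReal.ofReal (y ^ (2 * k)) *
        (‖u y‖ₑ ^ 2 * ENNReal.ofReal (Real.exp (-(2 * σ) * y)))) := fun y => by
    have h1 := (Real.hasSum_cosh (2 * η * y)).mul_left 2
    have h2 : Real.exp (2 * η * y) ≤ 2 * Real.cosh (2 * η * y) := by
      rw [Real.cosh_eq]; linarith [Real.exp_pos (-(2 * η * y))]
    have hnn : ∀ k : ℕ, 0 ≤ 2 * ((2 * η * y) ^ (2 * k) / ((2 * k).factorial : ℝ)) := fun k => by
      have : 0 ≤ (2 * η * y) ^ (2 * k) := by rw [pow_mul]; positivity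
      positivity
    have h3 : ENNReal.ofReal (Real.exp (2 * η * y)) ≤
        ∑' k : ℕ, ENNReal.ofReal (2 * ((2 * η * y) ^ (2 * k) / (2 * k).factorial)) := by
      rw [← ENNReal.ofReal_tsum_of_nonneg hnn h1.summable, h1.tsum_eq]
      exact ENNReal.ofReal_le_ofReal h2
    have h4 : ∀ k : ℕ, ENNReal.ofReal (2 * ((2 * η) ^ (2 * k) / (2 * k).factorial)) *
        (ENNReal.ofReal (y ^ (2 * k)) *
        (‖u y‖ₑ ^ 2 * ENNReal.ofReal (Real.exp (-(2 * σ) * y)))) =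
        ENNReal.ofReal (2 * ((2 * η * y) ^ (2 * k) / (2 * k).factorial)) *
        (‖u y‖ₑ ^ 2 * ENNReal.ofReal (Real.exp (-(2 * σ) * y))) := fun k => by
      rw [← mul_assoc, ← ENNReal.ofReal_mul (by positivity), mul_pow (2 * η) y]
      congr 2
      ring
    simp only [h4]
    rw [ENNReal.tsum_mul_right]
    calc _ = ENNReal.ofReal (Real.exp (2 * η * y)) *
          (‖u y‖ₑ ^ 2 * ENNReal.ofReal (Real.exp (-(2 * σ) * y))) := by
          rw [mul_left_comm, ← ENNReal.ofReal_mul (Real.exp_nonneg _), ← Real.exp_add]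
          congr 3
          ring
      _ ≤ _ := by gcongr
  have hsum : ∀ k : ℕ, ∫⁻ y in Ioi (0 : ℝ),
      ENNReal.ofReal (2 * ((2 * η) ^ (2 * k) / (2 * k).factorial)) *
        (ENNReal.ofReal (y ^ (2 * k)) *
        (‖u y‖ₑ ^ 2 * ENNReal.ofReal (Real.exp (-(2 * σ) * y)))) ≤
      ENNReal.ofReal (2 * ((2 * k + 1) * q ^ k)) * D := fun k => by
    rw [lintegral_const_mul' _ _ ENNReal.ofReal_ne_top]
    calc _ ≤ ENNReal.ofReal (2 * ((2 * η) ^ (2 * k) / (2 * k).factorial)) *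
          (ENNReal.ofReal ((k.factorial / r ^ k) ^ 2) * D) := by
          gcongr
          exact lintegral_moment_le h haσ hHu hH hr hr' hb hC hbd k
      _ = ENNReal.ofReal (2 * ((2 * η) ^ (2 * k) / (2 * k).factorial) *
            (k.factorial / r ^ k) ^ 2) * D := by
          rw [← mul_assoc, ← ENNReal.ofReal_mul (by positivity)]
      _ ≤ _ := by
          gcongr ENNReal.ofReal ?_ * D
          have := factorial_sq_div_le k hq0
          calc _ = 2 * ((2 ^ (2 * k) * q ^ k / (2 * k).factorial) * (k.factorial : ℝ) ^ 2) := by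
                rw [hq, ← pow_mul, div_pow, div_pow, mul_pow, ← pow_mul, mul_comm k 2]
                ring
            _ ≤ _ := by gcongr
  have hsummable : Summable fun k : ℕ => 2 * ((2 * (k : ℝ) + 1) * q ^ k) := by
    have h1 := summable_pow_mul_geometric_of_norm_lt_one 1 (r := q)
      (by rwa [Real.norm_eq_abs, abs_of_nonneg hq0])
    have h0 := summable_geometric_of_lt_one hq0 hq1
    refine (((h1.mul_left 2).add h0).mul_left 2).congr fun k => ?_
    simp only [pow_one]; ring
  refine ne_top_of_le_ne_top ?_ (lintegral_mono hpt)
  rw [lintegral_tsum]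
  · refine ne_top_of_le_ne_top ?_ (ENNReal.tsum_le_tsum hsum)
    rw [ENNReal.tsum_mul_right, ← ENNReal.ofReal_tsum_of_nonneg (fun k => by positivity) hsummable]
    exact ENNReal.mul_ne_top ENNReal.ofReal_ne_top hDt
  · intro k
    exact ((ENNReal.measurable_ofReal.comp (measurable_id.pow_const _)).aemeasurable.mul
      hm).const_mul _

lemma LaplaceConv.of_decay {a b r C σ : ℝ} {u : ℝ → ℂ} {H : ℂ → ℂ}
    (h : LaplaceConv a u) (haσ : a < σ) (hHu : ∀ s : ℂ, a < s.re → laplace u s = H s)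
    (hH : DifferentiableOn ℂ H {s | b < s.re}) (hr : 0 < r) (hr' : r ≤ 3 / 4) (hb : b < σ - r)
    (hC : 0 ≤ C)
    (hbd : ∀ s : ℂ, σ - r ≤ s.re → s.re ≤ σ + r → ‖H s‖ ≤ C * (1 + |s.im|) ^ (-(3 / 4) : ℝ)) :
    LaplaceConv (σ - r) u := by
  intro τ hτ
  obtain ⟨η, hη0, hη1, hητ⟩ : ∃ η, 0 ≤ η ∧ η < r ∧ σ - η < τ :=
    ⟨max 0 ((σ - τ + r) / 2), le_max_left _ _, max_lt hr (by linarith), by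
      have := le_max_right 0 ((σ - τ + r) / 2); linarith⟩
  have hm : AEStronglyMeasurable (fun y : ℝ => u y * Complex.exp (-(τ : ℂ) * y))
      (volume.restrict (Ioi 0)) :=
    h.aestronglyMeasurable.mul (Continuous.aestronglyMeasurable (by fun_prop))
  have h1 := lintegral_sq_exp_ne_top h haσ hHu hH hr hr' hb hC hbd hη0 hη1
  have h2 : IntegrableOn (fun y : ℝ => ‖u y‖ ^ 2 * Real.exp (-(2 * (σ - η)) * y)) (Ioi 0) := by
    refine ⟨(h.aestronglyMeasurable.norm.pow 2).mul
      (Continuous.aestronglyMeasurable (by fun_prop)), ?_⟩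
    rw [hasFiniteIntegral_iff_norm]
    refine lt_of_le_of_lt (lintegral_mono fun y => ?_) h1.lt_top
    rw [norm_mul, norm_pow, norm_norm, Real.norm_eq_abs, abs_of_pos (Real.exp_pos _),
      ENNReal.ofReal_mul (by positivity), ENNReal.ofReal_pow (norm_nonneg _), ofReal_norm]
  have h3 : IntegrableOn (fun y : ℝ => Real.exp (-(2 * (τ - (σ - η))) * y)) (Ioi 0) :=
    exp_neg_integrableOn_Ioi 0 (by linarith)
  refine Integrable.mono' (h2.add h3) hm (ae_of_all _ fun y => ?_)
  rw [norm_mul, norm_exp_neg_mul, Complex.ofReal_re]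
  have e1 : Real.exp (-(2 * (σ - η)) * y) = Real.exp (-(σ - η) * y) ^ 2 := by
    rw [← Real.exp_nat_mul]; congr 1; push_cast; ring
  have e2 : Real.exp (-(2 * (τ - (σ - η))) * y) = Real.exp (-(τ - (σ - η)) * y) ^ 2 := by
    rw [← Real.exp_nat_mul]; congr 1; push_cast; ring
  have e3 : Real.exp (-τ * y) = Real.exp (-(σ - η) * y) * Real.exp (-(τ - (σ - η)) * y) := by
    rw [← Real.exp_add]; congr 1; ring
  simp only [Pi.add_apply]
  rw [e1, e2, e3]
  nlinarith [sq_nonneg (‖u y‖ * Real.exp (-(σ - η) * y) - Real.exp (-(τ - (σ - η)) * y)),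
    sq_nonneg (‖u y‖ * Real.exp (-(σ - η) * y)), sq_nonneg (Real.exp (-(τ - (σ - η)) * y))]

lemma laplaceConv_psiError (hRH : RiemannHypothesis) :
    LaplaceConv (1 / 2) (fun y => (psiError y : ℂ)) := by
  intro τ hτ
  rcases lt_or_ge 1 τ with h | h
  · exact laplaceConv_psiError_one τ h
  obtain ⟨C, hC, hbd⟩ := exists_psiTransform_bound hRH (ε := (τ - 1 / 2) / 2) (by linarith)
  have := LaplaceConv.of_decay (σ := 5 / 4) (r := 5 / 4 - (1 / 2 + (τ - 1 / 2) / 2))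
    laplaceConv_psiError_one (by norm_num)
    (fun s hs => laplace_psiError_of_one_lt hs) (differentiableOn_psiTransform hRH)
    (by linarith) (by linarith) (by linarith) hC.le
    (fun s h1 h2 => hbd s (by linarith) (by linarith))
  exact this τ (by linarith)

lemma laplace_psiError (hRH : RiemannHypothesis) {s : ℂ} (hs : 1 / 2 < s.re) :
    laplace (fun y => (psiError y : ℂ)) s = psiTransform s := by
  have hc := laplaceConv_psiError hRH
  have hopen := isOpen_halfPlane (1 / 2)
  have h1 := (differentiableOn_laplace hc).analyticOnNhd hopen
  have h2 := (differentiableOn_psiTransform hRH).analyticOnNhd hopen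
  refine h1.eqOn_of_preconnected_of_eventuallyEq h2
    (convex_halfSpace_re_gt _).isPreconnected (z₀ := 2) (by norm_num) ?_ hs
  filter_upwards [(isOpen_halfPlane 1).mem_nhds (show (1 : ℝ) < (2 : ℂ).re by norm_num)] with z hz
  exact laplace_psiError_of_one_lt hz

end

/-- The zeros of `ζ` seen from the windows with centre at height at most `N`. -/
noncomputable def zeroSet (N : ℕ) : Finset ℂ :=
  (Finset.Icc (-(N : ℤ)) N).biUnion windowZeros

lemma re_of_mem_zeroSet (hRH : RiemannHypothesis) {N : ℕ} {ρ : ℂ} (h : ρ ∈ zeroSet N) :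
    ρ.re = 1 / 2 := by
  obtain ⟨n, -, hn⟩ := Finset.mem_biUnion.mp h
  exact re_of_mem_windowZeros hRH hn

/-- The partial sum `-∑ e^{ρ y} / ρ` of the explicit formula. -/
noncomputable def zeroSum (N : ℕ) (y : ℝ) : ℂ :=
  ∑ ρ ∈ zeroSet N, (-(zetaOrder ρ : ℂ) / ρ) * Complex.exp (ρ * y)

lemma laplaceConv_sum {a : ℝ} (S : Finset ℂ) (c : ℂ → ℂ) (hS : ∀ ρ ∈ S, ρ.re = a) :
    LaplaceConv a (fun y => ∑ ρ ∈ S, c ρ * Complex.exp (ρ * y)) ∧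
    ∀ s : ℂ, a < s.re → laplace (fun y => ∑ ρ ∈ S, c ρ * Complex.exp (ρ * y)) s =
      ∑ ρ ∈ S, c ρ / (s - ρ) := by
  classical
  induction S using Finset.induction_on with
  | empty => exact ⟨fun σ _ => by simp, fun s _ => by simp [laplace]⟩
  | insert ρ S hρ ih =>
    obtain ⟨h1, h2⟩ := ih fun z hz => hS z (Finset.mem_insert_of_mem hz)
    have hr := hS ρ (Finset.mem_insert_self _ _)
    have h3 : LaplaceConv a (fun y : ℝ => c ρ * Complex.exp (ρ * y)) :=
      ((laplaceConv_exp_mul ρ).mono hr.le).const_mul _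
    simp only [Finset.sum_insert hρ]
    refine ⟨h3.add h1, fun s hs => ?_⟩
    rw [laplace_add h3 h1 hs, h2 s hs, laplace_const_mul, laplace_exp_mul ρ (by rwa [hr]),
      div_eq_mul_inv]

lemma laplaceConv_residual (hRH : RiemannHypothesis) (N : ℕ) :
    LaplaceConv (1 / 2) (fun y => (psiError y : ℂ) - zeroSum N y) :=
  (laplaceConv_psiError hRH).sub
    (laplaceConv_sum _ (fun ρ => -(zetaOrder ρ : ℂ) / ρ) fun _ h => re_of_mem_zeroSet hRH h).1

lemma laplace_residual (hRH : RiemannHypothesis) (N : ℕ) {s : ℂ} (hs : 1 / 2 < s.re) :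
    laplace (fun y => (psiError y : ℂ) - zeroSum N y) s =
      -(deriv riemannZeta₁ s / riemannZeta₁ s + 1 -
        ∑ ρ ∈ zeroSet N, (zetaOrder ρ : ℂ) / (s - ρ) -
        ∑ ρ ∈ zeroSet N, (zetaOrder ρ : ℂ) / ρ) / s := by
  have h := laplaceConv_sum (a := 1 / 2) (zeroSet N) (fun ρ => -(zetaOrder ρ : ℂ) / ρ)
    fun _ h => re_of_mem_zeroSet hRH h
  have h2 := laplace_sub (laplaceConv_psiError hRH) h.1 hs
  rw [h.2 s hs, laplace_psiError hRH hs] at h2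
  have hs0 : s ≠ 0 := by rintro rfl; norm_num at hs
  have h3 : ∑ ρ ∈ zeroSet N, -(zetaOrder ρ : ℂ) / ρ / (s - ρ) =
      -(∑ ρ ∈ zeroSet N, (zetaOrder ρ : ℂ) / (s - ρ) +
        ∑ ρ ∈ zeroSet N, (zetaOrder ρ : ℂ) / ρ) / s := by
    rw [← Finset.sum_add_distrib, ← Finset.sum_neg_distrib, Finset.sum_div]
    refine Finset.sum_congr rfl fun ρ hρ => ?_
    have hr := re_of_mem_zeroSet hRH hρ
    have h0 : ρ ≠ 0 := by rintro rfl; norm_num at hr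
    have h1 : s - ρ ≠ 0 := by
      intro h
      have := congrArg Complex.re h
      simp at this
      linarith
    field_simp
    ring
  unfold zeroSum
  rw [h2, h3, psiTransform]
  ring

lemma norm_sub_ge_of_mem_zeroSet_sdiff (hRH : RiemannHypothesis) {N : ℕ} {n : ℤ} {s ρ : ℂ}
    (hρ : ρ ∈ zeroSet N) (hn : ρ ∉ windowZeros n) (hs : |s.im - n| ≤ 1 / 2) :
    1 / 10 ≤ ‖s - ρ‖ := by
  have h0 : riemannZeta₁ ρ = 0 := by
    obtain ⟨m, -, hm⟩ := Finset.mem_biUnion.mp hρ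
    exact (mem_windowZeros.mp hm).2
  have h1 : 3 / 5 < |ρ.im - n| := by
    by_contra! h
    exact hn (mem_windowZeros_of_im (re_of_mem_zeroSet hRH hρ) h0 h)
  have h2 := Complex.abs_im_le_norm (s - ρ)
  rw [Complex.sub_im] at h2
  have h3 : |ρ.im - n| ≤ |s.im - ρ.im| + |s.im - n| := by
    have := abs_sub (s.im - n) (s.im - ρ.im)
    rw [show s.im - n - (s.im - ρ.im) = ρ.im - n by ring] at this
    linarith
  linarith

lemma sq_norm_sum_div_le {S T : Finset ℂ} (hST : S ⊆ T) (m : ℂ → ℕ) (s : ℂ) :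
    ‖∑ ρ ∈ S, (m ρ : ℂ) / (s - ρ)‖ ^ 2 ≤
      (∑ ρ ∈ T, (m ρ : ℝ)) * ∑ ρ ∈ T, (m ρ : ℝ) * (‖s - ρ‖ ^ 2)⁻¹ := by
  have h1 : ‖∑ ρ ∈ S, (m ρ : ℂ) / (s - ρ)‖ ≤ ∑ ρ ∈ T, (m ρ : ℝ) * ‖s - ρ‖⁻¹ := by
    refine (norm_sum_le _ _).trans ?_
    refine (Finset.sum_le_sum_of_subset_of_nonneg hST fun _ _ _ => norm_nonneg _).trans_eq ?_
    refine Finset.sum_congr rfl fun ρ _ => ?_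
    rw [norm_div, Complex.norm_natCast, div_eq_mul_inv]
  calc _ ≤ (∑ ρ ∈ T, (m ρ : ℝ) * ‖s - ρ‖⁻¹) ^ 2 := by gcongr
    _ ≤ _ := by
      refine Finset.sum_sq_le_sum_mul_sum_of_sq_le_mul T (fun _ _ => by positivity)
        (fun _ _ => by positivity) fun ρ _ => ?_
      rw [mul_pow, inv_pow]
      exact le_of_eq (by ring)

lemma exists_residual_bound (hRH : RiemannHypothesis) : ∃ K : ℝ, 0 < K ∧
    (∀ n, ∑ ρ ∈ windowZeros n, (zetaOrder ρ : ℝ) ≤ K * windowWeight n) ∧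
    ∀ N : ℕ, ∃ D : ℝ, 0 ≤ D ∧ ∀ (n : ℤ) (s : ℂ), 1 / 2 < s.re → s.re ≤ 7 / 2 →
      |s.im - n| ≤ 1 / 2 →
      ‖laplace (fun y => (psiError y : ℂ) - zeroSum N y) s‖ ^ 2 ≤
        (if (N : ℤ) < |n| then 128 * K * windowWeight n / (1 + |(n : ℝ)|) ^ 2 *
          ∑ ρ ∈ windowZeros n, (zetaOrder ρ : ℝ) * (‖s - ρ‖ ^ 2)⁻¹ else 0) +
        D * (windowWeight n ^ 2 / (1 + |(n : ℝ)|) ^ 2) := by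
  classical
  obtain ⟨K, hK, h⟩ := exists_window_bound
  refine ⟨K, hK, fun n => (h n).1, fun N => ?_⟩
  set M := ∑ ρ ∈ zeroSet N, (zetaOrder ρ : ℝ) with hM
  have hM0 : 0 ≤ M := Finset.sum_nonneg fun _ _ => by positivity
  set E := ‖∑ ρ ∈ zeroSet N, (zetaOrder ρ : ℂ) / ρ‖ with hE
  set C := K + 1 + 10 * M + E with hC
  have hE0 : 0 ≤ E := norm_nonneg _
  refine ⟨128 * C ^ 2, by positivity, fun n s h1 h2 h3 => ?_⟩
  have hw := one_le_windowWeight n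
  have hb := (h n).2 s (norm_sub_windowCentre_le h1.le h2 h3) (riemannZeta₁_ne_zero hRH h1)
  set Z := windowZeros n
  set S := zeroSet N with hS
  set f : ℂ → ℂ := fun ρ => (zetaOrder ρ : ℂ) / (s - ρ) with hf
  have hsplit : ∑ ρ ∈ Z, f ρ - ∑ ρ ∈ S, f ρ = ∑ ρ ∈ Z \ S, f ρ - ∑ ρ ∈ S \ Z, f ρ :=
    (Finset.sum_sdiff_sub_sum_sdiff).symm
  have hSZ : ‖∑ ρ ∈ S \ Z, f ρ‖ ≤ 10 * M := by
    rw [hM, Finset.mul_sum]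
    refine (norm_sum_le _ _).trans ?_
    refine (Finset.sum_le_sum fun ρ hρ => ?_).trans
      (Finset.sum_le_sum_of_subset_of_nonneg Finset.sdiff_subset fun _ _ _ => by positivity)
    obtain ⟨hρ1, hρ2⟩ := Finset.mem_sdiff.mp hρ
    have h5 := norm_sub_ge_of_mem_zeroSet_sdiff hRH hρ1 hρ2 h3
    rw [hf, norm_div, Complex.norm_natCast, div_le_iff₀ (by linarith)]
    nlinarith [(zetaOrder ρ).cast_nonneg (α := ℝ)]
  set A := ‖∑ ρ ∈ Z \ S, f ρ‖ with hA
  have hbr : ‖deriv riemannZeta₁ s / riemannZeta₁ s + 1 - ∑ ρ ∈ S, f ρ -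
      ∑ ρ ∈ S, (zetaOrder ρ : ℂ) / ρ‖ ≤ A + C * windowWeight n := by
    have e : deriv riemannZeta₁ s / riemannZeta₁ s + 1 - ∑ ρ ∈ S, f ρ -
        ∑ ρ ∈ S, (zetaOrder ρ : ℂ) / ρ =
        ∑ ρ ∈ Z \ S, f ρ + ((deriv riemannZeta₁ s / riemannZeta₁ s - ∑ ρ ∈ Z, f ρ) + 1
        - ∑ ρ ∈ S \ Z, f ρ - ∑ ρ ∈ S, (zetaOrder ρ : ℂ) / ρ) := by
      linear_combination hsplit
    rw [e]
    refine (norm_add_le _ _).trans ?_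
    gcongr
    refine (norm_sub_le _ _).trans ?_
    refine (add_le_add_left (norm_sub_le _ _) _).trans ?_
    refine (add_le_add_left (add_le_add_left (norm_add_le _ _) _) _).trans ?_
    rw [norm_one, ← hE]
    nlinarith
  have him : (1 + |(n : ℝ)|) / 8 ≤ ‖s‖ := by
    have h5 := quarter_le_norm h1.le
    have : |(n : ℝ)| ≤ |s.im - n| + |s.im| := by
      have := abs_sub_abs_le_abs_sub (n : ℝ) s.im
      rw [abs_sub_comm] at this; linarith
    linarith [abs_nonneg (n : ℝ)]
  have hn0 : 0 < 1 + |(n : ℝ)| := by positivity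
  rw [laplace_residual hRH N h1, norm_div, norm_neg]
  have hmain : (‖deriv riemannZeta₁ s / riemannZeta₁ s + 1 - ∑ ρ ∈ S, f ρ -
      ∑ ρ ∈ S, (zetaOrder ρ : ℂ) / ρ‖ / ‖s‖) ^ 2 ≤
      128 * A ^ 2 / (1 + |(n : ℝ)|) ^ 2 + 128 * C ^ 2 * (windowWeight n ^ 2 / (1 + |(n : ℝ)|) ^ 2) := by
    have hC0 : 0 ≤ C := by positivity
    calc _ ≤ ((A + C * windowWeight n) / ((1 + |(n : ℝ)|) / 8)) ^ 2 := by gcongr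
      _ = 64 * (A + C * windowWeight n) ^ 2 / (1 + |(n : ℝ)|) ^ 2 := by field_simp; norm_num
      _ ≤ 64 * (2 * (A ^ 2 + (C * windowWeight n) ^ 2)) / (1 + |(n : ℝ)|) ^ 2 := by
        gcongr; exact add_sq_le
      _ = _ := by ring
  refine hmain.trans ?_
  gcongr ?_ + _
  split_ifs with hN
  · have h6 : A ^ 2 ≤ (∑ ρ ∈ Z, (zetaOrder ρ : ℝ)) *
        ∑ ρ ∈ Z, (zetaOrder ρ : ℝ) * (‖s - ρ‖ ^ 2)⁻¹ :=
      sq_norm_sum_div_le Finset.sdiff_subset zetaOrder s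
    have h7 : 0 ≤ ∑ ρ ∈ Z, (zetaOrder ρ : ℝ) * (‖s - ρ‖ ^ 2)⁻¹ :=
      Finset.sum_nonneg fun _ _ => by positivity
    calc _ ≤ 128 * ((K * windowWeight n) * ∑ ρ ∈ Z, (zetaOrder ρ : ℝ) * (‖s - ρ‖ ^ 2)⁻¹) /
          (1 + |(n : ℝ)|) ^ 2 := by
          gcongr
          exact h6.trans (mul_le_mul_of_nonneg_right (h n).1 h7)
      _ = _ := by ring
  · have : Z \ S = ∅ := by
      rw [Finset.sdiff_eq_empty_iff_subset]
      intro ρ hρ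
      refine Finset.mem_biUnion.mpr ⟨n, ?_, hρ⟩
      rw [Finset.mem_Icc]
      exact abs_le.mp (not_lt.mp hN)
    rw [hA, this]; simp

lemma lintegral_inv_sq_add_sq {δ : ℝ} (hδ : 0 < δ) (γ : ℝ) :
    ∫⁻ t : ℝ, ENNReal.ofReal ((δ ^ 2 + (t - γ) ^ 2)⁻¹) = ENNReal.ofReal (π / δ) := by
  have h := ProbabilityTheory.lintegral_cauchyPDF_eq_one (x₀ := γ) (γ := δ.toNNReal)
    (Real.toNNReal_pos.mpr hδ).ne'
  have h2 : ∀ t : ℝ, ENNReal.ofReal ((δ ^ 2 + (t - γ) ^ 2)⁻¹) =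
      ENNReal.ofReal (π / δ) * ProbabilityTheory.cauchyPDF γ δ.toNNReal t := fun t => by
    rw [ProbabilityTheory.cauchyPDF_def, ← ENNReal.ofReal_mul (by positivity),
      ProbabilityTheory.cauchyPDFReal_def]
    congr 1
    rw [Real.coe_toNNReal δ hδ.le]
    have := Real.pi_pos
    field_simp
    ring
  simp only [h2]
  rw [lintegral_const_mul' _ _ ENNReal.ofReal_ne_top, h, mul_one]

lemma windowWeight_sq_div (n : ℤ) :
    windowWeight n ^ 2 / (1 + |(n : ℝ)|) ^ 2 = (1 + |(n : ℝ)|) ^ (-(3 / 2) : ℝ) := by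
  have h : 0 < 1 + |(n : ℝ)| := by positivity
  rw [windowWeight, ← Real.rpow_natCast, ← Real.rpow_mul h.le, ← Real.rpow_natCast,
    ← Real.rpow_sub h]
  norm_num

lemma windowWeight_sq_div_le {N : ℕ} {n : ℤ} (h : (N : ℤ) < |n|) :
    windowWeight n ^ 2 / (1 + |(n : ℝ)|) ^ 2 ≤
      (1 + (N : ℝ)) ^ (-(1 / 4) : ℝ) * (1 + |(n : ℝ)|) ^ (-(5 / 4) : ℝ) := by
  have hn : (N : ℝ) < |(n : ℝ)| := by exact_mod_cast h
  have h0 : 0 < 1 + |(n : ℝ)| := by positivity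
  rw [windowWeight_sq_div, show (-(3 / 2) : ℝ) = -(1 / 4) + -(5 / 4) by norm_num,
    Real.rpow_add h0]
  refine mul_le_mul_of_nonneg_right ?_ (by positivity)
  exact Real.rpow_le_rpow_of_nonpos (by positivity) (by linarith) (by norm_num)

lemma summable_one_add_abs_int : Summable fun n : ℤ => (1 + |(n : ℝ)|) ^ (-(5 / 4) : ℝ) := by
  have h := Real.summable_abs_int_rpow (b := 5 / 4) (by norm_num)
  refine Summable.of_norm_bounded_eventually h ?_
  have : ∀ᶠ n : ℤ in cofinite, n ≠ 0 := (finite_singleton 0).compl_mem_cofinite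
  filter_upwards [this] with n hn
  have hn : 0 < |(n : ℝ)| := by positivity
  rw [Real.norm_eq_abs, abs_of_nonneg (by positivity)]
  exact Real.rpow_le_rpow_of_nonpos hn (by linarith) (by norm_num)

lemma windowWeight_round_div_le (t : ℝ) :
    windowWeight (round t) / (1 + |(round t : ℝ)|) ≤ 4 * (1 + |t|) ^ (-(3 / 4) : ℝ) := by
  have h1 := windowWeight_round_le t
  have h2 := abs_sub_round t
  have h3 : (1 + |t|) / 2 ≤ 1 + |(round t : ℝ)| := by
    have := abs_sub_abs_le_abs_sub t (round t : ℝ)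
    linarith [abs_nonneg t]
  have h0 : 0 < 1 + |t| := by positivity
  calc _ ≤ 2 * (1 + |t|) ^ (1 / 4 : ℝ) / ((1 + |t|) / 2) := by gcongr
    _ = 4 * ((1 + |t|) ^ (1 / 4 : ℝ) / (1 + |t|) ^ (1 : ℝ)) := by
      rw [Real.rpow_one]; field_simp; norm_num
    _ = _ := by rw [← Real.rpow_sub h0]; norm_num

lemma exists_lintegral_residual_le (hRH : RiemannHypothesis) :
    ∃ C : ℝ, 0 ≤ C ∧ ∀ N : ℕ, ∃ D : ENNReal, D ≠ ⊤ ∧ ∀ δ : ℝ, 0 < δ → δ ≤ 1 →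
      ∫⁻ t : ℝ, ‖laplace (fun y => (psiError y : ℂ) - zeroSum N y)
        (((1 / 2 + δ : ℝ) : ℂ) + (t : ℂ) * Complex.I)‖ₑ ^ 2 ≤
      ENNReal.ofReal (C * (1 + (N : ℝ)) ^ (-(1 / 4) : ℝ) / δ) + D := by
  obtain ⟨K, hK, hKm, h⟩ := exists_residual_bound hRH
  set B := ∑' n : ℤ, (1 + |(n : ℝ)|) ^ (-(5 / 4) : ℝ) with hB
  have hB0 : 0 ≤ B := tsum_nonneg fun n => by positivity
  refine ⟨128 * π * K ^ 2 * B, by positivity, fun N => ?_⟩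
  obtain ⟨D, hD, hbd⟩ := h N
  refine ⟨_, lintegral_decay_sq_ne_top (√D * 4), fun δ hδ hδ1 => ?_⟩
  set a : ℤ → ℝ := fun n => 128 * K * windowWeight n / (1 + |(n : ℝ)|) ^ 2 with ha
  have hw : ∀ n, 0 < windowWeight n := fun n => one_pos.trans_le (one_le_windowWeight n)
  have ha0 : ∀ n, 0 ≤ a n := fun n => by have := hw n; positivity
  set b : ℤ → ℝ → ENNReal := fun n t => if (N : ℤ) < |n| then ENNReal.ofReal (a n) *
    ∑ ρ ∈ windowZeros n, ENNReal.ofReal (zetaOrder ρ) *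
      ENNReal.ofReal ((δ ^ 2 + (t - ρ.im) ^ 2)⁻¹) else 0 with hb
  have hpt : ∀ t : ℝ, ‖laplace (fun y => (psiError y : ℂ) - zeroSum N y)
        (((1 / 2 + δ : ℝ) : ℂ) + (t : ℂ) * Complex.I)‖ₑ ^ 2 ≤
      ∑' n, b n t + ENNReal.ofReal (√D * 4 * (1 + |t|) ^ (-(3 / 4) : ℝ)) ^ 2 := fun t => by
    set s : ℂ := ((1 / 2 + δ : ℝ) : ℂ) + (t : ℂ) * Complex.I with hs
    have hre : s.re = 1 / 2 + δ := by simp [hs]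
    have him : s.im = t := by simp [hs]
    have h1 := hbd (round t) s (by rw [hre]; linarith) (by rw [hre]; linarith)
      (by rw [him]; exact abs_sub_round t)
    rw [← ofReal_norm, ← ENNReal.ofReal_pow (norm_nonneg _)]
    refine (ENNReal.ofReal_le_ofReal h1).trans (ENNReal.ofReal_add_le.trans ?_)
    gcongr ?_ + ?_
    · refine le_trans (le_of_eq ?_) (ENNReal.le_tsum (round t))
      simp only [hb]
      split_ifs with hN
      · rw [ENNReal.ofReal_mul (ha0 _), ENNReal.ofReal_sum_of_nonneg fun _ _ => by positivity]
        congr 1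
        refine Finset.sum_congr rfl fun ρ hρ => ?_
        rw [ENNReal.ofReal_mul (by positivity), ← Complex.normSq_eq_norm_sq,
          Complex.normSq_apply, Complex.sub_re, Complex.sub_im, hre, him,
          re_of_mem_windowZeros hRH hρ]
        congr 3
        ring
      · simp
    · rw [← ENNReal.ofReal_pow (by positivity)]
      refine ENNReal.ofReal_le_ofReal ?_
      rw [mul_assoc, mul_pow, Real.sq_sqrt hD, ← div_pow]
      have := windowWeight_round_div_le t
      have := hw (round t)
      gcongr
  have hbm : ∀ n, Measurable (b n) := fun n => by
    simp only [hb]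
    split_ifs
    · fun_prop
    · fun_prop
  have hbi : ∀ n, ∫⁻ t, b n t ≤ ENNReal.ofReal (128 * π * K ^ 2 / δ *
      (1 + (N : ℝ)) ^ (-(1 / 4) : ℝ) * (1 + |(n : ℝ)|) ^ (-(5 / 4) : ℝ)) := fun n => by
    simp only [hb]
    split_ifs with hN
    · rw [lintegral_const_mul' _ _ ENNReal.ofReal_ne_top, lintegral_finsetSum _ fun ρ _ => by fun_prop]
      simp only [lintegral_const_mul' _ _ ENNReal.ofReal_ne_top, lintegral_inv_sq_add_sq hδ]
      rw [← Finset.sum_mul, ← ENNReal.ofReal_sum_of_nonneg fun _ _ => by positivity,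
        ← ENNReal.ofReal_mul (by positivity), ← ENNReal.ofReal_mul (ha0 n)]
      refine ENNReal.ofReal_le_ofReal ?_
      have h1 := hKm n
      have h2 := windowWeight_sq_div_le hN
      have h3 := hw n
      calc a n * ((∑ ρ ∈ windowZeros n, (zetaOrder ρ : ℝ)) * (π / δ))
          ≤ a n * ((K * windowWeight n) * (π / δ)) := by
            have := ha0 n; gcongr
        _ = 128 * π * K ^ 2 / δ * (windowWeight n ^ 2 / (1 + |(n : ℝ)|) ^ 2) := by
            rw [ha]; ring
        _ ≤ 128 * π * K ^ 2 / δ *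
            ((1 + (N : ℝ)) ^ (-(1 / 4) : ℝ) * (1 + |(n : ℝ)|) ^ (-(5 / 4) : ℝ)) := by gcongr
        _ = _ := by ring
    · simp
  calc _ ≤ ∫⁻ t : ℝ, (∑' n, b n t +
        ENNReal.ofReal (√D * 4 * (1 + |t|) ^ (-(3 / 4) : ℝ)) ^ 2) := lintegral_mono hpt
    _ = (∑' n, ∫⁻ t, b n t) +
        ∫⁻ t : ℝ, ENNReal.ofReal (√D * 4 * (1 + |t|) ^ (-(3 / 4) : ℝ)) ^ 2 := by
      rw [lintegral_add_left (Measurable.tsum hbm),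
        lintegral_tsum fun n => (hbm n).aemeasurable]
    _ ≤ _ := by
      gcongr
      refine (ENNReal.tsum_le_tsum hbi).trans_eq ?_
      rw [← ENNReal.ofReal_tsum_of_nonneg (fun n => by positivity)
        (summable_one_add_abs_int.mul_left _), tsum_mul_left, ← hB]
      congr 1
      ring

lemma exists_zeroSum_approx (hRH : RiemannHypothesis) {ε : ℝ} (hε : 0 < ε) :
    ∃ N : ℕ, ∀ᶠ δ in nhdsWithin (0 : ℝ) (Ioi 0),
      ∫⁻ y in Ioi (0 : ℝ), ‖(psiError y : ℂ) - zeroSum N y‖ₑ ^ 2 *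
        ENNReal.ofReal (Real.exp (-(2 * (1 / 2 + δ)) * y)) ≤ ENNReal.ofReal (ε / δ) := by
  obtain ⟨C, hC, h⟩ := exists_lintegral_residual_le hRH
  have hlim : Tendsto (fun N : ℕ => C * (1 + (N : ℝ)) ^ (-(1 / 4) : ℝ)) atTop (nhds (C * 0)) := by
    refine Tendsto.const_mul _ ?_
    exact (tendsto_rpow_neg_atTop (by norm_num)).comp
      (tendsto_atTop_add_const_left _ _ tendsto_natCast_atTop_atTop)
  rw [mul_zero] at hlim
  obtain ⟨N, hN⟩ := (hlim.eventually_lt_const (half_pos hε)).exists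
  obtain ⟨D, hD, hbd⟩ := h N
  refine ⟨N, ?_⟩
  have hδD : ∀ᶠ δ in nhdsWithin (0 : ℝ) (Ioi 0), δ * D.toReal < ε / 2 := by
    have : Tendsto (fun δ : ℝ => δ * D.toReal) (nhdsWithin 0 (Ioi 0)) (nhds (0 * D.toReal)) :=
      ((tendsto_id.mono_left nhdsWithin_le_nhds).mul_const _)
    rw [zero_mul] at this
    exact this.eventually_lt_const (half_pos hε)
  have hδ1 : ∀ᶠ δ in nhdsWithin (0 : ℝ) (Ioi 0), δ < 1 :=
    (tendsto_id.mono_left nhdsWithin_le_nhds).eventually_lt_const one_pos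
  filter_upwards [hδD, hδ1, self_mem_nhdsWithin] with δ h1 h2 h3
  have h3 : 0 < δ := h3
  refine (lintegral_sq_le_laplace (laplaceConv_residual hRH N) (by linarith)).trans
    ((hbd δ h3 h2.le).trans ?_)
  rw [← ENNReal.ofReal_toReal hD, ← ENNReal.ofReal_add (by positivity) (by positivity)]
  refine ENNReal.ofReal_le_ofReal ?_
  rw [div_add' _ _ _ h3.ne']
  gcongr
  linarith

/-- Trigonometric polynomials on the real line. -/
noncomputable def trigPoly : Submodule ℂ (ℝ → ℂ) :=
  Submodule.span ℂ (range fun a : ℝ => fun y : ℝ => Complex.exp (((a * y : ℝ) : ℂ) * Complex.I))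

lemma exp_mem_trigPoly (a : ℝ) :
    (fun y : ℝ => Complex.exp (((a * y : ℝ) : ℂ) * Complex.I)) ∈ trigPoly :=
  Submodule.subset_span ⟨a, rfl⟩

lemma one_mem_trigPoly : (fun _ : ℝ => (1 : ℂ)) ∈ trigPoly := by
  simpa using exp_mem_trigPoly 0

lemma const_mem_trigPoly (c : ℂ) : (fun _ : ℝ => c) ∈ trigPoly := by
  simpa [Pi.smul_def] using trigPoly.smul_mem c one_mem_trigPoly

lemma continuous_of_mem_trigPoly {P : ℝ → ℂ} (hP : P ∈ trigPoly) : Continuous P := by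
  induction hP using Submodule.span_induction with
  | mem x h => obtain ⟨a, rfl⟩ := h; fun_prop
  | zero => exact continuous_const
  | add x y _ _ hx hy => exact hx.add hy
  | smul c x _ hx => exact hx.const_smul c

lemma exists_bound_of_mem_trigPoly {P : ℝ → ℂ} (hP : P ∈ trigPoly) :
    ∃ C : ℝ, 0 ≤ C ∧ ∀ y, ‖P y‖ ≤ C := by
  induction hP using Submodule.span_induction with
  | mem x h =>
    obtain ⟨a, rfl⟩ := h
    exact ⟨1, zero_le_one, fun y => (Complex.norm_exp_ofReal_mul_I _).le⟩
  | zero => exact ⟨0, le_rfl, fun y => by simp⟩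
  | add x y _ _ hx hy =>
    obtain ⟨C, hC, h1⟩ := hx
    obtain ⟨D, hD, h2⟩ := hy
    exact ⟨C + D, by positivity, fun t => (norm_add_le _ _).trans (add_le_add (h1 t) (h2 t))⟩
  | smul c x _ hx =>
    obtain ⟨C, hC, h1⟩ := hx
    refine ⟨‖c‖ * C, by positivity, fun t => ?_⟩
    rw [Pi.smul_apply, norm_smul]
    exact mul_le_mul_of_nonneg_left (h1 t) (norm_nonneg _)

lemma mul_mem_trigPoly {P Q : ℝ → ℂ} (hP : P ∈ trigPoly) (hQ : Q ∈ trigPoly) :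
    P * Q ∈ trigPoly := by
  induction hP, hQ using Submodule.span_induction₂ with
  | mem_mem x y hx hy =>
    obtain ⟨a, rfl⟩ := hx
    obtain ⟨b, rfl⟩ := hy
    refine (congrArg (· ∈ trigPoly) (funext fun y => ?_)).mp (exp_mem_trigPoly (a + b))
    simp only [Pi.mul_apply, ← Complex.exp_add]
    congr 1; push_cast; ring
  | zero_left y hy => rw [zero_mul]; exact trigPoly.zero_mem
  | zero_right x hx => rw [mul_zero]; exact trigPoly.zero_mem
  | add_left x y z _ _ _ h1 h2 => rw [add_mul]; exact trigPoly.add_mem h1 h2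
  | add_right x y z _ _ _ h1 h2 => rw [mul_add]; exact trigPoly.add_mem h1 h2
  | smul_left r x y _ _ h => rw [smul_mul_assoc]; exact trigPoly.smul_mem r h
  | smul_right r x y _ _ h => rw [mul_smul_comm]; exact trigPoly.smul_mem r h

lemma pow_mem_trigPoly {P : ℝ → ℂ} (hP : P ∈ trigPoly) (n : ℕ) : P ^ n ∈ trigPoly := by
  induction n with
  | zero => exact one_mem_trigPoly
  | succ n ih => rw [pow_succ]; exact mul_mem_trigPoly ih hP

lemma conj_mem_trigPoly {P : ℝ → ℂ} (hP : P ∈ trigPoly) :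
    (fun y => (starRingEnd ℂ) (P y)) ∈ trigPoly := by
  induction hP using Submodule.span_induction with
  | mem x h =>
    obtain ⟨a, rfl⟩ := h
    refine (congrArg (· ∈ trigPoly) (funext fun y => ?_)).mp (exp_mem_trigPoly (-a))
    rw [← Complex.exp_conj]
    congr 1
    simp
  | zero => exact (congrArg (· ∈ trigPoly) (funext fun y => by simp)).mp trigPoly.zero_mem
  | add x y _ _ hx hy => simpa [Pi.add_def] using trigPoly.add_mem hx hy
  | smul c x _ hx => simpa [Pi.smul_def] using trigPoly.smul_mem ((starRingEnd ℂ) c) hx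

lemma re_mem_trigPoly {P : ℝ → ℂ} (hP : P ∈ trigPoly) :
    (fun y => ((P y).re : ℂ)) ∈ trigPoly := by
  refine (congrArg (· ∈ trigPoly) (funext fun y => ?_)).mp
    (trigPoly.smul_mem (1 / 2 : ℂ) (trigPoly.add_mem hP (conj_mem_trigPoly hP)))
  simp only [Pi.smul_apply, Pi.add_apply, Complex.add_conj, smul_eq_mul]
  push_cast; ring

lemma exists_mean_of_mem_trigPoly {P : ℝ → ℂ} (hP : P ∈ trigPoly) :
    ∃ m : ℂ, Tendsto (fun Y : ℝ => (∫ y in (1 : ℝ)..Y, P y) / (Y : ℂ)) atTop (nhds m) := by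
  induction hP using Submodule.span_induction with
  | mem x h =>
    obtain ⟨a, rfl⟩ := h
    rcases eq_or_ne a 0 with rfl | ha
    · refine ⟨1, ?_⟩
      have h1 : Tendsto (fun Y : ℝ => (1 : ℂ) - ((Y⁻¹ : ℝ) : ℂ)) atTop (nhds (1 - ((0 : ℝ) : ℂ))) :=
        tendsto_const_nhds.sub (Complex.continuous_ofReal.continuousAt.tendsto.comp
          tendsto_inv_atTop_zero)
      simp only [Complex.ofReal_zero, sub_zero] at h1
      refine h1.congr' ?_
      filter_upwards [eventually_gt_atTop 0] with Y hY
      have : (Y : ℂ) ≠ 0 := by exact_mod_cast hY.ne'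
      simp only [zero_mul, Complex.ofReal_zero, Complex.exp_zero, intervalIntegral.integral_const,
        Complex.real_smul, mul_one]
      push_cast
      field_simp
    · refine ⟨0, ?_⟩
      have h1 : ∀ Y : ℝ, (∫ y in (1 : ℝ)..Y, Complex.exp (((a * y : ℝ) : ℂ) * Complex.I)) =
          (Complex.exp (a * Complex.I * Y) - Complex.exp (a * Complex.I * (1 : ℝ))) /
            (a * Complex.I) := fun Y => by
        rw [← integral_exp_mul_complex (by simpa using ha)]
        congr 1 with y
        congr 1; push_cast; ring
      refine squeeze_zero_norm' (a := fun Y : ℝ => (2 / |a|) / Y) ?_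
        (tendsto_const_nhds.div_atTop tendsto_id)
      filter_upwards [eventually_gt_atTop 0] with Y hY
      rw [h1, norm_div, norm_div, Complex.norm_real, Real.norm_eq_abs, abs_of_pos hY]
      gcongr ?_ / _
      rw [norm_mul, Complex.norm_I, mul_one, Complex.norm_real, Real.norm_eq_abs]
      gcongr
      refine (norm_sub_le _ _).trans ?_
      have : ∀ t : ℝ, ‖Complex.exp (a * Complex.I * t)‖ = 1 := fun t => by
        rw [show (a * Complex.I * t : ℂ) = ((a * t : ℝ) : ℂ) * Complex.I by push_cast; ring]
        exact Complex.norm_exp_ofReal_mul_I _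
      rw [this, this]; norm_num
  | zero => exact ⟨0, by simp⟩
  | add x y hx' hy' hx hy =>
    obtain ⟨m, h1⟩ := hx
    obtain ⟨n, h2⟩ := hy
    refine ⟨m + n, (h1.add h2).congr fun Y => ?_⟩
    have e : (∫ t in (1 : ℝ)..Y, (x + y) t) = (∫ t in (1 : ℝ)..Y, x t) + ∫ t in (1 : ℝ)..Y, y t :=
      intervalIntegral.integral_add ((continuous_of_mem_trigPoly hx').intervalIntegrable _ _)
        ((continuous_of_mem_trigPoly hy').intervalIntegrable _ _)
    rw [e, add_div]
  | smul c x _ hx =>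
    obtain ⟨m, h1⟩ := hx
    refine ⟨c * m, (h1.const_mul c).congr fun Y => ?_⟩
    have e : (∫ t in (1 : ℝ)..Y, (c • x) t) = c * ∫ t in (1 : ℝ)..Y, x t :=
      intervalIntegral.integral_const_mul c _
    rw [e, mul_div_assoc]

/-- The averaging operator `F ↦ ∫_0^∞ F(y + v) e^{-v/2} dv`. -/
noncomputable def expTail (F : ℝ → ℂ) (y : ℝ) : ℂ :=
  ∫ v in Ioi (0 : ℝ), F (y + v) * Complex.exp (-(1 / 2 : ℂ) * v)

lemma integrableOn_expTail_of_bounded {F : ℝ → ℂ} (hF : Measurable F) {C : ℝ}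
    (hC : ∀ y, ‖F y‖ ≤ C) (y : ℝ) :
    IntegrableOn (fun v : ℝ => F (y + v) * Complex.exp (-(1 / 2 : ℂ) * v)) (Ioi 0) := by
  have h1 : IntegrableOn (fun v : ℝ => C * Real.exp (-(1 / 2) * v)) (Ioi 0) :=
    (exp_neg_integrableOn_Ioi 0 (by norm_num)).const_mul C
  refine h1.mono' (Measurable.aestronglyMeasurable (by fun_prop)) (ae_of_all _ fun v => ?_)
  rw [norm_mul, norm_exp_neg_mul]
  norm_num
  exact mul_le_mul_of_nonneg_right (hC _) (Real.exp_nonneg _)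

lemma integrableOn_expTail_of_mem {P : ℝ → ℂ} (hP : P ∈ trigPoly) (y : ℝ) :
    IntegrableOn (fun v : ℝ => P (y + v) * Complex.exp (-(1 / 2 : ℂ) * v)) (Ioi 0) := by
  obtain ⟨C, -, hC⟩ := exists_bound_of_mem_trigPoly hP
  exact integrableOn_expTail_of_bounded (continuous_of_mem_trigPoly hP).measurable hC y

lemma expTail_mem_trigPoly {P : ℝ → ℂ} (hP : P ∈ trigPoly) : expTail P ∈ trigPoly := by
  induction hP using Submodule.span_induction with
  | mem x h =>
    obtain ⟨a, rfl⟩ := h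
    refine (congrArg (· ∈ trigPoly) (funext fun y => ?_)).mp
      (trigPoly.smul_mem (∫ v in Ioi (0 : ℝ), Complex.exp (((a * v : ℝ) : ℂ) * Complex.I) *
        Complex.exp (-(1 / 2 : ℂ) * v)) (exp_mem_trigPoly a))
    rw [expTail, Pi.smul_apply, smul_eq_mul, mul_comm, ← integral_const_mul]
    congr 1 with v
    rw [← mul_assoc, ← Complex.exp_add]
    congr 2
    push_cast; ring
  | zero => 
    have : expTail 0 = 0 := by ext y; simp [expTail]
    rw [this]; exact trigPoly.zero_mem
  | add x y hx' hy' hx hy =>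
    have : expTail (x + y) = expTail x + expTail y := by
      ext t
      simp only [expTail, Pi.add_apply, add_mul]
      exact integral_add (integrableOn_expTail_of_mem hx' t) (integrableOn_expTail_of_mem hy' t)
    rw [this]; exact trigPoly.add_mem hx hy
  | smul c x _ hx =>
    have : expTail (c • x) = c • expTail x := by
      ext t
      simp only [expTail, Pi.smul_apply, smul_eq_mul, mul_assoc]
      exact integral_const_mul _ _
    rw [this]; exact trigPoly.smul_mem c hx

/-- `f` has vanishing upper mean on `(1, ∞)`. -/
def MeanZero (f : ℝ → ENNReal) : Prop :=
  ∀ ε : ℝ, 0 < ε → ∀ᶠ Y in atTop, ∫⁻ y in Ioc 1 Y, f y ≤ ENNReal.ofReal (ε * Y)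

/-- `f` has bounded means on `(1, ∞)`. -/
def BoundedMean (f : ℝ → ENNReal) : Prop :=
  ∃ C : ℝ, 0 ≤ C ∧ ∀ Y : ℝ, 1 ≤ Y → ∫⁻ y in Ioc 1 Y, f y ≤ ENNReal.ofReal (C * Y)

/-- Besicovitch almost periodic functions of exponent one on the half line. -/
def IsB1 (F : ℝ → ℂ) : Prop :=
  ∀ ε : ℝ, 0 < ε → ∃ P ∈ trigPoly, ∀ᶠ Y in atTop,
    ∫⁻ y in Ioc 1 Y, ‖F y - P y‖ₑ ≤ ENNReal.ofReal (ε * Y)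

lemma MeanZero.mono {f g : ℝ → ENNReal} (hg : MeanZero g) (h : ∀ y, 1 < y → f y ≤ g y) :
    MeanZero f := by
  intro ε hε
  filter_upwards [hg ε hε] with Y hY
  exact (setLIntegral_mono' measurableSet_Ioc fun y hy => h y hy.1).trans hY

lemma MeanZero.add {f g : ℝ → ENNReal} (hf : MeanZero f) (hg : MeanZero g) (hfm : Measurable f) :
    MeanZero (fun y => f y + g y) := by
  intro ε hε
  filter_upwards [hf (ε / 2) (half_pos hε), hg (ε / 2) (half_pos hε), eventually_ge_atTop 0]
    with Y h1 h2 hY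
  rw [lintegral_add_left hfm]
  refine (add_le_add h1 h2).trans_eq ?_
  rw [← ENNReal.ofReal_add (by positivity) (by positivity)]
  ring_nf

lemma MeanZero.of_lintegral_ne_top {f : ℝ → ENNReal} (h : ∫⁻ y in Ioi (1 : ℝ), f y ≠ ⊤) :
    MeanZero f := by
  intro ε hε
  filter_upwards [eventually_ge_atTop ((∫⁻ y in Ioi (1 : ℝ), f y).toReal / ε)] with Y hY
  refine (lintegral_mono_set Ioc_subset_Ioi_self).trans ?_
  rw [← ENNReal.ofReal_toReal h]
  exact ENNReal.ofReal_le_ofReal (by rwa [div_le_iff₀ hε, mul_comm] at hY)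

lemma MeanZero.div {f : ℝ → ENNReal} (hf : BoundedMean f) :
    MeanZero (fun y => f y * ENNReal.ofReal (1 / y)) := by
  obtain ⟨C, hC, h⟩ := hf
  intro ε hε
  set A : ℝ := 2 * C / ε + 1 with hA
  have hA1 : 1 ≤ A := by rw [hA]; linarith [show 0 ≤ 2 * C / ε by positivity]
  have hA0 : 0 < A := by linarith
  have hCA : C / A ≤ ε / 2 := by
    rw [div_le_iff₀ hA0, hA]
    have : ε / 2 * (2 * C / ε + 1) = C + ε / 2 := by field_simp
    linarith
  filter_upwards [eventually_ge_atTop (2 * C * A / ε), eventually_ge_atTop A] with Y h1 h2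
  have hY : 1 ≤ Y := hA1.trans h2
  have e : Ioc (1 : ℝ) Y = Ioc 1 A ∪ Ioc A Y := (Ioc_union_Ioc_eq_Ioc hA1 h2).symm
  rw [e]
  refine (lintegral_union_le _ _ _).trans ?_
  have i1 : ∫⁻ y in Ioc 1 A, f y * ENNReal.ofReal (1 / y) ≤ ENNReal.ofReal (C * A) := by
    refine (setLIntegral_mono' measurableSet_Ioc fun y hy => ?_).trans (h A hA1)
    refine mul_le_of_le_one_right zero_le ?_
    rw [← ENNReal.ofReal_one]
    exact ENNReal.ofReal_le_ofReal (by rw [div_le_one (by linarith [hy.1])]; exact hy.1.le)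
  have i2 : ∫⁻ y in Ioc A Y, f y * ENNReal.ofReal (1 / y) ≤
      ENNReal.ofReal (1 / A) * ENNReal.ofReal (C * Y) := by
    refine le_trans ?_ (mul_le_mul_right (h Y hY) _)
    rw [← lintegral_const_mul' _ _ ENNReal.ofReal_ne_top]
    refine (setLIntegral_mono' measurableSet_Ioc fun y hy => ?_).trans
      (lintegral_mono_set (Ioc_subset_Ioc_left hA1))
    rw [mul_comm]
    exact mul_le_mul_left (ENNReal.ofReal_le_ofReal (one_div_le_one_div_of_le hA0 hy.1.le)) _
  refine (add_le_add i1 i2).trans ?_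
  rw [← ENNReal.ofReal_mul (by positivity), ← ENNReal.ofReal_add (by positivity) (by positivity)]
  refine ENNReal.ofReal_le_ofReal ?_
  rw [div_le_iff₀ hε] at h1
  have : 1 / A * (C * Y) = C / A * Y := by ring
  nlinarith

lemma IsB1.of_meanZero {F G : ℝ → ℂ} (hF : IsB1 F)
    (h : MeanZero (fun y => ‖G y - F y‖ₑ)) (hm : Measurable F) : IsB1 G := by
  intro ε hε
  obtain ⟨P, hP, hPF⟩ := hF (ε / 2) (half_pos hε)
  refine ⟨P, hP, ?_⟩
  filter_upwards [hPF, h (ε / 2) (half_pos hε), eventually_ge_atTop 0] with Y h1 h2 hY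
  have hPm := (continuous_of_mem_trigPoly hP).measurable
  calc ∫⁻ y in Ioc 1 Y, ‖G y - P y‖ₑ ≤ ∫⁻ y in Ioc 1 Y, (‖F y - P y‖ₑ + ‖G y - F y‖ₑ) := by
        refine lintegral_mono fun y => ?_
        have : G y - P y = (F y - P y) + (G y - F y) := by ring
        rw [this]; exact enorm_add_le _ _
    _ = (∫⁻ y in Ioc 1 Y, ‖F y - P y‖ₑ) + ∫⁻ y in Ioc 1 Y, ‖G y - F y‖ₑ :=
        lintegral_add_left (hm.sub hPm).enorm _
    _ ≤ ENNReal.ofReal (ε / 2 * Y) + ENNReal.ofReal (ε / 2 * Y) := add_le_add h1 h2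
    _ = ENNReal.ofReal (ε * Y) := by
        rw [← ENNReal.ofReal_add (by positivity) (by positivity)]; ring_nf

lemma IsB1.boundedMean {F : ℝ → ℂ} (hF : IsB1 F) (hm : Measurable F) :
    BoundedMean (fun y => ‖F y‖ₑ) := by
  obtain ⟨P, hP, hPF⟩ := hF 1 one_pos
  obtain ⟨C, hC0, hC⟩ := exists_bound_of_mem_trigPoly hP
  have hPm := (continuous_of_mem_trigPoly hP).measurable
  obtain ⟨Y0, hY0⟩ := (hPF.and (eventually_ge_atTop 1)).exists_forall_of_atTop
  have key : ∀ Y, Y0 ≤ Y → ∫⁻ y in Ioc 1 Y, ‖F y‖ₑ ≤ ENNReal.ofReal ((1 + C) * Y) := by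
    intro Y hY
    obtain ⟨h1, h2⟩ := hY0 Y hY
    calc ∫⁻ y in Ioc 1 Y, ‖F y‖ₑ ≤ ∫⁻ y in Ioc 1 Y, (‖F y - P y‖ₑ + ENNReal.ofReal C) := by
          refine lintegral_mono fun y => ?_
          calc ‖F y‖ₑ = ‖(F y - P y) + P y‖ₑ := by ring_nf
            _ ≤ ‖F y - P y‖ₑ + ‖P y‖ₑ := enorm_add_le _ _
            _ ≤ _ := by
              gcongr
              rw [← ofReal_norm]; exact ENNReal.ofReal_le_ofReal (hC y)
      _ = (∫⁻ y in Ioc 1 Y, ‖F y - P y‖ₑ) + ∫⁻ y in Ioc 1 Y, ENNReal.ofReal C :=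
          lintegral_add_left (hm.sub hPm).enorm _
      _ ≤ ENNReal.ofReal (1 * Y) + ENNReal.ofReal (C * Y) := by
          refine add_le_add h1 ?_
          rw [lintegral_const, Measure.restrict_apply_univ, Real.volume_Ioc,
            ← ENNReal.ofReal_mul hC0]
          exact ENNReal.ofReal_le_ofReal (by nlinarith)
      _ = _ := by rw [← ENNReal.ofReal_add (by linarith) (by nlinarith)]; ring_nf
  have h1 : 1 ≤ Y0 := (hY0 Y0 le_rfl).2
  refine ⟨(1 + C) * Y0, by positivity, fun Y hY => ?_⟩
  rcases le_total Y0 Y with h | h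
  · refine (key Y h).trans (ENNReal.ofReal_le_ofReal ?_)
    have : (1 + C) * Y * 1 ≤ (1 + C) * Y * Y0 := by gcongr
    linarith
  · refine (lintegral_mono_set (Ioc_subset_Ioc_right h)).trans
      ((key Y0 le_rfl).trans (ENNReal.ofReal_le_ofReal ?_))
    have : (1 + C) * Y0 * 1 ≤ (1 + C) * Y0 * Y := by gcongr
    linarith

lemma lintegral_tail_le {f w : ℝ → ENNReal} (hf : Measurable f) (hw : Measurable w) {C Y : ℝ}
    (hC : 0 ≤ C) (hY : 1 ≤ Y)
    (h : ∀ Z, Y ≤ Z → ∫⁻ y in Ioc 1 Z, f y ≤ ENNReal.ofReal (C * Z)) :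
    ∫⁻ y in Ioc 1 Y, (∫⁻ v in Ioi (0 : ℝ), f (y + v) * w v) ≤
      ENNReal.ofReal (C * Y) * ∫⁻ v in Ioi (0 : ℝ), ENNReal.ofReal (1 + v) * w v := by
  rw [lintegral_lintegral_swap (Measurable.aemeasurable (by fun_prop)),
    ← lintegral_const_mul' _ _ ENNReal.ofReal_ne_top]
  refine setLIntegral_mono' measurableSet_Ioi fun v hv => ?_
  have hv : 0 < v := hv
  rw [lintegral_mul_const _ (by fun_prop), ← mul_assoc]
  refine mul_le_mul_left ?_ _
  have e : ∫⁻ y in Ioc 1 Y, f (y + v) = ∫⁻ y in Ioc (1 + v) (Y + v), f y := by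
    have := (measurePreserving_add_right (volume : Measure ℝ) v).setLIntegral_comp_preimage
      (measurableSet_Ioc (a := 1 + v) (b := Y + v)) hf
    rw [← this]
    congr 2
    ext y; simp
  rw [e, ← ENNReal.ofReal_mul (by positivity)]
  refine (lintegral_mono_set (Ioc_subset_Ioc_left (by linarith))).trans
    ((h (Y + v) (by linarith)).trans (ENNReal.ofReal_le_ofReal ?_))
  nlinarith [mul_nonneg hC (mul_nonneg hv.le (by linarith : 0 ≤ Y - 1))]

/-- The weight `(1 + v) e^{-v/2}`. -/
noncomputable def tailWeight (v : ℝ) : ENNReal := ENNReal.ofReal ((1 + v) * Real.exp (-(v / 2)))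

lemma measurable_tailWeight : Measurable tailWeight := by
  unfold tailWeight; fun_prop

lemma exists_lintegral_tailWeight_le :
    ∃ W : ℝ, 0 < W ∧
      ∫⁻ v in Ioi (0 : ℝ), ENNReal.ofReal (1 + v) * tailWeight v ≤ ENNReal.ofReal W := by
  have h1 : IntegrableOn (fun v : ℝ => 64 * Real.exp (-(1 / 4) * v)) (Ioi 0) :=
    (exp_neg_integrableOn_Ioi 0 (by norm_num)).const_mul 64
  refine ⟨(∫ v in Ioi (0 : ℝ), 64 * Real.exp (-(1 / 4) * v)) + 1, ?_, ?_⟩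
  · have : 0 ≤ ∫ v in Ioi (0 : ℝ), 64 * Real.exp (-(1 / 4) * v) :=
      integral_nonneg fun v => by positivity
    linarith
  · refine le_trans ?_ (ENNReal.ofReal_le_ofReal (le_add_of_nonneg_right zero_le_one))
    rw [ofReal_integral_eq_lintegral_ofReal h1 (ae_of_all _ fun v => by positivity)]
    refine setLIntegral_mono' measurableSet_Ioi fun v hv => ?_
    have hv : 0 < v := hv
    rw [tailWeight, ← ENNReal.ofReal_mul (by positivity)]
    refine ENNReal.ofReal_le_ofReal ?_
    have h2 : 1 + v ≤ 8 * Real.exp (v / 8) := by linarith [Real.add_one_le_exp (v / 8)]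
    calc (1 + v) * ((1 + v) * Real.exp (-(v / 2)))
        ≤ (8 * Real.exp (v / 8)) * ((8 * Real.exp (v / 8)) * Real.exp (-(v / 2))) := by gcongr
      _ = 64 * (Real.exp (v / 8) * Real.exp (v / 8) * Real.exp (-(v / 2))) := by ring
      _ = 64 * Real.exp (-(1 / 4) * v) := by
        rw [← Real.exp_add, ← Real.exp_add]; ring_nf

lemma BoundedMean.tail {f : ℝ → ENNReal} (hf : BoundedMean f) (hm : Measurable f) :
    BoundedMean (fun y => ∫⁻ v in Ioi (0 : ℝ), f (y + v) * tailWeight v) := by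
  obtain ⟨C, hC, h⟩ := hf
  obtain ⟨W, hW, hW'⟩ := exists_lintegral_tailWeight_le
  refine ⟨C * W, by positivity, fun Y hY => ?_⟩
  refine (lintegral_tail_le hm measurable_tailWeight hC hY
    fun Z hZ => h Z (hY.trans hZ)).trans ((mul_le_mul_right hW' _).trans_eq ?_)
  rw [← ENNReal.ofReal_mul (by positivity)]
  ring_nf

lemma enorm_expTail_le (F : ℝ → ℂ) (y : ℝ) :
    ‖expTail F y‖ₑ ≤ ∫⁻ v in Ioi (0 : ℝ), ‖F (y + v)‖ₑ * tailWeight v := by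
  refine (enorm_integral_le_lintegral_enorm _).trans
    (setLIntegral_mono' measurableSet_Ioi fun v hv => ?_)
  have hv : 0 < v := hv
  rw [enorm_mul]
  refine mul_le_mul_right ?_ _
  rw [← ofReal_norm, norm_exp_neg_mul, tailWeight]
  refine ENNReal.ofReal_le_ofReal ?_
  have : Real.exp (-(1 / 2 : ℂ).re * v) = Real.exp (-(v / 2)) := by
    congr 1; norm_num; ring
  rw [this]
  exact le_mul_of_one_le_left (Real.exp_nonneg _) (by linarith)

/-- If `k` is almost periodic in mean, so is `k - expTail k`. -/
lemma IsB1.sub_expTail {k : ℝ → ℂ} (hk : IsB1 k) (hm : Measurable k)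
    (hi : ∀ y, 1 < y →
      IntegrableOn (fun v : ℝ => k (y + v) * Complex.exp (-(1 / 2 : ℂ) * v)) (Ioi 0)) :
    IsB1 (fun y => k y - expTail k y) := by
  intro ε hε
  obtain ⟨W, hW, hW'⟩ := exists_lintegral_tailWeight_le
  have hη : 0 < ε / (1 + W) := by positivity
  obtain ⟨P, hP, hPk⟩ := hk _ hη
  have hPm := (continuous_of_mem_trigPoly hP).measurable
  refine ⟨P - expTail P, trigPoly.sub_mem hP (expTail_mem_trigPoly hP), ?_⟩
  obtain ⟨Y0, hY0⟩ := hPk.exists_forall_of_atTop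
  have hfm : Measurable fun y => ‖k y - P y‖ₑ := (hm.sub hPm).enorm
  filter_upwards [eventually_ge_atTop Y0, eventually_ge_atTop 1] with Y h1 h2
  calc ∫⁻ y in Ioc 1 Y, ‖k y - expTail k y - (P - expTail P) y‖ₑ
      ≤ ∫⁻ y in Ioc 1 Y, (‖k y - P y‖ₑ +
          ∫⁻ v in Ioi (0 : ℝ), ‖k (y + v) - P (y + v)‖ₑ * tailWeight v) := by
        refine setLIntegral_mono' measurableSet_Ioc fun y hy => ?_
        have e : k y - expTail k y - (P - expTail P) y =
            (k y - P y) - expTail (fun y => k y - P y) y := by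
          have : expTail (fun y => k y - P y) y = expTail k y - expTail P y := by
            simp only [expTail, sub_mul]
            exact integral_sub (hi y hy.1) (integrableOn_expTail_of_mem hP y)
          rw [this]; simp only [Pi.sub_apply]; ring
        rw [e]
        exact enorm_sub_le.trans (add_le_add le_rfl (enorm_expTail_le _ y))
    _ = (∫⁻ y in Ioc 1 Y, ‖k y - P y‖ₑ) + ∫⁻ y in Ioc 1 Y,
          (∫⁻ v in Ioi (0 : ℝ), ‖k (y + v) - P (y + v)‖ₑ * tailWeight v) :=
        lintegral_add_left hfm _
    _ ≤ ENNReal.ofReal (ε / (1 + W) * Y) + ENNReal.ofReal (ε / (1 + W) * Y) * ENNReal.ofReal W :=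
        add_le_add (hY0 Y h1) ((lintegral_tail_le hfm measurable_tailWeight hη.le h2
          fun Z hZ => hY0 Z (h1.trans hZ)).trans (mul_le_mul_right hW' _))
    _ = ENNReal.ofReal (ε * Y) := by
        rw [← ENNReal.ofReal_mul (by positivity),
          ← ENNReal.ofReal_add (by positivity) (by positivity)]
        congr 1
        field_simp

/-- `e^{-y/2} (ψ(e^y) - e^y)`. -/
noncomputable def scaledPsi (y : ℝ) : ℂ := ((Real.exp (-(y / 2)) * psiError y : ℝ) : ℂ)

lemma measurable_scaledPsi : Measurable scaledPsi := by
  have := measurable_psiError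
  unfold scaledPsi; fun_prop

lemma scaled_zeroSum_mem_trigPoly (hRH : RiemannHypothesis) (N : ℕ) :
    (fun y : ℝ => (Real.exp (-(y / 2)) : ℂ) * zeroSum N y) ∈ trigPoly := by
  have h : (∑ ρ ∈ zeroSet N, (-(zetaOrder ρ : ℂ) / ρ) •
      fun y : ℝ => Complex.exp (((ρ.im * y : ℝ) : ℂ) * Complex.I)) ∈ trigPoly :=
    trigPoly.sum_mem fun ρ _ => trigPoly.smul_mem _ (exp_mem_trigPoly _)
  refine (congrArg (· ∈ trigPoly) (funext fun y => ?_)).mp h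
  rw [Finset.sum_apply, zeroSum, Finset.mul_sum]
  refine Finset.sum_congr rfl fun ρ hρ => ?_
  have e : Complex.exp (((ρ.im * y : ℝ) : ℂ) * Complex.I) =
      (Real.exp (-(y / 2)) : ℂ) * Complex.exp (ρ * y) := by
    rw [Complex.ofReal_exp, ← Complex.exp_add]
    congr 1
    have h2 : ρ = (1 / 2 : ℂ) + ρ.im * Complex.I := by
      conv_lhs => rw [← Complex.re_add_im ρ, re_of_mem_zeroSet hRH hρ]
      push_cast; ring
    conv_rhs => rw [h2]
    push_cast; ring
  simp only [Pi.smul_apply, smul_eq_mul]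
  rw [e]; ring

lemma isB1_scaledPsi (hRH : RiemannHypothesis) : IsB1 scaledPsi := by
  intro ε hε
  obtain ⟨N, hN⟩ := exists_zeroSum_approx hRH
    (ε := (ε / 2) ^ 2 * Real.exp (-2)) (by positivity)
  have hP := scaled_zeroSum_mem_trigPoly hRH N
  refine ⟨_, hP, ?_⟩
  have hPm := (continuous_of_mem_trigPoly hP).measurable
  have ht : Tendsto (fun Y : ℝ => 1 / Y) atTop (nhdsWithin 0 (Ioi 0)) := by
    simpa only [one_div] using tendsto_inv_atTop_nhdsGT_zero
  filter_upwards [ht.eventually hN, eventually_gt_atTop 0] with Y h1 hY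
  have key : ∫⁻ y in Ioc 1 Y, ‖scaledPsi y - (Real.exp (-(y / 2)) : ℂ) * zeroSum N y‖ₑ ^ 2 ≤
      ENNReal.ofReal ((ε / 2) ^ 2 * Y) := by
    have i1 : ∫⁻ y in Ioc 1 Y, ‖scaledPsi y - (Real.exp (-(y / 2)) : ℂ) * zeroSum N y‖ₑ ^ 2 ≤
        ENNReal.ofReal (Real.exp 2) * ∫⁻ y in Ioi (0 : ℝ), ‖(psiError y : ℂ) - zeroSum N y‖ₑ ^ 2 *
          ENNReal.ofReal (Real.exp (-(2 * (1 / 2 + 1 / Y)) * y)) := by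
      rw [← lintegral_const_mul' _ _ ENNReal.ofReal_ne_top]
      refine (setLIntegral_mono' measurableSet_Ioc fun y hy => ?_).trans
        (lintegral_mono_set fun y (hy : y ∈ Ioc 1 Y) => zero_lt_one.trans hy.1)
      have e : scaledPsi y - (Real.exp (-(y / 2)) : ℂ) * zeroSum N y =
          (Real.exp (-(y / 2)) : ℂ) * ((psiError y : ℂ) - zeroSum N y) := by
        rw [scaledPsi]; push_cast; ring
      rw [e, enorm_mul, mul_pow, mul_comm, mul_left_comm]
      refine mul_le_mul_right ?_ _
      rw [← ofReal_norm, ← ENNReal.ofReal_pow (norm_nonneg _), ← ENNReal.ofReal_mul (by positivity)]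
      refine ENNReal.ofReal_le_ofReal ?_
      rw [Complex.norm_of_nonneg (Real.exp_nonneg _), ← Real.exp_nat_mul, ← Real.exp_add]
      refine Real.exp_le_exp.mpr ?_
      have : y / Y ≤ 1 := (div_le_one hY).mpr hy.2
      have e2 : 2 + -(2 * (1 / 2 + 1 / Y)) * y = -y + 2 - 2 * (y / Y) := by ring
      rw [e2]; push_cast; linarith
    refine i1.trans ((mul_le_mul_right h1 _).trans_eq ?_)
    rw [← ENNReal.ofReal_mul (by positivity)]
    congr 1
    rw [Real.exp_neg]
    have := Real.exp_pos 2
    field_simp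
  calc ∫⁻ y in Ioc 1 Y, ‖scaledPsi y - (Real.exp (-(y / 2)) : ℂ) * zeroSum N y‖ₑ
      ≤ ∫⁻ y in Ioc 1 Y, (ENNReal.ofReal (ε / 2) +
          ENNReal.ofReal (2 / ε) * ‖scaledPsi y - (Real.exp (-(y / 2)) : ℂ) * zeroSum N y‖ₑ ^ 2) := by
        refine lintegral_mono fun y => ?_
        set z := scaledPsi y - (Real.exp (-(y / 2)) : ℂ) * zeroSum N y
        beta_reduce
        rw [← ofReal_norm, ← ENNReal.ofReal_pow (norm_nonneg _), ← ENNReal.ofReal_mul (by positivity),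
          ← ENNReal.ofReal_add (by positivity) (by positivity)]
        refine ENNReal.ofReal_le_ofReal ?_
        have h0 : 0 ≤ (‖z‖ - ε / 2) ^ 2 * (2 / ε) := by positivity
        have h3 : (‖z‖ - ε / 2) ^ 2 * (2 / ε) = ε / 2 + 2 / ε * ‖z‖ ^ 2 - 2 * ‖z‖ := by
          field_simp; ring
        linarith [norm_nonneg z]
    _ = (∫⁻ y in Ioc 1 Y, ENNReal.ofReal (ε / 2)) + ENNReal.ofReal (2 / ε) *
          ∫⁻ y in Ioc 1 Y, ‖scaledPsi y - (Real.exp (-(y / 2)) : ℂ) * zeroSum N y‖ₑ ^ 2 := by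
        rw [lintegral_add_left measurable_const, lintegral_const_mul' _ _ ENNReal.ofReal_ne_top]
    _ ≤ ENNReal.ofReal (ε / 2 * Y) + ENNReal.ofReal (2 / ε) * ENNReal.ofReal ((ε / 2) ^ 2 * Y) := by
        refine add_le_add ?_ (mul_le_mul_right key _)
        rw [lintegral_const, Measure.restrict_apply_univ, Real.volume_Ioc,
          ← ENNReal.ofReal_mul (by positivity)]
        exact ENNReal.ofReal_le_ofReal (by nlinarith)
    _ = ENNReal.ofReal (ε * Y) := by
        rw [← ENNReal.ofReal_mul (by positivity),
          ← ENNReal.ofReal_add (by positivity) (by positivity)]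
        congr 1
        field_simp; ring

lemma IsB1.add_mem {F Q : ℝ → ℂ} (hF : IsB1 F) (hQ : Q ∈ trigPoly) : IsB1 (F + Q) := by
  intro ε hε
  obtain ⟨P, hP, h⟩ := hF ε hε
  refine ⟨P + Q, trigPoly.add_mem hP hQ, ?_⟩
  simpa only [Pi.add_apply, add_sub_add_right_eq_sub] using h

/-- The error term `θ(e^y) - e^y`. -/
noncomputable def thetaError (y : ℝ) : ℝ := Chebyshev.theta (Real.exp y) - Real.exp y

lemma measurable_thetaError : Measurable thetaError :=
  (Chebyshev.theta_mono.measurable.comp Real.measurable_exp).sub Real.measurable_exp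

lemma abs_psiError_sub_thetaError_sub_le {y : ℝ} (hy : 0 ≤ y) :
    |psiError y - thetaError y - Real.exp (y / 2) - psiError (y / 2)| ≤
      2 * (Real.log 4 + 4) * Real.exp (y / 3) := by
  have h1 := Chebyshev.psi_sub_theta_le_psi_add_psi_add_psi (Real.exp y)
  have h2 := Chebyshev.psi_sub_theta_ge_psi_add_psi_add_psi (Real.exp_pos y).le
  simp only [← Real.exp_mul] at h1 h2
  have e : y * (2 : ℝ)⁻¹ = y / 2 := by ring
  rw [e] at h1 h2
  have h3 := Chebyshev.psi_le_const_mul_self (Real.exp_pos (y * (3 : ℝ)⁻¹)).le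
  have h5 := Chebyshev.psi_le_const_mul_self (Real.exp_pos (y * (5 : ℝ)⁻¹)).le
  have h7 := Chebyshev.psi_nonneg (Real.exp (y * (7 : ℝ)⁻¹))
  have h3' := Chebyshev.psi_nonneg (Real.exp (y * (3 : ℝ)⁻¹))
  have hle : Real.exp (y * (5 : ℝ)⁻¹) ≤ Real.exp (y * (3 : ℝ)⁻¹) :=
    Real.exp_le_exp.mpr (by linarith)
  have e3 : y / 3 = y * (3 : ℝ)⁻¹ := by ring
  have h4 : 0 < Real.log 4 := Real.log_pos (by norm_num)
  have hle' := mul_le_mul_of_nonneg_left hle (by linarith : 0 ≤ Real.log 4 + 4)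
  have hp := mul_pos (by linarith : 0 < Real.log 4 + 4) (Real.exp_pos (y * (3 : ℝ)⁻¹))
  rw [e3, abs_le]
  simp only [psiError, thetaError]
  constructor <;> linarith

lemma exists_abs_psiError_sub_thetaError_le :
    ∃ C, 0 ≤ C ∧ ∀ y, |psiError y - thetaError y| ≤ C * Real.exp (y / 2) := by
  obtain ⟨C, hC⟩ := Chebyshev.psi_sub_theta_le_mul_sqrt
  refine ⟨|C|, abs_nonneg C, fun y => ?_⟩
  have e : psiError y - thetaError y =
      Chebyshev.psi (Real.exp y) - Chebyshev.theta (Real.exp y) := by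
    simp only [psiError, thetaError]; ring
  rw [e, abs_of_nonneg (sub_nonneg.mpr (Chebyshev.theta_le_psi _)), Real.exp_half]
  exact (hC _).trans (mul_le_mul_of_nonneg_right (le_abs_self C) (Real.sqrt_nonneg _))

lemma integrableOn_abs_psiError (hRH : RiemannHypothesis) :
    IntegrableOn (fun y => |psiError y| * Real.exp (-y)) (Ioi 0) := by
  have := (laplaceConv_psiError hRH).integrableOn_norm (σ := 1) (by norm_num)
  simpa only [Complex.norm_real, Real.norm_eq_abs, neg_mul, one_mul] using this

lemma integrableOn_abs_thetaError (hRH : RiemannHypothesis) :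
    IntegrableOn (fun y => |thetaError y| * Real.exp (-y)) (Ioi 0) := by
  obtain ⟨C, hC0, hC⟩ := exists_abs_psiError_sub_thetaError_le
  have h1 : IntegrableOn (fun y : ℝ => C * Real.exp (-(1 / 2) * y)) (Ioi 0) :=
    (exp_neg_integrableOn_Ioi 0 (by norm_num)).const_mul C
  have hm := measurable_thetaError
  refine ((integrableOn_abs_psiError hRH).add h1).mono'
    (Measurable.aestronglyMeasurable (by fun_prop)) (ae_of_all _ fun y => ?_)
  rw [Real.norm_eq_abs, abs_mul, abs_abs, Real.abs_exp]
  have h2 : |thetaError y| ≤ |psiError y| + C * Real.exp (y / 2) := by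
    have := abs_sub_abs_le_abs_sub (thetaError y) (psiError y)
    rw [abs_sub_comm] at this
    linarith [hC y]
  have h3 := mul_le_mul_of_nonneg_right h2 (Real.exp_pos (-y)).le
  have e : Real.exp (-(1 / 2) * y) = Real.exp (y / 2) * Real.exp (-y) := by
    rw [← Real.exp_add]; ring_nf
  simp only [Pi.add_apply]
  rw [e]; linarith

/-- `e^{-y/2} (θ(e^y) - e^y)`. -/
noncomputable def scaledTheta (y : ℝ) : ℂ := ((Real.exp (-(y / 2)) * thetaError y : ℝ) : ℂ)

lemma measurable_scaledTheta : Measurable scaledTheta := by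
  have := measurable_thetaError
  unfold scaledTheta; fun_prop

lemma isB1_scaledTheta (hRH : RiemannHypothesis) : IsB1 scaledTheta := by
  have h0 : IsB1 (scaledPsi + fun _ => (-1 : ℂ)) :=
    (isB1_scaledPsi hRH).add_mem (const_mem_trigPoly _)
  refine h0.of_meanZero ?_ (measurable_scaledPsi.add measurable_const)
  set c : ℝ := 2 * (Real.log 4 + 4) with hc
  set R : ℝ → ℝ := fun y => |psiError (1 / 2 * y)| * Real.exp (-(1 / 2 * y)) +
    c * Real.exp (-(1 / 6) * y) with hR
  have hRi : IntegrableOn R (Ioi 0) := by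
    refine Integrable.add ?_ ((exp_neg_integrableOn_Ioi 0 (by norm_num)).const_mul c)
    have := (integrableOn_Ioi_comp_mul_left_iff (fun y => |psiError y| * Real.exp (-y)) 0
      (by norm_num : (0 : ℝ) < 1 / 2)).mpr (by simpa using integrableOn_abs_psiError hRH)
    exact this
  have hfin : ∫⁻ y in Ioi (1 : ℝ), ‖R y‖ₑ ≠ ⊤ :=
    ((lintegral_mono_set (Ioi_subset_Ioi zero_le_one)).trans_lt hRi.2).ne
  refine (MeanZero.of_lintegral_ne_top hfin).mono fun y hy => ?_
  have e : scaledTheta y - (scaledPsi y + -1) =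
      ((-(Real.exp (-(y / 2)) * (psiError y - thetaError y - Real.exp (y / 2))) : ℝ) : ℂ) := by
    simp only [scaledTheta, scaledPsi]
    have : Real.exp (-(y / 2)) * Real.exp (y / 2) = 1 := by rw [← Real.exp_add]; simp
    have e1 : -(Real.exp (-(y / 2)) * (psiError y - thetaError y - Real.exp (y / 2))) =
        Real.exp (-(y / 2)) * thetaError y - Real.exp (-(y / 2)) * psiError y +
          Real.exp (-(y / 2)) * Real.exp (y / 2) := by ring
    rw [e1, this]; push_cast; ring
  rw [Pi.add_apply, e, ← ofReal_norm, ← ofReal_norm, Complex.norm_real, norm_neg]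
  refine ENNReal.ofReal_le_ofReal (le_trans ?_ (le_abs_self _))
  have h1 := abs_psiError_sub_thetaError_sub_le (by linarith : 0 ≤ y)
  have h2 : |psiError y - thetaError y - Real.exp (y / 2)| ≤
      |psiError (y / 2)| + c * Real.exp (y / 3) := by
    have := abs_sub_abs_le_abs_sub (psiError y - thetaError y - Real.exp (y / 2)) (psiError (y / 2))
    linarith
  rw [norm_mul, Real.norm_eq_abs, Real.norm_eq_abs, Real.abs_exp]
  have h3 := mul_le_mul_of_nonneg_left h2 (Real.exp_pos (-(y / 2))).le
  have e3 : Real.exp (-(1 / 6) * y) = Real.exp (-(y / 2)) * Real.exp (y / 3) := by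
    rw [← Real.exp_add]; ring_nf
  have e4 : 1 / 2 * y = y / 2 := by ring
  rw [hR]
  beta_reduce
  rw [e3, e4]
  linarith

lemma setIntegral_Ioi_eq_add_left {E : Type*} [NormedAddCommGroup E] [NormedSpace ℝ E]
    (g : ℝ → E) (y : ℝ) : ∫ w in Ioi y, g w = ∫ v in Ioi 0, g (y + v) := by
  have := (measurePreserving_add_left (volume : Measure ℝ) y).setIntegral_preimage_emb
    (measurableEmbedding_addLeft y) g (Ioi y)
  have e : (fun x => y + x) ⁻¹' Ioi y = Ioi (0 : ℝ) := by ext; simp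
  rw [e] at this
  exact this.symm

lemma integrableOn_Ioi_comp_add_left {E : Type*} [NormedAddCommGroup E]
    {g : ℝ → E} {y : ℝ} (h : IntegrableOn g (Ioi y)) :
    IntegrableOn (fun v => g (y + v)) (Ioi 0) := by
  have := (measurePreserving_add_left (volume : Measure ℝ) y).integrableOn_comp_preimage
    (measurableEmbedding_addLeft y) (f := g) (s := Ioi y)
  have e : (fun x => y + x) ⁻¹' Ioi y = Ioi (0 : ℝ) := by ext; simp
  rw [e] at this
  exact this.mpr h

lemma integrableOn_scaledTheta_tail (hRH : RiemannHypothesis) {y : ℝ} (hy : 0 ≤ y) :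
    IntegrableOn (fun v : ℝ => scaledTheta (y + v) * Complex.exp (-(1 / 2 : ℂ) * v)) (Ioi 0) := by
  have h1 := (integrableOn_abs_thetaError hRH).mono_set (Ioi_subset_Ioi hy)
  have h2 : IntegrableOn (fun v => |thetaError (y + v)| * Real.exp (-(y + v))) (Ioi 0) :=
    integrableOn_Ioi_comp_add_left h1
  have hm := measurable_scaledTheta
  refine (h2.const_mul (Real.exp (y / 2))).mono'
    (Measurable.aestronglyMeasurable (by fun_prop)) (ae_of_all _ fun v => le_of_eq ?_)
  rw [norm_mul, norm_exp_neg_mul, scaledTheta, Complex.norm_real, norm_mul, Real.norm_eq_abs,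
    Real.norm_eq_abs, Real.abs_exp]
  have e : Real.exp (-((y + v) / 2)) * Real.exp (-(1 / 2 : ℂ).re * v) =
      Real.exp (y / 2) * Real.exp (-(y + v)) := by
    rw [← Real.exp_add, ← Real.exp_add]
    congr 1; norm_num; ring
  linear_combination |thetaError (y + v)| * e

lemma isB1_scaledTheta_sub_expTail (hRH : RiemannHypothesis) :
    IsB1 (fun y => scaledTheta y - expTail scaledTheta y) :=
  (isB1_scaledTheta hRH).sub_expTail measurable_scaledTheta
    fun _ hy => integrableOn_scaledTheta_tail hRH (by linarith)

lemma hasDerivAt_inv_mul_log {t : ℝ} (ht : 1 < t) :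
    HasDerivAt (fun t : ℝ => (t * Real.log t)⁻¹)
      (-((Real.log t + 1) / (t * Real.log t) ^ 2)) t := by
  have hl := Real.log_pos ht
  have h0 : t ≠ 0 := by linarith
  exact ((Real.hasDerivAt_mul_log h0).inv (by positivity)).congr_deriv (neg_div _ _)

lemma sum_inv_prime_eq_theta (b : ℝ) :
    ∑ p ∈ Finset.filter Nat.Prime (Finset.Icc 0 ⌊b⌋₊), (1 : ℝ) / p =
      Chebyshev.theta b / (b * Real.log b) +
        ∫ t in Ioc 2 b, (Real.log t + 1) / (t * Real.log t) ^ 2 * Chebyshev.theta t := by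
  set c : ℕ → ℝ := fun n => if n.Prime then Real.log n else 0 with hc
  have hθ : ∀ t : ℝ, ∑ k ∈ Finset.Icc 0 ⌊t⌋₊, c k = Chebyshev.theta t := by
    intro t
    rw [Chebyshev.theta_eq_sum_Icc, Finset.sum_filter]
  have hcont : ContinuousOn (fun t : ℝ => -((Real.log t + 1) / (t * Real.log t) ^ 2)) (Icc 2 b) := by
    intro t ht
    have h2 : (2 : ℝ) ≤ t := ht.1
    have hl := Real.log_pos (by linarith : 1 < t)
    have h0 : t ≠ 0 := by linarith
    have h3 : (t * Real.log t) ^ 2 ≠ 0 := by positivity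
    exact ContinuousAt.continuousWithinAt (by fun_prop (disch := assumption))
  have hd : ∀ t ∈ Icc 2 b, deriv (fun t : ℝ => (t * Real.log t)⁻¹) t =
      -((Real.log t + 1) / (t * Real.log t) ^ 2) := fun t ht =>
    (hasDerivAt_inv_mul_log (by linarith [ht.1])).deriv
  have key := sum_mul_eq_sub_integral_mul₁ c (f := fun t : ℝ => (t * Real.log t)⁻¹)
    (by simp [hc]) (by simp [hc]) b
    (fun t ht => (hasDerivAt_inv_mul_log (by linarith [ht.1])).differentiableAt)
    ((hcont.congr fun t ht => hd t ht).integrableOn_Icc)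
  simp only [hθ] at key
  rw [Finset.sum_filter]
  have e1 : ∑ p ∈ Finset.Icc 0 ⌊b⌋₊, (if p.Prime then (1 : ℝ) / p else 0) =
      ∑ k ∈ Finset.Icc 0 ⌊b⌋₊, ((k : ℝ) * Real.log k)⁻¹ * c k := by
    refine Finset.sum_congr rfl fun p _ => ?_
    by_cases hp : p.Prime
    · have h2 : (2 : ℝ) ≤ p := by exact_mod_cast hp.two_le
      have hl := Real.log_pos (by linarith : (1 : ℝ) < p)
      simp only [hc, hp, if_true]
      field_simp
    · simp [hc, hp]
  rw [e1, key, sub_eq_add_neg, ← integral_neg, div_eq_mul_inv, mul_comm (Chebyshev.theta b)]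
  congr 1
  refine setIntegral_congr_fun measurableSet_Ioc fun t ht => ?_
  rw [hd t ⟨ht.1.le, ht.2⟩]
  ring

lemma setIntegral_Ioc_eq_log (g : ℝ → ℝ) {a y : ℝ} (ha : 0 < a) :
    ∫ t in Ioc a (Real.exp y), g t = ∫ w in Ioc (Real.log a) y, Real.exp w * g (Real.exp w) := by
  have himg : Real.exp '' Ioc (Real.log a) y = Ioc a (Real.exp y) := by
    ext t
    constructor
    · rintro ⟨w, hw, rfl⟩
      exact ⟨(Real.log_lt_iff_lt_exp ha).mp hw.1, Real.exp_le_exp.mpr hw.2⟩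
    · intro ht
      have h0 : 0 < t := ha.trans ht.1
      exact ⟨Real.log t, ⟨Real.log_lt_log ha ht.1, (Real.log_le_iff_le_exp h0).mpr ht.2⟩,
        Real.exp_log h0⟩
  rw [← himg, integral_image_eq_integral_abs_deriv_smul measurableSet_Ioc
    (fun x _ => (Real.hasDerivAt_exp x).hasDerivWithinAt) Real.exp_injective.injOn]
  simp only [Real.abs_exp, smul_eq_mul]

lemma integrableOn_tail_thetaError (hRH : RiemannHypothesis) {a : ℝ} (ha : 0 < a) :
    IntegrableOn (fun w => (w + 1) / w ^ 2 * (Real.exp (-w) * thetaError w)) (Ioi a) := by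
  have h1 := ((integrableOn_abs_thetaError hRH).mono_set (Ioi_subset_Ioi ha.le)).const_mul
    ((a + 1) / a ^ 2)
  have hm := measurable_thetaError
  refine h1.mono' (Measurable.aestronglyMeasurable (by fun_prop))
    ((ae_restrict_iff' measurableSet_Ioi).mpr (ae_of_all _ fun w hw => ?_))
  have hw : a < w := hw
  have hw0 : 0 < w := ha.trans hw
  rw [norm_mul, norm_mul, Real.norm_eq_abs, Real.norm_eq_abs, Real.norm_eq_abs, Real.abs_exp,
    mul_comm (Real.exp (-w)), abs_of_pos (by positivity)]
  refine mul_le_mul_of_nonneg_right ?_ (by positivity)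
  have e : ∀ u : ℝ, 0 < u → (u + 1) / u ^ 2 = 1 / u + 1 / u ^ 2 := fun u hu => by field_simp
  rw [e w hw0, e a ha]
  gcongr

lemma sum_inv_prime_exp (hRH : RiemannHypothesis) :
    ∃ C : ℝ, ∀ y : ℝ, Real.log 2 ≤ y →
      ∑ p ∈ Finset.filter Nat.Prime (Finset.Icc 0 ⌊Real.exp y⌋₊), (1 : ℝ) / p =
        Real.log y + C + Real.exp (-y) * thetaError y / y -
          ∫ w in Ioi y, (w + 1) / w ^ 2 * (Real.exp (-w) * thetaError w) := by
  set G : ℝ → ℝ := fun w => (w + 1) / w ^ 2 * (Real.exp (-w) * thetaError w) with hG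
  have hl2 : 0 < Real.log 2 := Real.log_pos one_lt_two
  refine ⟨1 / Real.log 2 - Real.log (Real.log 2) + ∫ w in Ioi (Real.log 2), G w, fun y hy => ?_⟩
  have hy0 : 0 < y := hl2.trans_le hy
  rw [sum_inv_prime_eq_theta, setIntegral_Ioc_eq_log _ two_pos, Real.log_exp]
  have hc : ∀ w ∈ uIcc (Real.log 2) y, w ≠ 0 := by
    intro w hw
    rw [uIcc_of_le hy] at hw
    exact (hl2.trans_le hw.1).ne'
  have hcont : ContinuousOn (fun w : ℝ => (w + 1) / w ^ 2) (uIcc (Real.log 2) y) := fun w hw =>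
    ContinuousAt.continuousWithinAt
      (by have := pow_ne_zero 2 (hc w hw); fun_prop (disch := assumption))
  have hGi := integrableOn_tail_thetaError hRH hl2
  have e1 : ∫ w in Ioc (Real.log 2) y, Real.exp w * ((Real.log (Real.exp w) + 1) /
      (Real.exp w * Real.log (Real.exp w)) ^ 2 * Chebyshev.theta (Real.exp w)) =
      (∫ w in Ioc (Real.log 2) y, (w + 1) / w ^ 2) + ∫ w in Ioc (Real.log 2) y, G w := by
    rw [← integral_add]
    · refine setIntegral_congr_fun measurableSet_Ioc fun w hw => ?_
      have hw0 : 0 < w := hl2.trans hw.1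
      simp only [hG, thetaError, Real.log_exp, Real.exp_neg]
      field_simp
      ring
    · exact (uIcc_of_le hy ▸ hcont).integrableOn_Icc.mono_set Ioc_subset_Icc_self
    · exact hGi.mono_set Ioc_subset_Ioi_self
  have e2 : ∫ w in Ioc (Real.log 2) y, (w + 1) / w ^ 2 =
      (Real.log y - 1 / y) - (Real.log (Real.log 2) - 1 / Real.log 2) := by
    rw [← intervalIntegral.integral_of_le hy]
    refine intervalIntegral.integral_eq_sub_of_hasDerivAt (f := fun w => Real.log w - 1 / w)
      (fun w hw => ?_) hcont.intervalIntegrable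
    have := hc w hw
    have h := (Real.hasDerivAt_log this).sub (hasDerivAt_inv this)
    simp only [one_div]
    refine h.congr_deriv ?_
    field_simp
    ring
  have e3 : ∫ w in Ioi (Real.log 2), G w = (∫ w in Ioc (Real.log 2) y, G w) + ∫ w in Ioi y, G w := by
    rw [← Ioc_union_Ioi_eq_Ioi hy]
    exact setIntegral_union (Ioc_disjoint_Ioi le_rfl) measurableSet_Ioi
      (hGi.mono_set Ioc_subset_Ioi_self) (hGi.mono_set (Ioi_subset_Ioi hy))
  have e4 : Chebyshev.theta (Real.exp y) / (Real.exp y * y) =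
      1 / y + Real.exp (-y) * thetaError y / y := by
    simp only [thetaError, Real.exp_neg]
    field_simp
    ring
  rw [e1, e2, e3, e4]
  ring

/-- The excess `-log (1 - 1/p) - 1/p` at primes, extended by zero. -/
noncomputable def primeExcess (n : ℕ) : ℝ :=
  if n.Prime then -Real.log (1 - 1 / n) - 1 / n else 0

lemma neg_log_one_sub_bounds {u : ℝ} (h1 : u ≤ 1 / 2) :
    0 ≤ -Real.log (1 - u) - u ∧ -Real.log (1 - u) - u ≤ 2 * u ^ 2 := by
  have hp : 0 < 1 - u := by linarith
  constructor
  · linarith [Real.log_le_sub_one_of_pos hp]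
  · have h := Real.one_sub_inv_le_log_of_pos hp
    have e : (1 - u)⁻¹ - 1 - u = u ^ 2 / (1 - u) := by field_simp; ring
    have h2 : u ^ 2 / (1 - u) ≤ 2 * u ^ 2 := by
      rw [div_le_iff₀ hp]; nlinarith [sq_nonneg u]
    linarith

lemma one_div_prime_le {p : ℕ} (hp : p.Prime) : (1 : ℝ) / p ≤ 1 / 2 :=
  one_div_le_one_div_of_le two_pos (by exact_mod_cast hp.two_le)

lemma primeExcess_nonneg (n : ℕ) : 0 ≤ primeExcess n := by
  rw [primeExcess]
  split_ifs with h
  · exact (neg_log_one_sub_bounds (one_div_prime_le h)).1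
  · exact le_rfl

lemma primeExcess_le (n : ℕ) : primeExcess n ≤ 2 * (1 / (n : ℝ) ^ 2) := by
  rw [primeExcess]
  split_ifs with h
  · refine (neg_log_one_sub_bounds (one_div_prime_le h)).2.trans_eq ?_
    rw [one_div_pow]
  · positivity

lemma summable_primeExcess : Summable primeExcess :=
  Summable.of_nonneg_of_le primeExcess_nonneg primeExcess_le
    ((Real.summable_one_div_nat_pow.mpr one_lt_two).mul_left 2)

lemma log_mertensProd (x : ℝ) :
    Real.log (mertensProd x) =
      ∑ p ∈ Finset.filter Nat.Prime (Finset.Icc 0 ⌊x⌋₊), -Real.log (1 - 1 / (p : ℝ)) := by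
  have e : Finset.Iic ⌊x⌋₊ = Finset.Icc 0 ⌊x⌋₊ := by ext; simp
  rw [mertensProd, e, Real.log_prod]
  · exact Finset.sum_congr rfl fun p _ => Real.log_inv _
  · intro p hp
    have := one_div_prime_le (Finset.mem_filter.mp hp).2
    exact inv_ne_zero (by linarith)

lemma exists_abs_log_mertensProd_sub_le :
    ∃ β K : ℝ, 0 ≤ K ∧ ∀ y : ℝ, |Real.log (mertensProd (Real.exp y)) -
      ∑ p ∈ Finset.filter Nat.Prime (Finset.Icc 0 ⌊Real.exp y⌋₊), (1 : ℝ) / p - β| ≤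
        K * Real.exp (-(3 / 4) * y) := by
  have hS : Summable fun n : ℕ => (n : ℝ) ^ (-(5 / 4) : ℝ) :=
    Real.summable_nat_rpow.mpr (by norm_num)
  refine ⟨∑' n, primeExcess n, 2 * ∑' n : ℕ, (n : ℝ) ^ (-(5 / 4) : ℝ),
    mul_nonneg zero_le_two (tsum_nonneg fun n => by positivity), fun y => ?_⟩
  set m := ⌊Real.exp y⌋₊ with hm
  have e1 : Real.log (mertensProd (Real.exp y)) -
      ∑ p ∈ Finset.filter Nat.Prime (Finset.Icc 0 m), (1 : ℝ) / p =
      ∑ n ∈ Finset.range (m + 1), primeExcess n := by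
    rw [log_mertensProd, ← Finset.sum_sub_distrib, Finset.sum_filter,
      Nat.range_succ_eq_Icc_zero]
    rfl
  rw [e1, ← summable_primeExcess.sum_add_tsum_nat_add (m + 1), sub_add_cancel_left, abs_neg,
    abs_of_nonneg (tsum_nonneg fun n => primeExcess_nonneg _)]
  have hle : ∀ n : ℕ, primeExcess (n + (m + 1)) ≤
      2 * Real.exp (-(3 / 4) * y) * ((n + (m + 1) : ℕ) : ℝ) ^ (-(5 / 4) : ℝ) := by
    intro n
    have hx : Real.exp y ≤ ((n + (m + 1) : ℕ) : ℝ) := by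
      have := (Nat.lt_floor_add_one (Real.exp y)).le
      push_cast
      rw [← hm] at this
      linarith [Nat.cast_nonneg (α := ℝ) n]
    set N : ℝ := ((n + (m + 1) : ℕ) : ℝ) with hN
    have hN0 : 0 < N := (Real.exp_pos y).trans_le hx
    refine (primeExcess_le _).trans ?_
    rw [mul_assoc]
    refine mul_le_mul_of_nonneg_left ?_ zero_le_two
    have e2 : 1 / N ^ 2 = N ^ (-(3 / 4) : ℝ) * N ^ (-(5 / 4) : ℝ) := by
      rw [← Real.rpow_add hN0, one_div, ← Real.rpow_natCast, ← Real.rpow_neg hN0.le]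
      norm_num
    rw [e2]
    refine mul_le_mul_of_nonneg_right ?_ (by positivity)
    refine (Real.rpow_le_rpow_of_nonpos (Real.exp_pos y) hx (by norm_num)).trans_eq ?_
    rw [← Real.exp_mul]; ring_nf
  have hS' := (summable_nat_add_iff (m + 1)).mpr hS
  calc ∑' n, primeExcess (n + (m + 1))
      ≤ ∑' n : ℕ, 2 * Real.exp (-(3 / 4) * y) * ((n + (m + 1) : ℕ) : ℝ) ^ (-(5 / 4) : ℝ) :=
        ((summable_nat_add_iff (m + 1)).mpr summable_primeExcess).tsum_le_tsum hle
          (hS'.mul_left _)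
    _ = 2 * Real.exp (-(3 / 4) * y) * ∑' n : ℕ, ((n + (m + 1) : ℕ) : ℝ) ^ (-(5 / 4) : ℝ) :=
        tsum_mul_left
    _ ≤ 2 * Real.exp (-(3 / 4) * y) * ∑' n : ℕ, (n : ℝ) ^ (-(5 / 4) : ℝ) := by
        refine mul_le_mul_of_nonneg_left ?_ (by positivity)
        rw [← hS.sum_add_tsum_nat_add (m + 1)]
        exact le_add_of_nonneg_left (Finset.sum_nonneg fun n _ => by positivity)
    _ = _ := by ring

/-- Mertens' product formula with an unspecified constant. -/
lemma exists_mertens_formula (hRH : RiemannHypothesis) :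
    ∃ C K : ℝ, 0 ≤ K ∧ ∀ y : ℝ, Real.log 2 ≤ y →
      |Real.log (mertensProd (Real.exp y)) - Real.log y - C - Real.exp (-y) * thetaError y / y +
        ∫ w in Ioi y, (w + 1) / w ^ 2 * (Real.exp (-w) * thetaError w)| ≤
          K * Real.exp (-(3 / 4) * y) := by
  obtain ⟨β, K, hK, h⟩ := exists_abs_log_mertensProd_sub_le
  obtain ⟨C, hC⟩ := sum_inv_prime_exp hRH
  refine ⟨C + β, K, hK, fun y hy => ?_⟩
  have := h y
  rw [hC y hy] at this
  refine (congrArg abs ?_).trans_le this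
  ring

lemma tendsto_log_mertensProd_sub {C K : ℝ}
    (h : ∀ y : ℝ, Real.log 2 ≤ y →
      |Real.log (mertensProd (Real.exp y)) - Real.log y - C - Real.exp (-y) * thetaError y / y +
        ∫ w in Ioi y, (w + 1) / w ^ 2 * (Real.exp (-w) * thetaError w)| ≤
          K * Real.exp (-(3 / 4) * y)) :
    Tendsto (fun y => Real.log (mertensProd (Real.exp y)) - Real.log y) atTop (nhds C) := by
  have t1 : Tendsto (fun y : ℝ => K * Real.exp (-(3 / 4) * y)) atTop (nhds 0) := by
    rw [← mul_zero K]
    refine Tendsto.const_mul K (Real.tendsto_exp_atBot.comp ?_)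
    exact tendsto_id.const_mul_atTop_of_neg (by norm_num)
  have t2 : Tendsto (fun y : ℝ => Real.exp (-y) * thetaError y / y) atTop (nhds 0) := by
    obtain ⟨B, hB0, hB⟩ := exists_abs_psiError_sub_thetaError_le
    have h0 : Tendsto (fun y : ℝ => (Real.log 4 + 5 + B) / y) atTop (nhds 0) :=
      tendsto_const_nhds.div_atTop tendsto_id
    refine squeeze_zero_norm' ?_ h0
    filter_upwards [eventually_gt_atTop 0] with y hy
    rw [Real.norm_eq_abs, abs_div, abs_mul, Real.abs_exp, abs_of_pos hy]
    refine div_le_div_of_nonneg_right ?_ hy.le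
    have h1 : |thetaError y| ≤ (Real.log 4 + 5 + B) * Real.exp y := by
      have h2 := abs_psiError_le y
      have h3 := abs_sub_abs_le_abs_sub (thetaError y) (psiError y)
      rw [abs_sub_comm] at h3
      have h4 := mul_le_mul_of_nonneg_left (Real.exp_le_exp.mpr (by linarith : y / 2 ≤ y)) hB0
      linarith [hB y]
    refine (mul_le_mul_of_nonneg_left h1 (Real.exp_pos _).le).trans_eq ?_
    rw [Real.exp_neg]
    field_simp
  have t3 : Tendsto (fun y : ℝ => ∫ w in Ioi y, (w + 1) / w ^ 2 * (Real.exp (-w) * thetaError w))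
      atTop (nhds 0) :=
    tendsto_integral_Ioi_zero tendsto_id
  have t4 := squeeze_zero_norm' (a := fun y : ℝ => K * Real.exp (-(3 / 4) * y))
    (f := fun y => Real.log (mertensProd (Real.exp y)) - Real.log y - C -
      Real.exp (-y) * thetaError y / y +
        ∫ w in Ioi y, (w + 1) / w ^ 2 * (Real.exp (-w) * thetaError w))
    ((eventually_ge_atTop (Real.log 2)).mono fun y hy => h y hy) t1
  have t5 := ((t4.add t2).sub t3).add_const C
  simp only [add_zero, sub_zero, zero_add] at t5
  exact t5.congr fun y => by ring

lemma summable_rpow_neg_one_add {ε : ℝ} (hε : 0 < ε) :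
    Summable fun n : ℕ => (n : ℝ) ^ (-(1 + ε)) :=
  Real.summable_nat_rpow.mpr (by linarith)

lemma prime_rpow_neg_le {p : ℕ} (hp : p.Prime) {s : ℝ} (hs : 1 ≤ s) :
    (p : ℝ) ^ (-s) ≤ 1 / 2 := by
  have h2 : (2 : ℝ) ≤ p := by exact_mod_cast hp.two_le
  refine (Real.rpow_le_rpow_of_exponent_le (by linarith : (1 : ℝ) ≤ p)
    (neg_le_neg hs)).trans ?_
  rw [Real.rpow_neg_one, ← one_div]
  exact one_div_prime_le hp

/-- The coefficients of the logarithm of the zeta function, summed over powers of each prime. -/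
noncomputable def zetaLogTerm (s : ℝ) (n : ℕ) : ℝ :=
  if n.Prime then -Real.log (1 - (n : ℝ) ^ (-s)) else 0

lemma log_re_riemannZeta {s : ℝ} (hs : 1 < s) :
    Real.log (riemannZeta s).re = ∑' n : ℕ, zetaLogTerm s n := by
  have h := riemannZeta_eulerProduct_exp_log (s := (s : ℂ)) (by simpa using hs)
  have e : ∀ p : Nat.Primes, -Complex.log (1 - (p : ℂ) ^ (-(s : ℂ))) =
      ((-Real.log (1 - ((p : ℕ) : ℝ) ^ (-s)) : ℝ) : ℂ) := by
    intro p
    have h1 := prime_rpow_neg_le p.2 hs.le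
    rw [Complex.ofReal_neg, Complex.ofReal_log (by linarith), Complex.ofReal_sub,
      Complex.ofReal_cpow (by positivity)]
    simp
  simp only [e] at h
  rw [← Complex.ofReal_tsum, ← Complex.ofReal_exp] at h
  rw [← h, Complex.ofReal_re, Real.log_exp]
  have h2 := tsum_subtype {n : ℕ | n.Prime} (fun n : ℕ => -Real.log (1 - (n : ℝ) ^ (-s)))
  refine Eq.trans h2 (tsum_congr fun n => ?_)
  by_cases hn : n.Prime
  · rw [Set.indicator_of_mem (by exact hn), zetaLogTerm, if_pos hn]
  · rw [Set.indicator_of_notMem (by exact hn), zetaLogTerm, if_neg hn]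

lemma zetaLogTerm_bounds {s : ℝ} (hs : 1 ≤ s) (n : ℕ) :
    0 ≤ zetaLogTerm s n ∧ zetaLogTerm s n ≤ 2 * (n : ℝ) ^ (-s) := by
  rw [zetaLogTerm]
  split_ifs with hp
  · have hu := prime_rpow_neg_le hp hs
    have h0 : 0 ≤ (n : ℝ) ^ (-s) := by positivity
    obtain ⟨h1, h2⟩ := neg_log_one_sub_bounds hu
    exact ⟨by linarith, by nlinarith⟩
  · exact ⟨le_rfl, by positivity⟩

lemma summable_zetaLogTerm {s : ℝ} (hs : 1 < s) : Summable (zetaLogTerm s) := by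
  refine Summable.of_nonneg_of_le (fun n => (zetaLogTerm_bounds hs.le n).1)
    (fun n => (zetaLogTerm_bounds hs.le n).2) (Summable.mul_left 2 ?_)
  exact Real.summable_nat_rpow.mpr (by linarith)

lemma summable_zetaLogTerm_mul {ε : ℝ} (hε : 0 < ε) :
    Summable fun n : ℕ => zetaLogTerm 1 n * (n : ℝ) ^ (-ε) := by
  refine Summable.of_nonneg_of_le
    (fun n => mul_nonneg (zetaLogTerm_bounds le_rfl n).1 (by positivity)) (fun n => ?_)
    ((summable_rpow_neg_one_add hε).mul_left 2)
  rcases Nat.eq_zero_or_pos n with rfl | hn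
  · simp [zetaLogTerm, Real.zero_rpow_nonneg]
  have hn' : (0 : ℝ) < n := by exact_mod_cast hn
  rw [neg_add, Real.rpow_add hn', ← mul_assoc]
  exact mul_le_mul_of_nonneg_right (zetaLogTerm_bounds le_rfl n).2 (by positivity)

lemma tendsto_tsum_zetaLogTerm_sub :
    Tendsto (fun ε : ℝ => ∑' n : ℕ, (zetaLogTerm (1 + ε) n - zetaLogTerm 1 n * (n : ℝ) ^ (-ε)))
      (nhdsWithin 0 (Ioi 0)) (nhds 0) := by
  have hb : Summable fun n : ℕ => 2 * (1 / (n : ℝ) ^ 2) :=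
    (Real.summable_one_div_nat_pow.mpr one_lt_two).mul_left 2
  have h := tendsto_tsum_of_dominated_convergence (𝓕 := nhdsWithin (0 : ℝ) (Ioi 0))
    (f := fun (ε : ℝ) (n : ℕ) => zetaLogTerm (1 + ε) n - zetaLogTerm 1 n * (n : ℝ) ^ (-ε))
    (g := fun _ => (0 : ℝ)) hb ?_ ?_
  · simpa using h
  · intro n
    by_cases hp : n.Prime
    · have hn : (n : ℝ) ≠ 0 := by exact_mod_cast hp.ne_zero
      have h1 := prime_rpow_neg_le hp (le_refl (1 : ℝ))
      have hc : ContinuousAt (fun ε : ℝ => zetaLogTerm (1 + ε) n -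
          zetaLogTerm 1 n * (n : ℝ) ^ (-ε)) 0 := by
        simp only [zetaLogTerm, hp, if_true]
        have h2 : ContinuousAt (fun ε : ℝ => (n : ℝ) ^ (-ε)) 0 :=
          (Real.continuousAt_const_rpow hn).comp (by fun_prop)
        have h3 : ContinuousAt (fun ε : ℝ => (n : ℝ) ^ (-(1 + ε))) 0 :=
          (Real.continuousAt_const_rpow hn).comp (by fun_prop)
        refine ContinuousAt.sub (ContinuousAt.neg (ContinuousAt.log (by fun_prop) ?_))
          (h2.const_mul _)
        rw [add_zero]
        linarith
      have := hc.tendsto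
      simp only [add_zero, neg_zero, Real.rpow_zero, mul_one, sub_self] at this
      exact this.mono_left nhdsWithin_le_nhds
    · simp [zetaLogTerm, hp]
  · filter_upwards [self_mem_nhdsWithin] with ε hε n
    have hε : 0 < ε := hε
    by_cases hp : n.Prime
    · have hn : (0 : ℝ) < n := by exact_mod_cast hp.pos
      have hn1 : (1 : ℝ) ≤ n := by exact_mod_cast hp.one_le
      simp only [zetaLogTerm, hp, if_true]
      set u : ℝ := (n : ℝ) ^ (-(1 : ℝ)) with hu
      set r : ℝ := (n : ℝ) ^ (-ε) with hr
      have hr0 : 0 ≤ r := by positivity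
      have hr1 : r ≤ 1 := Real.rpow_le_one_of_one_le_of_nonpos hn1 (by linarith)
      have hu0 : 0 ≤ u := by positivity
      have hur : (n : ℝ) ^ (-(1 + ε)) = u * r := by rw [neg_add, Real.rpow_add hn]
      have hu2 : 1 / (n : ℝ) ^ 2 = u ^ 2 := by
        rw [hu, Real.rpow_neg_one, inv_pow, one_div]
      have hu1 : u ≤ 1 / 2 := prime_rpow_neg_le hp le_rfl
      have hur1 : u * r ≤ u := mul_le_of_le_one_right hu0 hr1
      rw [hur, hu2]
      obtain ⟨a1, a2⟩ := neg_log_one_sub_bounds hu1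
      obtain ⟨b1, b2⟩ := neg_log_one_sub_bounds (hur1.trans hu1)
      have c1 : (u * r) ^ 2 ≤ u ^ 2 := by gcongr
      have c2 : (-Real.log (1 - u) - u) * r ≤ 2 * u ^ 2 := (mul_le_of_le_one_right a1 hr1).trans a2
      have c3 := mul_nonneg a1 hr0
      rw [Real.norm_eq_abs, abs_le]
      constructor <;> linarith
    · simp only [zetaLogTerm, hp, if_false, zero_mul, sub_zero, norm_zero]
      positivity

lemma sum_zetaLogTerm_one (x : ℝ) :
    ∑ k ∈ Finset.Icc 1 ⌊x⌋₊, zetaLogTerm 1 k = Real.log (mertensProd x) := by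
  rw [log_mertensProd, Finset.sum_filter, ← Finset.add_sum_Ioc_eq_sum_Icc (Nat.zero_le _)]
  simp only [Nat.not_prime_zero, if_false, zero_add]
  refine Finset.sum_congr (by ext; simp [Nat.succ_le_iff]) fun k _ => ?_
  rw [zetaLogTerm, Real.rpow_neg_one, one_div]

lemma measurable_log_mertensProd : Measurable fun x => Real.log (mertensProd x) := by
  have : Measurable fun n : ℕ => ∑ k ∈ Finset.Icc 1 n, zetaLogTerm 1 k := measurable_from_nat
  simp only [← sum_zetaLogTerm_one]
  exact this.comp Nat.measurable_floor

lemma tsum_zetaLogTerm_mul_eq {C : ℝ} (hC : Tendsto (fun y =>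
    Real.log (mertensProd (Real.exp y)) - Real.log y) atTop (nhds C)) {ε : ℝ} (hε : 0 < ε) :
    ∑' n : ℕ, zetaLogTerm 1 n * (n : ℝ) ^ (-ε) =
      ε * ∫ y in Ioi (0 : ℝ), Real.log (mertensProd (Real.exp y)) * Real.exp (-(ε * y)) := by
  have hO : (fun n : ℕ => ∑ k ∈ Finset.Icc 1 n, zetaLogTerm 1 k) =O[atTop]
      fun n : ℕ => (n : ℝ) ^ (ε / 2) := by
    have h1 : (fun x : ℝ => Real.log (mertensProd x)) =O[atTop] Real.log := by
      have h2 := hC.isBigO_one ℝ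
      have h3 : (fun y : ℝ => Real.log (mertensProd (Real.exp y))) =O[atTop] fun y => y := by
        have h4 : (fun _ : ℝ => (1 : ℝ)) =O[atTop] fun y : ℝ => y :=
          (Asymptotics.isLittleO_const_id_atTop 1).isBigO
        have := (h2.trans h4).add Real.isLittleO_log_id_atTop.isBigO
        exact this.congr_left fun y => by ring
      refine (h3.comp_tendsto Real.tendsto_log_atTop).congr' ?_ (EventuallyEq.refl _ _)
      filter_upwards [eventually_gt_atTop 0] with x hx
      simp only [Function.comp_apply]
      rw [Real.exp_log hx]
    have h5 := (h1.trans (isLittleO_log_rpow_atTop (half_pos hε)).isBigO).comp_tendsto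
      tendsto_natCast_atTop_atTop
    refine h5.congr_left fun n => ?_
    simp only [Function.comp_apply]
    rw [← sum_zetaLogTerm_one, Nat.floor_natCast]
  have key := LSeries_eq_mul_laplace (zetaLogTerm 1) (fun n => (zetaLogTerm_bounds le_rfl n).1)
    (half_pos hε).le hO (s := (ε : ℂ)) (by simpa using half_lt_self hε)
  simp only [sum_zetaLogTerm_one] at key
  have e1 : LSeries (fun n => (zetaLogTerm 1 n : ℂ)) ε =
      ((∑' n : ℕ, zetaLogTerm 1 n * (n : ℝ) ^ (-ε) : ℝ) : ℂ) := by
    rw [LSeries, Complex.ofReal_tsum]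
    refine tsum_congr fun n => ?_
    rcases Nat.eq_zero_or_pos n with rfl | hn
    · simp [zetaLogTerm]
    · rw [LSeries.term_of_ne_zero hn.ne', Complex.ofReal_mul, Complex.ofReal_cpow (by positivity),
        div_eq_mul_inv, Complex.ofReal_neg, Complex.cpow_neg]
      simp
  have e2 : laplace (fun y => (Real.log (mertensProd (Real.exp y)) : ℂ)) ε =
      ((∫ y in Ioi (0 : ℝ), Real.log (mertensProd (Real.exp y)) * Real.exp (-(ε * y)) : ℝ) : ℂ) := by
    rw [laplace, ← integral_complex_ofReal]
    refine integral_congr_ae (ae_of_all _ fun y => ?_)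
    simp
  rw [e1, e2] at key
  exact_mod_cast key

lemma integral_log_mul_exp_neg :
    ∫ u in Ioi (0 : ℝ), Real.log u * Real.exp (-u) = -Real.eulerMascheroniConstant := by
  have h1 := Complex.hasDerivAt_GammaIntegral (s := 1) (by simp)
  have h2 : HasDerivAt Complex.GammaIntegral (-(Real.eulerMascheroniConstant : ℂ)) 1 := by
    refine Complex.hasDerivAt_Gamma_one.congr_of_eventuallyEq ?_
    filter_upwards [(isOpen_halfPlane 0).mem_nhds (by simp : (1 : ℂ) ∈ {s : ℂ | 0 < s.re})] with s hs
    exact (Complex.Gamma_eq_integral hs).symm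
  have h3 := h1.unique h2
  simp only [sub_self, Complex.cpow_zero, one_mul] at h3
  have h4 : ((∫ u in Ioi (0 : ℝ), Real.log u * Real.exp (-u) : ℝ) : ℂ) =
      -(Real.eulerMascheroniConstant : ℂ) := by
    rw [← h3, ← integral_complex_ofReal]
    simp
  exact_mod_cast h4

lemma integrableOn_log_mul_exp_neg :
    IntegrableOn (fun u : ℝ => Real.log u * Real.exp (-u)) (Ioi 0) := by
  by_contra h
  have h1 := integral_undef h
  rw [integral_log_mul_exp_neg] at h1
  linarith [Real.one_half_lt_eulerMascheroniConstant]

lemma log_mertensProd_nonneg (x : ℝ) : 0 ≤ Real.log (mertensProd x) := by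
  rw [← sum_zetaLogTerm_one]
  exact Finset.sum_nonneg fun k _ => (zetaLogTerm_bounds le_rfl k).1

lemma log_mertensProd_mono {x y : ℝ} (h : x ≤ y) :
    Real.log (mertensProd x) ≤ Real.log (mertensProd y) := by
  simp only [← sum_zetaLogTerm_one]
  exact Finset.sum_le_sum_of_subset_of_nonneg
    (Finset.Icc_subset_Icc_right (Nat.floor_mono h))
    fun k _ _ => (zetaLogTerm_bounds le_rfl k).1

lemma exists_abs_log_mertensProd_sub_log_le {C : ℝ} (hC : Tendsto (fun y =>
    Real.log (mertensProd (Real.exp y)) - Real.log y) atTop (nhds C)) :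
    ∃ B : ℝ, 0 ≤ B ∧ ∀ y : ℝ, 0 < y → |Real.log (mertensProd (Real.exp y)) - Real.log y| ≤
      B + max 0 (-Real.log y) := by
  obtain ⟨A, hA⟩ := (hC.abs.eventually_lt_const (lt_add_one |C|)).exists_forall_of_atTop
  set M := Real.log (mertensProd (Real.exp A)) with hM
  have hM0 : 0 ≤ M := log_mertensProd_nonneg _
  refine ⟨|C| + 1 + M + |Real.log (max A 1)|, by positivity, fun y hy => ?_⟩
  have hmax := le_max_left 0 (-Real.log y)
  have hmax' := le_max_right 0 (-Real.log y)
  have hl := abs_nonneg (Real.log (max A 1))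
  have hC0 := abs_nonneg C
  rcases le_or_gt A y with h | h
  · linarith [hA y h]
  · have h1 : Real.log (mertensProd (Real.exp y)) ≤ M :=
      log_mertensProd_mono (Real.exp_le_exp.mpr h.le)
    have h2 := log_mertensProd_nonneg (Real.exp y)
    have h3 : Real.log y ≤ |Real.log (max A 1)| :=
      (Real.log_le_log hy (h.le.trans (le_max_left _ _))).trans (le_abs_self _)
    rw [abs_le]
    constructor <;> linarith

lemma mertens_constant {C : ℝ} (hC : Tendsto (fun y =>
    Real.log (mertensProd (Real.exp y)) - Real.log y) atTop (nhds C)) :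
    C = Real.eulerMascheroniConstant := by
  obtain ⟨B, hB0, hB⟩ := exists_abs_log_mertensProd_sub_log_le hC
  set D : ℝ → ℝ := fun y => Real.log (mertensProd (Real.exp y)) - Real.log y with hD
  have hDm : Measurable D :=
    (measurable_log_mertensProd.comp Real.measurable_exp).sub Real.measurable_log
  have hexp : IntegrableOn (fun u : ℝ => Real.exp (-u)) (Ioi 0) := by
    simpa using exp_neg_integrableOn_Ioi 0 one_pos
  have hbound : IntegrableOn (fun u : ℝ => B * Real.exp (-u) + ‖Real.log u * Real.exp (-u)‖)
      (Ioi 0) := (hexp.const_mul B).add integrableOn_log_mul_exp_neg.norm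
  have hdom : ∀ ε : ℝ, 0 < ε → ε ≤ 1 → ∀ u ∈ Ioi (0 : ℝ), ‖D (u / ε) * Real.exp (-u)‖ ≤
      B * Real.exp (-u) + ‖Real.log u * Real.exp (-u)‖ := by
    intro ε hε hε1 u hu
    have hu : 0 < u := hu
    rw [norm_mul, norm_mul, Real.norm_of_nonneg (Real.exp_nonneg _), ← add_mul]
    refine mul_le_mul_of_nonneg_right ((hB _ (by positivity)).trans (add_le_add le_rfl ?_))
      (Real.exp_nonneg _)
    refine max_le (abs_nonneg _) ((neg_le_neg (Real.log_le_log hu ?_)).trans (neg_le_abs _))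
    rw [le_div_iff₀ hε]
    nlinarith
  have hint : ∀ ε : ℝ, 0 < ε → ε ≤ 1 →
      IntegrableOn (fun u => D (u / ε) * Real.exp (-u)) (Ioi 0) := fun ε hε hε1 =>
    hbound.mono' (Measurable.aestronglyMeasurable (by fun_prop))
      ((ae_restrict_iff' measurableSet_Ioi).mpr (ae_of_all _ (hdom ε hε hε1)))
  have hmem : ∀ᶠ ε : ℝ in nhdsWithin 0 (Ioi 0), 0 < ε ∧ ε ≤ 1 := by
    filter_upwards [Ioc_mem_nhdsGT one_pos] with ε hε using hε
  have hlim : Tendsto (fun ε : ℝ => ∫ u in Ioi (0 : ℝ), D (u / ε) * Real.exp (-u))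
      (nhdsWithin 0 (Ioi 0)) (nhds C) := by
    have e : C = ∫ u in Ioi (0 : ℝ), C * Real.exp (-u) := by
      rw [integral_const_mul, integral_exp_neg_Ioi_zero, mul_one]
    rw [e]
    refine tendsto_integral_filter_of_dominated_convergence _
      (Eventually.of_forall fun ε => Measurable.aestronglyMeasurable (by fun_prop)) ?_ hbound
      ((ae_restrict_iff' measurableSet_Ioi).mpr (ae_of_all _ fun u hu => ?_))
    · filter_upwards [hmem] with ε hε
      exact (ae_restrict_iff' measurableSet_Ioi).mpr (ae_of_all _ (hdom ε hε.1 hε.2))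
    · refine Tendsto.mul_const _ (hC.comp ?_)
      have hu : 0 < u := hu
      exact (tendsto_inv_nhdsGT_zero.const_mul_atTop hu).congr fun ε => (div_eq_mul_inv u ε).symm
  have hscale : ∀ ε : ℝ, 0 < ε → ε ≤ 1 →
      ε * (∫ y in Ioi (0 : ℝ), Real.log (mertensProd (Real.exp y)) * Real.exp (-(ε * y))) =
        (∫ u in Ioi (0 : ℝ), D (u / ε) * Real.exp (-u)) - Real.eulerMascheroniConstant -
          Real.log ε := by
    intro ε hε hε1
    have h1 := integral_comp_mul_left_Ioi
      (fun u => Real.log (mertensProd (Real.exp (u / ε))) * Real.exp (-u)) 0 hε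
    simp only [mul_div_cancel_left₀ _ hε.ne', mul_zero, smul_eq_mul] at h1
    rw [h1, mul_inv_cancel_left₀ hε.ne']
    have h2 : ∀ u ∈ Ioi (0 : ℝ), Real.log (mertensProd (Real.exp (u / ε))) * Real.exp (-u) =
        (D (u / ε) * Real.exp (-u) + Real.log u * Real.exp (-u)) +
          -Real.log ε * Real.exp (-u) := by
      intro u hu
      have hu : 0 < u := hu
      simp only [hD]
      rw [Real.log_div hu.ne' hε.ne']
      ring
    have hsum : IntegrableOn (fun u => D (u / ε) * Real.exp (-u) + Real.log u * Real.exp (-u))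
        (Ioi 0) := (hint ε hε hε1).add integrableOn_log_mul_exp_neg
    rw [setIntegral_congr_fun measurableSet_Ioi h2, integral_add hsum (hexp.const_mul _),
      integral_add (hint ε hε hε1) integrableOn_log_mul_exp_neg, integral_log_mul_exp_neg,
      integral_const_mul, integral_exp_neg_Ioi_zero]
    ring
  have ht : Tendsto (fun ε : ℝ => 1 + ε) (nhdsWithin 0 (Ioi 0)) (nhdsWithin 1 (Ioi 1)) := by
    refine tendsto_nhdsWithin_iff.mpr ⟨?_, ?_⟩
    · have : ContinuousAt (fun ε : ℝ => 1 + ε) 0 := by fun_prop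
      have := this.tendsto
      rw [add_zero] at this
      exact this.mono_left nhdsWithin_le_nhds
    · filter_upwards [self_mem_nhdsWithin] with ε hε
      have hε : 0 < ε := hε
      exact lt_add_of_pos_right 1 hε
  have hz := (Asymptotics.isLittleO_one_iff ℝ).mp log_riemannZeta_add_log_sub_isLittleO_ofReal
  have hz' := hz.comp ht
  have hfin := (hz'.sub tendsto_tsum_zetaLogTerm_sub).sub hlim
  have hconst : Tendsto (fun _ : ℝ => -Real.eulerMascheroniConstant) (nhdsWithin 0 (Ioi 0))
      (nhds (0 - 0 - C)) := by
    refine hfin.congr' ?_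
    filter_upwards [hmem] with ε hε
    simp only [Function.comp_apply, add_sub_cancel_left]
    rw [log_re_riemannZeta (by linarith),
      (summable_zetaLogTerm (by linarith)).tsum_sub (summable_zetaLogTerm_mul hε.1),
      tsum_zetaLogTerm_mul_eq hC hε.1, hscale ε hε.1 hε.2]
    ring
  have := tendsto_nhds_unique hconst tendsto_const_nhds
  linarith

lemma enorm_mul_tail_sub_expTail_le (hRH : RiemannHypothesis) {y : ℝ} (hy : 1 ≤ y) :
    ‖((y * Real.exp (y / 2) * ∫ w in Ioi y, (w + 1) / w ^ 2 * (Real.exp (-w) * thetaError w) : ℝ) :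
        ℂ) - expTail scaledTheta y‖ₑ ≤
      (∫⁻ v in Ioi (0 : ℝ), ‖scaledTheta (y + v)‖ₑ * tailWeight v) * ENNReal.ofReal (1 / y) := by
  have hy0 : 0 < y := by linarith
  have hpt : ∀ v : ℝ, ((y * Real.exp (y / 2) *
      ((y + v + 1) / (y + v) ^ 2 * (Real.exp (-(y + v)) * thetaError (y + v))) : ℝ) : ℂ) =
      ((y * (y + v + 1) / (y + v) ^ 2 : ℝ) : ℂ) *
        (scaledTheta (y + v) * Complex.exp (-(1 / 2 : ℂ) * v)) := by
    intro v
    have e : Complex.exp (-(1 / 2 : ℂ) * v) = ((Real.exp (-(v / 2)) : ℝ) : ℂ) := by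
      rw [Complex.ofReal_exp]; congr 1; push_cast; ring
    rw [scaledTheta, e, ← Complex.ofReal_mul, ← Complex.ofReal_mul]
    congr 1
    have e2 : Real.exp (y / 2) * Real.exp (-(y + v)) =
        Real.exp (-((y + v) / 2)) * Real.exp (-(v / 2)) := by
      rw [← Real.exp_add, ← Real.exp_add]; congr 1; ring
    linear_combination y * ((y + v + 1) / (y + v) ^ 2) * thetaError (y + v) * e2
  have h1 : ((y * Real.exp (y / 2) *
      ∫ w in Ioi y, (w + 1) / w ^ 2 * (Real.exp (-w) * thetaError w) : ℝ) : ℂ) =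
      ∫ v in Ioi (0 : ℝ), ((y * (y + v + 1) / (y + v) ^ 2 : ℝ) : ℂ) *
        (scaledTheta (y + v) * Complex.exp (-(1 / 2 : ℂ) * v)) := by
    rw [setIntegral_Ioi_eq_add_left, ← integral_const_mul, ← integral_complex_ofReal]
    exact integral_congr_ae (ae_of_all _ hpt)
  have hi2 : IntegrableOn (fun v : ℝ => ((y * (y + v + 1) / (y + v) ^ 2 : ℝ) : ℂ) *
      (scaledTheta (y + v) * Complex.exp (-(1 / 2 : ℂ) * v))) (Ioi 0) :=
    ((integrableOn_Ioi_comp_add_left (integrableOn_tail_thetaError hRH hy0)).const_mul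
      (y * Real.exp (y / 2))).ofReal (𝕜 := ℂ) |>.congr (ae_of_all _ hpt)
  have hi := integrableOn_scaledTheta_tail hRH hy0.le
  rw [h1, expTail, ← integral_sub hi2 hi]
  have hm := measurable_scaledTheta
  refine (enorm_integral_le_lintegral_enorm _).trans ?_
  have hmt := measurable_tailWeight
  have hmv : Measurable fun v => ‖scaledTheta (y + v)‖ₑ * tailWeight v := by fun_prop
  rw [← lintegral_mul_const _ hmv]
  refine setLIntegral_mono' measurableSet_Ioi fun v hv => ?_
  have hv : 0 < v := hv
  rw [← sub_one_mul, enorm_mul, enorm_mul, mul_left_comm, mul_assoc]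
  refine mul_le_mul_right ?_ _
  have e : ((y * (y + v + 1) / (y + v) ^ 2 : ℝ) : ℂ) - 1 =
      ((y * (y + v + 1) / (y + v) ^ 2 - 1 : ℝ) : ℂ) := by push_cast; ring
  rw [e, ← ofReal_norm, ← ofReal_norm, norm_exp_neg_mul, Complex.norm_real, Real.norm_eq_abs,
    tailWeight, ← ENNReal.ofReal_mul (abs_nonneg _), ← ENNReal.ofReal_mul (by positivity)]
  refine ENNReal.ofReal_le_ofReal ?_
  have e3 : Real.exp (-(1 / 2 : ℂ).re * v) = Real.exp (-(v / 2)) := by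
    congr 1; norm_num; ring
  rw [e3, mul_right_comm]
  refine mul_le_mul_of_nonneg_right ?_ (Real.exp_nonneg _)
  have h4 : y * (y + v + 1) / (y + v) ^ 2 - 1 = (y - (y + v) * v) / (y + v) ^ 2 := by
    field_simp; ring
  rw [h4, abs_div, abs_of_pos (by positivity : 0 < (y + v) ^ 2), mul_one_div,
    div_le_div_iff₀ (by positivity) hy0]
  have h5 : |y - (y + v) * v| ≤ y + (y + v) * v := by
    rw [abs_le]; constructor <;> nlinarith [mul_pos (add_pos hy0 hv) hv]
  nlinarith [mul_pos hy0 hv, mul_pos (mul_pos hv hv) hv, mul_pos (mul_pos hy0 hv) hv,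
    mul_pos (mul_pos hy0 hv) hy0, mul_le_mul_of_nonneg_right h5 hy0.le]

lemma measurable_expTail {F : ℝ → ℂ} (hF : Measurable F) : Measurable (expTail F) := by
  have : StronglyMeasurable (Function.uncurry fun y v : ℝ =>
      F (y + v) * Complex.exp (-(1 / 2 : ℂ) * v)) := by
    apply Measurable.stronglyMeasurable
    unfold Function.uncurry
    fun_prop
  exact this.integral_prod_right.measurable

lemma measurable_EM : Measurable EM := by
  unfold EM
  exact (Real.continuous_sqrt.measurable.mul Real.measurable_log).mul
    ((measurable_log_mertensProd.sub (Real.measurable_log.comp Real.measurable_log)).sub_const _)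

lemma isB1_EM_exp (hRH : RiemannHypothesis) : IsB1 (fun y => (EM (Real.exp y) : ℂ)) := by
  obtain ⟨C, K, hK, h⟩ := exists_mertens_formula hRH
  obtain rfl := mertens_constant (tendsto_log_mertensProd_sub h)
  have hm := measurable_scaledTheta
  refine (isB1_scaledTheta_sub_expTail hRH).of_meanZero ?_ (hm.sub (measurable_expTail hm))
  have hz1 := MeanZero.div (((isB1_scaledTheta hRH).boundedMean hm).tail hm.enorm)
  have hz2 : MeanZero (fun y => ENNReal.ofReal (K * (y * Real.exp (-(1 / 4) * y)))) := by
    refine MeanZero.of_lintegral_ne_top ?_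
    have hi : IntegrableOn (fun y : ℝ => y * Real.exp (-(1 / 4) * y)) (Ioi 1) := by
      have := integrableOn_rpow_mul_exp_neg_mul_rpow (s := 1) (p := 1) (b := 1 / 4)
        (by norm_num) one_pos (by norm_num)
      simp only [Real.rpow_one] at this
      exact this.mono_set (Ioi_subset_Ioi zero_le_one)
    exact (hi.const_mul K).lintegral_lt_top.ne
  refine (hz2.add hz1 (by fun_prop)).mono fun y hy => ?_
  have hy0 : 0 < y := by linarith
  set J := ∫ w in Ioi y, (w + 1) / w ^ 2 * (Real.exp (-w) * thetaError w) with hJ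
  set R := Real.log (mertensProd (Real.exp y)) - Real.log y - Real.eulerMascheroniConstant -
    Real.exp (-y) * thetaError y / y + J with hR
  have hRb : |R| ≤ K * Real.exp (-(3 / 4) * y) :=
    h y ((Real.log_two_lt_d9.trans (by norm_num)).le.trans hy.le)
  have hEM : EM (Real.exp y) = y * Real.exp (y / 2) * R + Real.exp (-(y / 2)) * thetaError y -
      y * Real.exp (y / 2) * J := by
    have e1 : √(Real.exp y) = Real.exp (y / 2) := (Real.exp_half y).symm
    have e2 : Real.exp (-(y / 2)) = Real.exp (y / 2) * Real.exp (-y) := by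
      rw [← Real.exp_add]; congr 1; ring
    rw [EM, e1, Real.log_exp, e2, hR]
    field_simp
    ring
  have e : (EM (Real.exp y) : ℂ) - (scaledTheta y - expTail scaledTheta y) =
      ((y * Real.exp (y / 2) * R : ℝ) : ℂ) -
        (((y * Real.exp (y / 2) * J : ℝ) : ℂ) - expTail scaledTheta y) := by
    rw [hEM, scaledTheta]; push_cast; ring
  rw [e]
  refine (enorm_sub_le).trans (add_le_add ?_ (enorm_mul_tail_sub_expTail_le hRH hy.le))
  rw [← ofReal_norm, Complex.norm_real, Real.norm_eq_abs, abs_mul,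
    abs_of_pos (by positivity : 0 < y * Real.exp (y / 2))]
  refine ENNReal.ofReal_le_ofReal ((mul_le_mul_of_nonneg_left hRb (by positivity)).trans_eq ?_)
  have e2 : Real.exp (-(1 / 4) * y) = Real.exp (y / 2) * Real.exp (-(3 / 4) * y) := by
    rw [← Real.exp_add]; congr 1; ring
  rw [e2]; ring

lemma exists_trigPoly_near_exp {Q : ℝ → ℂ} (hQ : Q ∈ trigPoly) {ε : ℝ} (hε : 0 < ε) :
    ∃ P ∈ trigPoly, ∀ y, ‖Complex.exp (Q y) - P y‖ ≤ ε := by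
  obtain ⟨C, hC0, hC⟩ := exists_bound_of_mem_trigPoly hQ
  have hlim : Tendsto (fun n : ℕ => C ^ n / n.factorial * 2) atTop (nhds 0) := by
    simpa using (FloorSemiring.tendsto_pow_div_factorial_atTop C).mul_const 2
  obtain ⟨n, hn, hnC⟩ := ((hlim.eventually (ge_mem_nhds hε)).and
    (tendsto_natCast_atTop_atTop.eventually_ge_atTop (2 * C))).exists
  refine ⟨∑ m ∈ Finset.range n, ((m.factorial : ℂ)⁻¹) • Q ^ m,
    trigPoly.sum_mem fun m _ => trigPoly.smul_mem _ (pow_mem_trigPoly hQ m), fun y => ?_⟩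
  have hy : ‖Q y‖ / n.succ ≤ 1 / 2 := by
    rw [div_le_iff₀ (by positivity)]
    push_cast
    linarith [hC y]
  have h1 := Complex.exp_bound' hy
  have e : (∑ m ∈ Finset.range n, ((m.factorial : ℂ)⁻¹) • Q ^ m) y =
      ∑ m ∈ Finset.range n, Q y ^ m / m.factorial := by
    rw [Finset.sum_apply]
    refine Finset.sum_congr rfl fun m _ => ?_
    rw [Pi.smul_apply, Pi.pow_apply, smul_eq_mul, inv_mul_eq_div]
  rw [e]
  refine (h1.trans ?_).trans hn
  gcongr
  exact hC y

lemma norm_exp_mul_I_sub_le (a b : ℝ) :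
    ‖Complex.exp (a * Complex.I) - Complex.exp (b * Complex.I)‖ ≤ |a - b| := by
  have e : Complex.exp (a * Complex.I) - Complex.exp (b * Complex.I) =
      Complex.exp (b * Complex.I) * (Complex.exp (Complex.I * ((a - b : ℝ) : ℂ)) - 1) := by
    rw [mul_sub, ← Complex.exp_add, mul_one]; congr 2; push_cast; ring
  rw [e, norm_mul, Complex.norm_exp_ofReal_mul_I, one_mul]
  exact Real.norm_exp_I_mul_ofReal_sub_one_le

lemma IsB1.exp_mul_I {F : ℝ → ℝ} (hF : IsB1 (fun y => (F y : ℂ))) (hm : Measurable F) (ξ : ℝ) :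
    IsB1 (fun y => Complex.exp (((F y * ξ : ℝ) : ℂ) * Complex.I)) := by
  intro ε hε
  obtain ⟨P, hP, hPF⟩ := hF (ε / 2 / (|ξ| + 1)) (by positivity)
  have hQ : (fun y => ((P y).re : ℂ) * (ξ * Complex.I)) ∈ trigPoly :=
    mul_mem_trigPoly (re_mem_trigPoly hP) (const_mem_trigPoly (ξ * Complex.I))
  obtain ⟨R, hR, hRQ⟩ := exists_trigPoly_near_exp hQ (half_pos hε)
  refine ⟨R, hR, ?_⟩
  filter_upwards [hPF, eventually_ge_atTop 1] with Y hY hY1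
  have hPm := (continuous_of_mem_trigPoly hP).measurable
  have hb : ∀ y, ‖Complex.exp (((F y * ξ : ℝ) : ℂ) * Complex.I) - R y‖ₑ ≤
      ENNReal.ofReal |ξ| * ‖(F y : ℂ) - P y‖ₑ + ENNReal.ofReal (ε / 2) := by
    intro y
    rw [← ofReal_norm, ← ofReal_norm, ← ENNReal.ofReal_mul (abs_nonneg _),
      ← ENNReal.ofReal_add (by positivity) (by positivity)]
    refine ENNReal.ofReal_le_ofReal ((norm_sub_le_norm_sub_add_norm_sub _
      (Complex.exp ((((P y).re * ξ : ℝ) : ℂ) * Complex.I)) _).trans (add_le_add ?_ ?_))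
    · refine (norm_exp_mul_I_sub_le _ _).trans ?_
      rw [← sub_mul, abs_mul, mul_comm]
      gcongr
      have := Complex.abs_re_le_norm ((F y : ℂ) - P y)
      rwa [Complex.sub_re, Complex.ofReal_re] at this
    · have := hRQ y
      rwa [← mul_assoc, ← Complex.ofReal_mul] at this
  calc ∫⁻ y in Ioc 1 Y, ‖Complex.exp (((F y * ξ : ℝ) : ℂ) * Complex.I) - R y‖ₑ
      ≤ ∫⁻ y in Ioc 1 Y, (ENNReal.ofReal |ξ| * ‖(F y : ℂ) - P y‖ₑ + ENNReal.ofReal (ε / 2)) :=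
        lintegral_mono hb
    _ = ENNReal.ofReal |ξ| * (∫⁻ y in Ioc 1 Y, ‖(F y : ℂ) - P y‖ₑ) +
          ENNReal.ofReal (ε / 2) * ENNReal.ofReal (Y - 1) := by
        rw [lintegral_add_right _ measurable_const, lintegral_const_mul _ (by fun_prop),
          lintegral_const, Measure.restrict_apply_univ, Real.volume_Ioc]
    _ ≤ ENNReal.ofReal |ξ| * ENNReal.ofReal (ε / 2 / (|ξ| + 1) * Y) +
          ENNReal.ofReal (ε / 2) * ENNReal.ofReal (Y - 1) := by gcongr
    _ ≤ ENNReal.ofReal (ε * Y) := by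
        rw [← ENNReal.ofReal_mul (abs_nonneg _), ← ENNReal.ofReal_mul (by positivity),
          ← ENNReal.ofReal_add (by positivity) (mul_nonneg (by positivity) (by linarith))]
        refine ENNReal.ofReal_le_ofReal ?_
        have h1 : |ξ| * (ε / 2 / (|ξ| + 1)) ≤ ε / 2 := by
          rw [mul_div_assoc', div_le_iff₀ (by positivity)]
          nlinarith [abs_nonneg ξ]
        nlinarith [mul_le_mul_of_nonneg_right h1 (by linarith : 0 ≤ Y)]

lemma IsB1.exists_mean {G : ℝ → ℂ} (hG : IsB1 G) (hm : Measurable G) :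
    ∃ m : ℂ, Tendsto (fun Y : ℝ => (∫ y in (1 : ℝ)..Y, G y) / (Y : ℂ)) atTop (nhds m) := by
  rw [← cauchy_map_iff_exists_tendsto, Metric.cauchy_iff]
  refine ⟨inferInstance, fun ε hε => ?_⟩
  obtain ⟨C, hC0, hC⟩ := hG.boundedMean hm
  obtain ⟨P, hP, hPG⟩ := hG (ε / 4) (by positivity)
  obtain ⟨m, hmP⟩ := exists_mean_of_mem_trigPoly hP
  have hPc := continuous_of_mem_trigPoly hP
  have hd : ∀ᶠ Y : ℝ in atTop, dist ((∫ y in (1 : ℝ)..Y, G y) / (Y : ℂ)) m < ε / 2 := by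
    filter_upwards [hPG, eventually_ge_atTop 1, (Metric.tendsto_nhds.mp hmP) (ε / 4) (by positivity)]
      with Y h1 hY h2
    have hY0 : 0 < Y := by linarith
    have hGi : IntervalIntegrable G volume 1 Y := by
      rw [intervalIntegrable_iff_integrableOn_Ioc_of_le hY]
      exact ⟨hm.aestronglyMeasurable, (hC Y hY).trans_lt ENNReal.ofReal_lt_top⟩
    have h3 : dist ((∫ y in (1 : ℝ)..Y, G y) / (Y : ℂ)) ((∫ y in (1 : ℝ)..Y, P y) / (Y : ℂ)) ≤
        ε / 4 := by
      rw [dist_eq_norm, ← sub_div, ← intervalIntegral.integral_sub hGi (hPc.intervalIntegrable _ _),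
        norm_div, Complex.norm_real, Real.norm_of_nonneg hY0.le, div_le_iff₀ hY0,
        intervalIntegral.integral_of_le hY]
      have h4 := (enorm_integral_le_lintegral_enorm _).trans h1
      rwa [← ofReal_norm, ENNReal.ofReal_le_ofReal_iff (by positivity)] at h4
    linarith [dist_triangle ((∫ y in (1 : ℝ)..Y, G y) / (Y : ℂ))
      ((∫ y in (1 : ℝ)..Y, P y) / (Y : ℂ)) m]
  refine ⟨_, image_mem_map hd, ?_⟩
  rintro _ ⟨Y, hY, rfl⟩ _ ⟨Z, hZ, rfl⟩
  have hY : dist _ m < ε / 2 := hY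
  have hZ : dist _ m < ε / 2 := hZ
  linarith [dist_triangle_right ((∫ y in (1 : ℝ)..Y, G y) / (Y : ℂ))
    ((∫ y in (1 : ℝ)..Z, G y) / (Z : ℂ)) m]

/-- The law of `F` under the uniform distribution on `(1, max Y 2]`. -/
noncomputable def uniformLaw (F : ℝ → ℝ) (Y : ℝ) : Measure ℝ :=
  (ProbabilityTheory.cond volume (Ioc 1 (max Y 2))).map F

lemma isProbabilityMeasure_uniformLaw {F : ℝ → ℝ} (hF : Measurable F) (Y : ℝ) :
    IsProbabilityMeasure (uniformLaw F Y) := by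
  have h2 := le_max_right Y 2
  have : IsProbabilityMeasure (ProbabilityTheory.cond volume (Ioc 1 (max Y 2))) := by
    refine ProbabilityTheory.cond_isProbabilityMeasure_of_finite ?_ ?_
    · rw [Real.volume_Ioc, ne_eq, ENNReal.ofReal_eq_zero]; linarith
    · rw [Real.volume_Ioc]; exact ENNReal.ofReal_ne_top
  exact Measure.isProbabilityMeasure_map hF.aemeasurable

lemma integral_uniformLaw {E : Type*} [NormedAddCommGroup E] [NormedSpace ℝ E] {F : ℝ → ℝ}
    (hF : Measurable F) {f : ℝ → E} (hf : Continuous f) {Y : ℝ} (hY : 2 ≤ Y) :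
    ∫ t, f t ∂uniformLaw F Y = (Y - 1)⁻¹ • ∫ y in (1 : ℝ)..Y, f (F y) := by
  rw [uniformLaw, integral_map hF.aemeasurable hf.aestronglyMeasurable,
    ProbabilityTheory.cond, integral_smul_measure, max_eq_left hY, Real.volume_Ioc,
    intervalIntegral.integral_of_le (by linarith), ENNReal.toReal_inv,
    ENNReal.toReal_ofReal (by linarith)]

lemma tendsto_inv_sub_one_smul_iff {E : Type*} [NormedAddCommGroup E] [NormedSpace ℝ E]
    {g : ℝ → E} {m : E} :
    Tendsto (fun Y : ℝ => (Y - 1)⁻¹ • g Y) atTop (nhds m) ↔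
      Tendsto (fun Y : ℝ => Y⁻¹ • g Y) atTop (nhds m) := by
  have h0 : Tendsto (fun Y : ℝ => Y⁻¹) atTop (nhds 0) := tendsto_inv_atTop_zero
  have h1 : Tendsto (fun Y : ℝ => 1 - Y⁻¹) atTop (nhds 1) := by
    simpa using h0.const_sub 1
  have h2 : Tendsto (fun Y : ℝ => (1 - Y⁻¹)⁻¹) atTop (nhds 1) := by
    simpa using h1.inv₀ one_ne_zero
  constructor
  · intro h
    refine (one_smul ℝ m ▸ h1.smul h).congr' ?_
    filter_upwards [eventually_gt_atTop 1] with Y hY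
    have : Y - 1 ≠ 0 := by linarith
    rw [smul_smul]
    congr 1
    field_simp
  · intro h
    refine (one_smul ℝ m ▸ h2.smul h).congr' ?_
    filter_upwards [eventually_gt_atTop 1] with Y hY
    have : Y - 1 ≠ 0 := by linarith
    rw [smul_smul, ← mul_inv]
    congr 2
    field_simp

lemma isTightMeasureSet_uniformLaw {F : ℝ → ℝ} (hF : Measurable F)
    (hb : BoundedMean fun y => ‖F y‖ₑ) : IsTightMeasureSet (Set.range (uniformLaw F)) := by
  obtain ⟨C, hC0, hC⟩ := hb
  refine isTightMeasureSet_of_tendsto_measure_norm_gt ?_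
  have hlim : Tendsto (fun r : ℝ => ENNReal.ofReal (2 * C / r)) atTop (nhds 0) := by
    rw [← ENNReal.ofReal_zero]
    exact ENNReal.tendsto_ofReal (tendsto_const_nhds.div_atTop tendsto_id)
  refine tendsto_of_tendsto_of_tendsto_of_le_of_le' tendsto_const_nhds hlim
    (Eventually.of_forall fun _ => zero_le) ?_
  filter_upwards [eventually_gt_atTop 0] with r hr
  refine iSup₂_le ?_
  rintro _ ⟨Y, rfl⟩
  set Z := max Y 2 with hZ
  have hZ2 : 2 ≤ Z := le_max_right _ _
  have hset : MeasurableSet {x : ℝ | r < ‖x‖} := measurableSet_lt measurable_const measurable_norm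
  have hlaw : ∫⁻ t, ‖t‖ₑ ∂uniformLaw F Y ≤ ENNReal.ofReal (2 * C) := by
    rw [uniformLaw, lintegral_map measurable_enorm hF, ProbabilityTheory.cond,
      lintegral_smul_measure, ← hZ, Real.volume_Ioc, smul_eq_mul,
      ← ENNReal.ofReal_inv_of_pos (by linarith)]
    refine (mul_le_mul_right (hC Z (by linarith)) _).trans ?_
    rw [← ENNReal.ofReal_mul (inv_nonneg.mpr (by linarith))]
    refine ENNReal.ofReal_le_ofReal ?_
    rw [inv_mul_le_iff₀ (by linarith)]
    nlinarith
  have hmark := mul_meas_ge_le_lintegral (μ := uniformLaw F Y) measurable_enorm (ENNReal.ofReal r)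
  have hsub : {x : ℝ | r < ‖x‖} ⊆ {x : ℝ | ENNReal.ofReal r ≤ ‖x‖ₑ} := fun x hx => by
    rw [mem_ofPred_eq, ← ofReal_norm]
    exact ENNReal.ofReal_le_ofReal (le_of_lt hx)
  rw [ENNReal.ofReal_div_of_pos hr, ENNReal.le_div_iff_mul_le
    (Or.inl (by simpa using hr)) (Or.inl ENNReal.ofReal_ne_top), mul_comm]
  exact ((mul_le_mul_right (measure_mono hsub) _).trans hmark).trans hlaw

lemma IsB1.exists_tendsto_charFun {F : ℝ → ℝ} (hF : IsB1 (fun y => (F y : ℂ)))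
    (hm : Measurable F) (ξ : ℝ) :
    ∃ m : ℂ, Tendsto (fun Y => charFun (uniformLaw F Y) ξ) atTop (nhds m) := by
  obtain ⟨m, h⟩ := (hF.exp_mul_I hm ξ).exists_mean (by fun_prop)
  refine ⟨m, ?_⟩
  have h1 : Tendsto (fun Y : ℝ => Y⁻¹ • ∫ y in (1 : ℝ)..Y,
      Complex.exp (((F y * ξ : ℝ) : ℂ) * Complex.I)) atTop (nhds m) := by
    refine h.congr fun Y => ?_
    rw [Complex.real_smul, Complex.ofReal_inv, div_eq_inv_mul]
  refine (tendsto_inv_sub_one_smul_iff.mpr h1).congr' ?_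
  filter_upwards [eventually_ge_atTop 2] with Y hY
  rw [charFun_apply_real, integral_uniformLaw hm (by fun_prop) hY]
  congr 1
  refine intervalIntegral.integral_congr fun y _ => ?_
  simp only [Complex.ofReal_mul]
  ring_nf

theorem IsB1.exists_limiting_distribution {F : ℝ → ℝ} (hF : IsB1 (fun y => (F y : ℂ)))
    (hm : Measurable F) :
    ∃ μ : ProbabilityMeasure ℝ, ∀ f : BoundedContinuousFunction ℝ ℝ,
      Tendsto (fun Y : ℝ => Y⁻¹ * ∫ y in (1 : ℝ)..Y, f (F y)) atTop (nhds (∫ t, f t ∂μ)) := by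
  let ν : ℝ → ProbabilityMeasure ℝ := fun Y => ⟨uniformLaw F Y, isProbabilityMeasure_uniformLaw hm Y⟩
  have hb : BoundedMean fun y => ‖F y‖ₑ := by
    have := hF.boundedMean (Complex.measurable_ofReal.comp hm)
    simpa only [← ofReal_norm, Complex.norm_real, Real.norm_eq_abs, abs_abs] using this
  have htight : IsTightMeasureSet {((ν Y : ProbabilityMeasure ℝ) : Measure ℝ) | Y} :=
    isTightMeasureSet_uniformLaw hm hb
  have hcomp : IsCompact (closure {ν Y | Y}) :=
    isCompact_closure_of_isTightMeasureSet (by simpa using htight)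
  obtain ⟨μ, -, hμ⟩ := hcomp.ultrafilter_le_nhds ((Ultrafilter.of atTop).map ν)
    (.trans (by simp) (monotone_principal subset_closure))
  have hμ : Tendsto ν (Ultrafilter.of atTop : Ultrafilter ℝ) (nhds μ) := hμ
  have hchar : ∀ ξ, Tendsto (fun Y => charFun (ν Y) ξ) atTop (nhds (charFun (μ : Measure ℝ) ξ)) := by
    intro ξ
    obtain ⟨m, h⟩ := hF.exists_tendsto_charFun hm ξ
    have h1 : Tendsto (fun Y => charFun (ν Y) ξ) (Ultrafilter.of atTop : Ultrafilter ℝ)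
        (nhds (charFun (μ : Measure ℝ) ξ)) := by
      rw [ProbabilityMeasure.tendsto_iff_forall_integral_rclike_tendsto ℂ] at hμ
      simp_rw [charFun_eq_integral_innerProbChar]
      exact hμ _
    exact tendsto_nhds_unique h1 (h.mono_left (Ultrafilter.of_le _)) ▸ h
  have hlim : Tendsto ν atTop (nhds μ) := by
    refine ProbabilityMeasure.tendsto_of_tight_of_separatesPoints htight (𝕜 := ℂ)
      (A := BoundedContinuousFunction.charPoly continuous_probChar
        (L := innerₗ ℝ) continuous_inner) ?_ ?_
    · refine BoundedContinuousFunction.separatesPoints_charPoly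
        continuous_probChar probChar_ne_one _ ?_
      exact fun v hv => DFunLike.ne_iff.mpr ⟨v, inner_self_ne_zero.mpr hv⟩
    · exact fun g => ProbabilityMeasure.tendsto_charPoly_of_tendsto_charFun hchar
  refine ⟨μ, fun f => ?_⟩
  have h1 := ProbabilityMeasure.tendsto_iff_forall_integral_tendsto.mp hlim f
  refine tendsto_inv_sub_one_smul_iff.mp (h1.congr' ?_)
  filter_upwards [eventually_ge_atTop 2] with Y hY
  exact integral_uniformLaw hm f.continuous hY

/-- Assuming RH, `E_M` has a logarithmic limiting distribution: there is a Borel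
probability measure `μ_M` on `ℝ` such that for every bounded continuous `f : ℝ → ℝ`,
`(1/log x) ∫_2^x f(E_M(t)) dt/t → ∫ f dμ_M` as `x → ∞`. -/
theorem exists_limiting_distribution_EM (hRH : RiemannHypothesis) :
    ∃ μM : Measure ℝ, IsProbabilityMeasure μM ∧
      ∀ f : ℝ → ℝ, Continuous f → (∃ B : ℝ, ∀ t : ℝ, |f t| ≤ B) →
        Tendsto (fun x : ℝ => (∫ t in Set.Icc 2 x, f (EM t) / t) / Real.log x)
          atTop (nhds (∫ t, f t ∂μM)) := by
  have hm : Measurable fun y => EM (Real.exp y) := measurable_EM.comp Real.measurable_exp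
  obtain ⟨μ, hμ⟩ := (isB1_EM_exp hRH).exists_limiting_distribution hm
  refine ⟨μ, μ.prop, fun f hf ⟨B, hB⟩ => ?_⟩
  have h1 := (hμ (BoundedContinuousFunction.ofNormedAddCommGroup f hf B hB)).comp
    Real.tendsto_log_atTop
  set c := ∫ y in Real.log 2..1, f (EM (Real.exp y)) with hc
  have h2 : Tendsto (fun x => c / Real.log x) atTop (nhds 0) :=
    tendsto_const_nhds.div_atTop Real.tendsto_log_atTop
  have h3 := h2.add h1
  rw [zero_add] at h3
  refine h3.congr' ?_
  filter_upwards [eventually_ge_atTop 2] with x hx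
  have hx0 : 0 < x := by linarith
  have hi : ∀ a b, IntervalIntegrable (fun y => f (EM (Real.exp y))) volume a b := fun a b =>
    (intervalIntegrable_const (c := B)).mono_fun' (hf.measurable.comp hm).aestronglyMeasurable
      (ae_of_all _ fun y => hB _)
  have e : ∫ t in Icc 2 x, f (EM t) / t =
      c + ∫ y in (1 : ℝ)..Real.log x, f (EM (Real.exp y)) := by
    rw [hc, intervalIntegral.integral_add_adjacent_intervals (hi _ _) (hi _ _),
      intervalIntegral.integral_of_le (Real.log_le_log two_pos hx), integral_Icc_eq_integral_Ioc]
    have := setIntegral_Ioc_eq_log (fun t => f (EM t) / t) two_pos (y := Real.log x)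
    rw [Real.exp_log hx0] at this
    rw [this]
    refine integral_congr_ae (ae_of_all _ fun w => ?_)
    simp only
    rw [mul_div_cancel₀ _ (Real.exp_ne_zero w)]
  rw [e, add_div, div_eq_inv_mul (∫ y in (1 : ℝ)..Real.log x, f (EM (Real.exp y)))]
  rfl
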